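/- arXiv:2508.08085 — 2 statements merged into one kernel-verified Lean document; each statement's English description precedes it below -/
import Mathlib

section
/- Integral representation for a single Ferrers function of the first kind. Let ν, μ ∈ ℂ with Re(μ+ν) > −3 and Re(μ−ν) > 0, with ν−μ−1 ≠ 0 and neither (μ−ν+2)/2 nor (ν+μ+1)/2 a nonpositive integer, and let x be a real number in (−1,1). Assume that the function t ↦ 𝖯_ν^{−μ}(t) · (1−t²)^{−1} · P_ν((2 − x² − t²)/(2√((1−x²)(1−t²)))) is absolutely integrable on (x, 1) (note (2 − x² − t²)/(2√((1−x²)(1−t²))) ≥ 1 for t ∈ (x,1)). Then 𝖯_ν^{−μ}(x) = [2(ν−μ) Γ((μ−ν+3)/2) Γ((ν+μ+2)/2)] / [(ν−μ−1) Γ((μ−ν+2)/2) Γ((ν+μ+1)/2)] × ∫_x^1 𝖯_ν^{−μ}(t) · (1−t²)^{−1} · P_ν((2 − x² − t²)/(2√((1−x²)(1−t²)))) dt. -/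
open MeasureTheory Set

/-- The regularized Gauss hypergeometric function `₂F̃₁(a,b;c;z)`. -/
noncomputable def hyp2F1reg (a b c z : ℂ) : ℂ :=
  ∑' n : ℕ, (ascPochhammer ℂ n).eval a * (ascPochhammer ℂ n).eval b /
      (Complex.Gamma (c + n) * (n.factorial : ℂ)) * z ^ n

/-- The Jacobi function of the second kind `Q_γ^{(α,β)}(z)` for real `z > 1`. -/
noncomputable def jacobiQ (α β γ : ℂ) (z : ℝ) : ℂ :=
  (2 : ℂ) ^ (α + β + γ) * Complex.Gamma (α + γ + 1) * Complex.Gamma (β + γ + 1) *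
    ((z : ℂ) - 1) ^ (-α) * ((z : ℂ) + 1) ^ (-β - γ - 1) *
    hyp2F1reg (γ + 1) (β + γ + 1) (α + β + 2 * γ + 2) (2 / (1 + (z : ℂ)))

/-- The Jacobi function of the first kind `P_γ^{(α,β)}(z)` for real `z > 1`. -/
noncomputable def jacobiP (α β γ : ℂ) (z : ℝ) : ℂ :=
  Complex.Gamma (α + γ + 1) / Complex.Gamma (γ + 1) * (((z : ℂ) + 1) / 2) ^ γ *
    hyp2F1reg (-γ) (-β - γ) (α + 1) (((z : ℂ) - 1) / ((z : ℂ) + 1))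

/-- The Jacobi function of the first kind on the cut `𝖯_γ^{(α,β)}(x)`, `x ∈ (−1,1)`. -/
noncomputable def jacobiPcut (α β γ : ℂ) (x : ℝ) : ℂ :=
  Complex.Gamma (α + γ + 1) / Complex.Gamma (γ + 1) *
    hyp2F1reg (-γ) (α + β + γ + 1) (α + 1) ((1 - (x : ℂ)) / 2)

/-- The Gegenbauer function of the first kind `C_λ^α(z)` for real `z > 1`. -/
noncomputable def gegenbauerC (lam α : ℂ) (z : ℝ) : ℂ :=
  (Real.sqrt Real.pi : ℂ) * Complex.Gamma (lam + 2 * α) /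
      ((2 : ℂ) ^ (2 * α - 1) * Complex.Gamma α * Complex.Gamma (lam + 1)) *
    (((z : ℂ) + 1) / 2) ^ lam *
    hyp2F1reg (-lam) (1 / 2 - α - lam) (α + 1 / 2) (((z : ℂ) - 1) / ((z : ℂ) + 1))

/-- The Gegenbauer function of the first kind on the cut `𝖢_λ^α(x)`, `x ∈ (−1,1)`. -/
noncomputable def gegenbauerCcut (lam α : ℂ) (x : ℝ) : ℂ :=
  (Real.sqrt Real.pi : ℂ) * Complex.Gamma (lam + 2 * α) /
      ((2 : ℂ) ^ (2 * α - 1) * Complex.Gamma α * Complex.Gamma (lam + 1)) *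
    hyp2F1reg (-lam) (lam + 2 * α) (α + 1 / 2) ((1 - (x : ℂ)) / 2)

/-- The Gegenbauer function of the second kind `D_λ^α(z)` for real `z > 1`. -/
noncomputable def gegenbauerD (lam α : ℂ) (z : ℝ) : ℂ :=
  Complex.exp ((Real.pi : ℂ) * Complex.I * α) * (Complex.Gamma (lam + 2 * α) / Complex.Gamma α) *
    (2 * (z : ℂ)) ^ (-lam - 2 * α) *
    hyp2F1reg (lam / 2 + α) (lam / 2 + α + 1 / 2) (lam + α + 1) (1 / (z : ℂ) ^ 2)

/-- The associated Legendre function of the second kind `Q_ν^μ(z)` for real `z > 1`. -/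
noncomputable def legendreQ (ν μ : ℂ) (z : ℝ) : ℂ :=
  (Real.sqrt Real.pi : ℂ) * Complex.exp ((Real.pi : ℂ) * Complex.I * μ) *
    Complex.Gamma (ν + μ + 1) * ((z : ℂ) ^ 2 - 1) ^ (μ / 2) * (2 : ℂ) ^ (-ν - 1) *
    (z : ℂ) ^ (-ν - μ - 1) *
    hyp2F1reg ((ν + μ + 1) / 2) ((ν + μ + 2) / 2) (ν + 3 / 2) (1 / (z : ℂ) ^ 2)

/-- The Legendre function of the first kind `P_ν(z)` for real `z ≥ 1`. -/
noncomputable def legendreP (ν : ℂ) (z : ℝ) : ℂ :=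
  (((z : ℂ) + 1) / 2) ^ ν * hyp2F1reg (-ν) (-ν) 1 (((z : ℂ) - 1) / ((z : ℂ) + 1))

/-- The associated Legendre function of the first kind of order `−μ`, `P_ν^{−μ}(z)`, `z > 1`. -/
noncomputable def legendrePa (ν μ : ℂ) (z : ℝ) : ℂ :=
  (((z : ℂ) - 1) / ((z : ℂ) + 1)) ^ (μ / 2) * (((z : ℂ) + 1) / 2) ^ ν *
    hyp2F1reg (-ν) (μ - ν) (μ + 1) (((z : ℂ) - 1) / ((z : ℂ) + 1))

/-- The Ferrers function of the first kind of order `−μ`, `𝖯_ν^{−μ}(x)`, `x ∈ (−1,1)`. -/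
noncomputable def ferrersP (ν μ : ℂ) (x : ℝ) : ℂ :=
  ((1 - (x : ℂ)) / (1 + (x : ℂ))) ^ (μ / 2) * hyp2F1reg (-ν) (ν + 1) (1 + μ) ((1 - (x : ℂ)) / 2)

/-- The Ferrers function of the second kind of order `−μ`, `𝖰_ν^{−μ}(x)`, `x ∈ (−1,1)`. -/
noncomputable def ferrersQ (ν μ : ℂ) (x : ℝ) : ℂ :=
  -((Real.pi : ℂ) / (2 * Complex.sin ((Real.pi : ℂ) * μ))) *
    (Complex.cos ((Real.pi : ℂ) * (ν - μ)) *
        (Complex.Gamma (ν - μ + 1) / Complex.Gamma (ν + μ + 1)) *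
        ((1 + (x : ℂ)) / (1 - (x : ℂ))) ^ (-μ / 2) *
        hyp2F1reg (-ν) (ν + 1) (1 - μ) ((1 + (x : ℂ)) / 2) -
      Complex.cos ((Real.pi : ℂ) * ν) * ((1 - (x : ℂ)) / (1 + (x : ℂ))) ^ (-μ / 2) *
        hyp2F1reg (-ν) (ν + 1) (1 + μ) ((1 + (x : ℂ)) / 2))

namespace FSI
open Filter Topology

/-- coefficient sequences with radius of convergence at least one -/
def Good (p : ℕ → ℂ) : Prop := ∀ ρ : ℝ, 0 < ρ → ρ < 1 → Summable (fun n => ‖p n‖ * ρ ^ n)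

/-- power series -/
noncomputable def PS (p : ℕ → ℂ) (z : ℂ) : ℂ := ∑' n, p n * z ^ n

/-- derived sequence -/
noncomputable def dp (p : ℕ → ℂ) : ℕ → ℂ := fun n => (n + 1) * p (n + 1)

theorem Good.dp {p : ℕ → ℂ} (hp : Good p) : Good (dp p) := by
  intro ρ h0 h1
  obtain ⟨r, hr0, hr1⟩ := exists_between h1
  have hrpos : 0 < r := h0.trans hr0
  have hs := hp r hrpos hr1
  obtain ⟨M, hM⟩ : ∃ M, ∀ n, ‖p n‖ * r ^ n ≤ M := by
    have := hs.tendsto_atTop_zero.bddAbove_range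
    obtain ⟨M, hM⟩ := this
    exact ⟨M, fun n => hM ⟨n, rfl⟩⟩
  have hq : ‖ρ / r‖ < 1 := by
    rw [Real.norm_of_nonneg (by positivity)]; exact (div_lt_one hrpos).2 hr0
  have s1 := summable_pow_mul_geometric_of_norm_lt_one 1 hq
  have s0 := summable_pow_mul_geometric_of_norm_lt_one 0 hq
  have s2 := ((s1.add s0).mul_left (M / r))
  refine Summable.of_nonneg_of_le (fun n => by positivity) (fun n => ?_) s2
  have h := hM (n + 1)
  have e : ‖FSI.dp p n‖ * ρ ^ n = (n + 1) * (‖p (n + 1)‖ * r ^ (n + 1)) * ((ρ / r) ^ n / r) := by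
    unfold FSI.dp
    have : ‖((n : ℂ) + 1)‖ = n + 1 := by
      have := Complex.norm_natCast (n + 1); push_cast at this; exact this
    rw [norm_mul, this, div_pow]; field_simp; ring
  rw [e]
  calc _ ≤ (n + 1) * M * ((ρ / r) ^ n / r) := by gcongr
    _ = _ := by field_simp

theorem Good.summable {p : ℕ → ℂ} (hp : Good p) {z : ℂ} (hz : ‖z‖ < 1) :
    Summable (fun n => p n * z ^ n) := by
  obtain ⟨r, hr0, hr1⟩ := exists_between hz
  have hrpos : 0 < r := (norm_nonneg z).trans_lt hr0
  refine Summable.of_norm_bounded (hp r hrpos hr1) (fun n => ?_)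
  rw [norm_mul, norm_pow]; gcongr

theorem Good.hasDerivAt {p : ℕ → ℂ} (hp : Good p) {z : ℂ} (hz : ‖z‖ < 1) :
    HasDerivAt (PS p) (PS (FSI.dp p) z) z := by
  obtain ⟨r, hr0, hr1⟩ := exists_between hz
  have hrpos : 0 < r := (norm_nonneg z).trans_lt hr0
  have hd := hp.dp r hrpos hr1
  have hu : Summable (fun n : ℕ => ‖(n : ℂ) * p n‖ * r ^ (n - 1)) := by
    rw [← summable_nat_add_iff 1]
    refine hd.congr (fun n => ?_)
    simp [FSI.dp]
  have key := hasDerivAt_tsum_of_isPreconnected (g := fun n z => p n * z ^ n)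
    (g' := fun n z => p n * (n * z ^ (n - 1))) hu (Metric.isOpen_ball (x := (0 : ℂ)) (ε := r))
    (convex_ball (0 : ℂ) r).isPreconnected
    (fun n y _ => by simpa using (hasDerivAt_pow n y).const_mul (p n))
    (fun n y hy => by
      have : ‖y‖ < r := by simpa using hy
      rw [norm_mul, norm_mul, norm_mul, norm_pow]
      calc ‖p n‖ * (‖(n : ℂ)‖ * ‖y‖ ^ (n - 1)) ≤ ‖p n‖ * (‖(n : ℂ)‖ * r ^ (n - 1)) := by gcongr
        _ = _ := by ring)
    (y₀ := z) (y := z) (by simpa using hr0) (hp.summable hz) (by simpa using hr0)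
  have hs : Summable (fun n : ℕ => p n * (n * z ^ (n - 1))) := by
    refine Summable.of_norm_bounded hu (fun n => ?_)
    rw [norm_mul, norm_mul, norm_mul, norm_pow]
    calc ‖p n‖ * (‖(n : ℂ)‖ * ‖z‖ ^ (n - 1)) ≤ ‖p n‖ * (‖(n : ℂ)‖ * r ^ (n - 1)) := by gcongr
        _ = _ := by ring
  rw [hs.tsum_eq_zero_add] at key
  have e : PS (FSI.dp p) z = p 0 * ((0 : ℕ) * z ^ (0 - 1)) +
      ∑' b : ℕ, p (b + 1) * (((b + 1 : ℕ) : ℂ) * z ^ (b + 1 - 1)) := by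
    simp only [PS, FSI.dp]
    simp only [Nat.cast_zero, zero_mul, mul_zero, zero_add]
    refine tsum_congr (fun n => ?_)
    push_cast; ring
  rw [e]; exact key

/-- hypergeometric ODE -/
theorem hyp_ode {p : ℕ → ℂ} (hp : Good p) (a b c : ℂ)
    (hrec : ∀ n : ℕ, ((n : ℂ) + 1) * (n + c) * p (n + 1) = (n + a) * (n + b) * p n)
    {z : ℂ} (hz : ‖z‖ < 1) :
    z * (1 - z) * PS (dp (dp p)) z + (c - (a + b + 1) * z) * PS (dp p) z - a * b * PS p z = 0 := by
  have s0 := hp.summable hz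
  have s1 := hp.dp.summable hz
  have s2 := hp.dp.dp.summable hz
  -- z * PS (dp q) = Σ n q_n z^n
  have shift : ∀ q : ℕ → ℂ, Good q → HasSum (fun n : ℕ => (n : ℂ) * q n * z ^ n) (z * PS (dp q) z) := by
    intro q hq
    have h := (hq.dp.summable hz).hasSum.mul_left z
    rw [← hasSum_nat_add_iff' 1]
    simp only [Finset.range_one, Finset.sum_singleton, Nat.cast_zero, zero_mul, sub_zero]
    refine h.congr_fun (fun n => ?_) |> fun h => h
    simp only [dp]; push_cast; ring
  have h0 : HasSum (fun n => p n * z ^ n) (PS p z) := s0.hasSum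
  have h1 : HasSum (fun n => dp p n * z ^ n) (PS (dp p) z) := s1.hasSum
  have t1 := shift p hp
  have t2 := shift (dp p) hp.dp
  have t3 : HasSum (fun n : ℕ => (n : ℂ) * (n - 1) * p n * z ^ n) (z * (z * PS (dp (dp p)) z)) := by
    have h := t2.mul_left z
    rw [← hasSum_nat_add_iff' 1]
    simp only [Finset.range_one, Finset.sum_singleton, Nat.cast_zero, zero_mul, sub_zero]
    refine h.congr_fun (fun n => ?_) |> fun h => h
    simp only [dp]; push_cast; ring
  have tot := ((t2.sub t3).add ((h1.mul_left c).sub (t1.mul_left (a + b + 1)))).sub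
    (h0.mul_left (a * b))
  have hz0 : HasSum (fun _ : ℕ => (0 : ℂ)) 0 := hasSum_zero
  have := tot.unique (hz0.congr_fun (fun n => ?_))
  · linear_combination this
  · have := hrec n
    simp only [dp]
    linear_combination (z ^ n) * this

theorem tendsto_ratio (a c : ℂ) :
    Tendsto (fun n : ℕ => ((n : ℂ) + a) / (n + c)) atTop (𝓝 1) := by
  have h1 := tendsto_natCast_div_add_atTop (𝕜 := ℂ) a
  have h2 := tendsto_natCast_div_add_atTop (𝕜 := ℂ) c
  have h := h2.div h1 one_ne_zero
  rw [div_one] at h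
  refine h.congr' ?_
  filter_upwards [eventually_gt_atTop 0] with n hn
  have : (n : ℂ) ≠ 0 := by exact_mod_cast hn.ne'
  simp only [Pi.div_apply]
  field_simp

theorem eventually_add_ne (c : ℂ) : ∀ᶠ n : ℕ in atTop, (n : ℂ) + c ≠ 0 := by
  obtain ⟨N, hN⟩ := exists_nat_gt ‖c‖
  filter_upwards [eventually_ge_atTop N] with n hn h
  have : (n : ℂ) = -c := by linear_combination h
  have h2 : ‖(n : ℂ)‖ = ‖c‖ := by rw [this, norm_neg]
  rw [Complex.norm_natCast] at h2
  have : (N : ℝ) ≤ n := by exact_mod_cast hn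
  linarith

theorem good_of_rec {p : ℕ → ℂ} (a b c : ℂ)
    (hrec : ∀ n : ℕ, ((n : ℂ) + 1) * (n + c) * p (n + 1) = (n + a) * (n + b) * p n) : Good p := by
  intro ρ h0 h1
  obtain ⟨r, hr0, hr1⟩ := exists_between h1
  have ht := ((tendsto_ratio a 1).mul (tendsto_ratio b c)).norm
  simp only [mul_one, norm_one] at ht
  have hev : ∀ᶠ n : ℕ in atTop, ‖((n : ℂ) + a) / (n + 1) * (((n : ℂ) + b) / (n + c))‖ < r / ρ :=
    ht.eventually_lt_const ((one_lt_div h0).2 hr0)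
  refine summable_of_ratio_norm_eventually_le hr1 ?_
  filter_upwards [hev, eventually_add_ne c, eventually_add_ne 1] with n h hc h1'
  have e : p (n + 1) = (((n : ℂ) + a) / (n + 1) * (((n : ℂ) + b) / (n + c))) * p n := by
    field_simp
    linear_combination hrec n
  rw [Real.norm_of_nonneg (by positivity), Real.norm_of_nonneg (by positivity), e, norm_mul]
  calc _ ≤ (r / ρ) * ‖p n‖ * ρ ^ (n + 1) := by gcongr
    _ = _ := by field_simp; ring

/-- coefficients of the regularized hypergeometric series -/
noncomputable def hc (a b c : ℂ) (n : ℕ) : ℂ :=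
  (ascPochhammer ℂ n).eval a * (ascPochhammer ℂ n).eval b /
      (Complex.Gamma (c + n) * (n.factorial : ℂ))

theorem hc_rec (a b c : ℂ) (n : ℕ) :
    ((n : ℂ) + 1) * (n + c) * hc a b c (n + 1) = (n + a) * (n + b) * hc a b c n := by
  unfold hc
  have h := Complex.one_div_Gamma_eq_self_mul_one_div_Gamma_add_one (c + n)
  rw [ascPochhammer_succ_eval, ascPochhammer_succ_eval, Nat.factorial_succ]
  have h1 : (n : ℂ) + 1 ≠ 0 := by exact_mod_cast Nat.succ_ne_zero n
  have h2 : (n.factorial : ℂ) ≠ 0 := by exact_mod_cast n.factorial_ne_zero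
  push_cast
  rw [← add_assoc, div_eq_mul_inv, div_eq_mul_inv, mul_inv, mul_inv, mul_inv, h]
  field_simp
  ring

theorem hc_good (a b c : ℂ) : Good (hc a b c) := good_of_rec a b c (hc_rec a b c)

theorem hyp_eq (a b c z : ℂ) : hyp2F1reg a b c z = PS (hc a b c) z := rfl

theorem PS_zero (p : ℕ → ℂ) : PS p 0 = p 0 := by
  unfold PS
  rw [tsum_eq_single 0]
  · simp
  · intro n hn; simp [hn]

end FSI

namespace FSI
open Filter Topology

theorem hasDerivAt_tanh (r : ℝ) : HasDerivAt Real.tanh (1 - Real.tanh r ^ 2) r := by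
  have h := (Real.hasDerivAt_sinh r).div (Real.hasDerivAt_cosh r) (Real.cosh_pos r).ne'
  have e : Real.tanh = (Real.sinh / Real.cosh) := by
    ext x; simp [Real.tanh_eq_sinh_div_cosh]
  rw [e]
  refine HasDerivAt.congr_deriv h ?_
  have := (Real.cosh_pos r).ne'
  rw [Pi.div_apply]
  field_simp

theorem tanh_lt (r : ℝ) : Real.tanh r < 1 := Real.tanh_lt_one r
theorem lt_tanh (r : ℝ) : -1 < Real.tanh r := Real.neg_one_lt_tanh r

/-- log cosh -/
noncomputable def lc (r : ℝ) : ℝ := Real.log (Real.cosh r)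

theorem hasDerivAt_lc (r : ℝ) : HasDerivAt lc (Real.tanh r) r := by
  have h := (Real.hasDerivAt_cosh r).log (Real.cosh_pos r).ne'
  rw [← Real.tanh_eq_sinh_div_cosh] at h
  exact h

/-- Ferrers function in the variable `r` with `x = tanh r` -/
noncomputable def fF (ν μ : ℂ) (r : ℝ) : ℂ :=
  Complex.exp (-μ * r) * PS (hc (-ν) (ν + 1) (1 + μ)) (((1 - Real.tanh r) / 2 : ℝ) : ℂ)

noncomputable def fF1 (ν μ : ℂ) (r : ℝ) : ℂ :=
  Complex.exp (-μ * r) * (-μ * PS (hc (-ν) (ν + 1) (1 + μ)) (((1 - Real.tanh r) / 2 : ℝ) : ℂ) +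
    (-((1 - Real.tanh r ^ 2) / 2 : ℝ) : ℂ) *
      PS (dp (hc (-ν) (ν + 1) (1 + μ))) (((1 - Real.tanh r) / 2 : ℝ) : ℂ))

theorem exp_two_mul_tanh (r : ℝ) : (1 - Real.tanh r) / (1 + Real.tanh r) = Real.exp (-2 * r) := by
  have h1 := (Real.cosh_pos r).ne'
  have h2 : 1 + Real.tanh r ≠ 0 := by linarith [lt_tanh r]
  rw [div_eq_iff h2, Real.tanh_eq_sinh_div_cosh, Real.sinh_eq, Real.cosh_eq]
  have e : Real.exp (-2 * r) = Real.exp (-r) * Real.exp (-r) := by rw [← Real.exp_add]; ring_nf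
  have e2 : Real.exp r * Real.exp (-r) = 1 := by rw [← Real.exp_add]; simp
  rw [e]
  have : Real.exp r + Real.exp (-r) ≠ 0 := by positivity
  field_simp
  linear_combination (-2 * Real.exp (-r)) * e2

theorem ferrersP_tanh (ν μ : ℂ) (r : ℝ) : ferrersP ν μ (Real.tanh r) = fF ν μ r := by
  unfold ferrersP fF
  rw [hyp_eq]
  congr 1
  · have : ((1 - ((Real.tanh r : ℝ) : ℂ)) / (1 + ((Real.tanh r : ℝ) : ℂ))) = ((Real.exp (-2 * r) : ℝ) : ℂ) := by
      rw [← exp_two_mul_tanh]; push_cast; rfl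
    rw [this, Complex.cpow_def_of_ne_zero (by exact_mod_cast (Real.exp_pos _).ne'),
      ← Complex.ofReal_log (Real.exp_pos _).le, Real.log_exp]
    congr 1; push_cast; ring
  · push_cast; rfl

theorem y_norm (r : ℝ) : ‖(((1 - Real.tanh r) / 2 : ℝ) : ℂ)‖ < 1 := by
  rw [Complex.norm_real, Real.norm_eq_abs, abs_lt]
  constructor <;> linarith [tanh_lt r, lt_tanh r]

theorem hasDerivAt_y (r : ℝ) : HasDerivAt (fun r : ℝ => (((1 - Real.tanh r) / 2 : ℝ) : ℂ))
    (-((1 - Real.tanh r ^ 2) / 2 : ℝ) : ℂ) r := by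
  have h := (((hasDerivAt_tanh r).const_sub 1).div_const 2).ofReal_comp
  refine HasDerivAt.congr_deriv h ?_
  push_cast; ring

theorem hasDerivAt_PS_y {p : ℕ → ℂ} (hp : Good p) (r : ℝ) :
    HasDerivAt (fun r : ℝ => PS p (((1 - Real.tanh r) / 2 : ℝ) : ℂ))
      ((-((1 - Real.tanh r ^ 2) / 2 : ℝ) : ℂ) * PS (dp p) (((1 - Real.tanh r) / 2 : ℝ) : ℂ)) r := by
  have := (hp.hasDerivAt (y_norm r)).scomp r (hasDerivAt_y r)
  simpa [smul_eq_mul, Function.comp_def] using this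

theorem hasDerivAt_expc (μ : ℂ) (r : ℝ) :
    HasDerivAt (fun r : ℝ => Complex.exp (μ * r)) (μ * Complex.exp (μ * r)) r := by
  have h : HasDerivAt (fun r : ℝ => (r : ℂ)) 1 r := Complex.ofRealCLM.hasDerivAt
  have := (h.const_mul μ).cexp
  simpa [mul_comm] using this

theorem hasDerivAt_fF (ν μ : ℂ) (r : ℝ) : HasDerivAt (fF ν μ) (fF1 ν μ r) r := by
  have := (hasDerivAt_expc (-μ) r).mul (hasDerivAt_PS_y (hc_good (-ν) (ν + 1) (1 + μ)) r)
  refine HasDerivAt.congr_deriv this ?_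
  unfold fF1; ring

theorem hasDerivAt_fF1 (ν μ : ℂ) (r : ℝ) : HasDerivAt (fF1 ν μ)
    ((μ ^ 2 - ν * (ν + 1) * (1 - (Real.tanh r : ℂ) ^ 2)) * fF ν μ r) r := by
  have hp := hc_good (-ν) (ν + 1) (1 + μ)
  have ht : HasDerivAt (fun r : ℝ => (-((1 - Real.tanh r ^ 2) / 2 : ℝ) : ℂ))
      ((Real.tanh r : ℂ) * (1 - (Real.tanh r : ℂ) ^ 2)) r := by
    have h := ((((hasDerivAt_tanh r).pow 2).const_sub 1).div_const 2).neg.ofReal_comp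
    have h' : HasDerivAt (fun r : ℝ => (-((1 - Real.tanh r ^ 2) / 2 : ℝ) : ℂ)) _ r :=
      h.congr_of_eventuallyEq (Eventually.of_forall fun r => by simp)
    refine HasDerivAt.congr_deriv h' ?_
    push_cast; ring
  have := (hasDerivAt_expc (-μ) r).mul (((hasDerivAt_PS_y hp r).const_mul (-μ)).add
    (ht.mul (hasDerivAt_PS_y hp.dp r)))
  refine HasDerivAt.congr_deriv this ?_
  have ode := hyp_ode hp (-ν) (ν + 1) (1 + μ) (hc_rec _ _ _) (y_norm r)
  unfold fF
  simp only [Pi.add_apply, Pi.mul_apply]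
  push_cast at ode ⊢
  linear_combination ((1 - Complex.tanh r ^ 2) * Complex.exp (-μ * r)) * ode

/-- Legendre function in the variable `w` with `z = cosh w` -/
noncomputable def gE (ν : ℂ) (w : ℝ) : ℂ := Complex.exp (ν * ((2 * lc (w / 2) : ℝ) : ℂ))
noncomputable def gq (p : ℕ → ℂ) (w : ℝ) : ℂ := PS p ((Real.tanh (w / 2) : ℂ) ^ 2)
noncomputable def gA (ν : ℂ) (w : ℝ) : ℂ := ν * gq (hc (-ν) (-ν) 1) w +
  (1 - (Real.tanh (w / 2) : ℂ) ^ 2) * gq (dp (hc (-ν) (-ν) 1)) w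
noncomputable def gA1 (ν : ℂ) (w : ℝ) : ℂ := (Real.tanh (w / 2) : ℂ) *
  (1 - (Real.tanh (w / 2) : ℂ) ^ 2) * ((ν - 1) * gq (dp (hc (-ν) (-ν) 1)) w +
    (1 - (Real.tanh (w / 2) : ℂ) ^ 2) * gq (dp (dp (hc (-ν) (-ν) 1))) w)
noncomputable def gG (ν : ℂ) (w : ℝ) : ℂ := gE ν w * gq (hc (-ν) (-ν) 1) w
noncomputable def gG1 (ν : ℂ) (w : ℝ) : ℂ := gE ν w * ((Real.tanh (w / 2) : ℂ) * gA ν w)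
noncomputable def gG2 (ν : ℂ) (w : ℝ) : ℂ := gE ν w * (ν * (Real.tanh (w / 2) : ℂ) ^ 2 * gA ν w +
  (1 - (Real.tanh (w / 2) : ℂ) ^ 2) / 2 * gA ν w + (Real.tanh (w / 2) : ℂ) * gA1 ν w)

theorem hasDerivAt_T (w : ℝ) : HasDerivAt (fun w : ℝ => (Real.tanh (w / 2) : ℂ))
    ((1 - (Real.tanh (w / 2) : ℂ) ^ 2) / 2) w := by
  have h := ((hasDerivAt_tanh (w / 2)).comp w ((hasDerivAt_id w).div_const 2)).ofReal_comp
  refine HasDerivAt.congr_deriv h ?_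
  push_cast; ring

theorem hasDerivAt_gE (ν : ℂ) (w : ℝ) :
    HasDerivAt (gE ν) (ν * (Real.tanh (w / 2) : ℂ) * gE ν w) w := by
  have h := (((hasDerivAt_lc (w / 2)).comp w ((hasDerivAt_id w).div_const 2)).const_mul 2).ofReal_comp
  have := (h.const_mul ν).cexp
  refine HasDerivAt.congr_deriv this ?_
  simp only [gE, Function.comp, id]
  push_cast; ring

theorem T_norm (w : ℝ) : ‖(Real.tanh (w / 2) : ℂ) ^ 2‖ < 1 := by
  rw [norm_pow, Complex.norm_real, Real.norm_eq_abs]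
  have : |Real.tanh (w / 2)| < 1 := abs_lt.2 ⟨lt_tanh _, tanh_lt _⟩
  exact pow_lt_one₀ (abs_nonneg _) this two_ne_zero

theorem hasDerivAt_gq {p : ℕ → ℂ} (hp : Good p) (w : ℝ) :
    HasDerivAt (gq p) ((Real.tanh (w / 2) : ℂ) * (1 - (Real.tanh (w / 2) : ℂ) ^ 2) * gq (dp p) w) w := by
  have := (hp.hasDerivAt (T_norm w)).scomp w ((hasDerivAt_T w).pow 2)
  refine HasDerivAt.congr_deriv this ?_
  simp only [gq, smul_eq_mul]; push_cast; ring

theorem hasDerivAt_gA (ν : ℂ) (w : ℝ) : HasDerivAt (gA ν) (gA1 ν w) w := by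
  have hp := hc_good (-ν) (-ν) 1
  have := ((hasDerivAt_gq hp w).const_mul ν).add
    ((((hasDerivAt_T w).pow 2).const_sub 1).mul (hasDerivAt_gq hp.dp w))
  refine HasDerivAt.congr_deriv this ?_
  simp only [gA1, Pi.pow_apply]; push_cast; ring

theorem hasDerivAt_gG (ν : ℂ) (w : ℝ) : HasDerivAt (gG ν) (gG1 ν w) w := by
  have hp := hc_good (-ν) (-ν) 1
  have := (hasDerivAt_gE ν w).mul (hasDerivAt_gq hp w)
  refine HasDerivAt.congr_deriv this ?_
  simp only [gG1, gA]; ring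

theorem hasDerivAt_gG1 (ν : ℂ) (w : ℝ) : HasDerivAt (gG1 ν) (gG2 ν w) w := by
  have := (hasDerivAt_gE ν w).mul ((hasDerivAt_T w).mul (hasDerivAt_gA ν w))
  refine HasDerivAt.congr_deriv this ?_
  simp only [gG2, Pi.mul_apply]; ring

theorem continuous_gq {p : ℕ → ℂ} (hp : Good p) : Continuous (gq p) :=
  continuous_iff_continuousAt.2 fun w => (hasDerivAt_gq hp w).continuousAt

theorem continuous_gG (ν : ℂ) : Continuous (gG ν) :=
  continuous_iff_continuousAt.2 fun w => (hasDerivAt_gG ν w).continuousAt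
theorem continuous_gG1 (ν : ℂ) : Continuous (gG1 ν) :=
  continuous_iff_continuousAt.2 fun w => (hasDerivAt_gG1 ν w).continuousAt
theorem continuous_T : Continuous (fun w : ℝ => (Real.tanh (w / 2) : ℂ)) :=
  continuous_iff_continuousAt.2 fun w => (hasDerivAt_T w).continuousAt
theorem continuous_gG2 (ν : ℂ) : Continuous (gG2 ν) := by
  have hp := hc_good (-ν) (-ν) 1
  have h1 := continuous_gq hp.dp
  have h2 := continuous_gq hp.dp.dp
  have hT := continuous_T
  have hE : Continuous (gE ν) :=
    continuous_iff_continuousAt.2 fun w => (hasDerivAt_gE ν w).continuousAt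
  have hA : Continuous (gA ν) :=
    continuous_iff_continuousAt.2 fun w => (hasDerivAt_gA ν w).continuousAt
  have hA1 : Continuous (gA1 ν) := by unfold gA1; fun_prop
  unfold gG2; fun_prop

theorem sinh_half (w : ℝ) : Real.sinh w * (1 - Real.tanh (w / 2) ^ 2) = 2 * Real.tanh (w / 2) := by
  have h := (Real.cosh_pos (w / 2)).ne'
  have e : Real.sinh w = 2 * Real.sinh (w / 2) * Real.cosh (w / 2) := by
    rw [← Real.sinh_two_mul]; ring_nf
  rw [e, Real.tanh_eq_sinh_div_cosh]; field_simp
  have := Real.cosh_sq (w / 2)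
  rw [this]; ring

theorem cosh_half (w : ℝ) : Real.cosh w * (1 - Real.tanh (w / 2) ^ 2) = 1 + Real.tanh (w / 2) ^ 2 := by
  have h := (Real.cosh_pos (w / 2)).ne'
  have e : Real.cosh w = Real.cosh (w / 2) ^ 2 + Real.sinh (w / 2) ^ 2 := by
    rw [← Real.cosh_two_mul]; ring_nf
  rw [e, Real.tanh_eq_sinh_div_cosh]; field_simp
  have := Real.cosh_sq (w / 2)
  rw [this]; ring

theorem gG_ode (ν : ℂ) (w : ℝ) : (Real.sinh w : ℂ) * gG2 ν w + (Real.cosh w : ℂ) * gG1 ν w =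
    ν * (ν + 1) * (Real.sinh w : ℂ) * gG ν w := by
  have hp := hc_good (-ν) (-ν) 1
  have ode := hyp_ode hp (-ν) (-ν) 1 (hc_rec _ _ _) (T_norm w)
  have h1 : (1 - (Real.tanh (w / 2) : ℂ) ^ 2) ≠ 0 := by
    intro h
    have := T_norm w
    rw [← sub_eq_zero.1 h] at this; simp at this
  have hs : (Real.sinh w : ℂ) * (1 - (Real.tanh (w / 2) : ℂ) ^ 2) = 2 * (Real.tanh (w / 2) : ℂ) := by
    exact_mod_cast sinh_half w
  have hc' : (Real.cosh w : ℂ) * (1 - (Real.tanh (w / 2) : ℂ) ^ 2) = 1 + (Real.tanh (w / 2) : ℂ) ^ 2 := by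
    exact_mod_cast cosh_half w
  apply mul_left_cancel₀ h1
  simp only [gG, gG1, gG2, gA, gA1, gq] at *
  set T := (Real.tanh (w / 2) : ℂ)
  have e1 : ∀ a b c d : ℂ, (1 - T ^ 2) * (a * b + c * d) =
      (a * (1 - T ^ 2)) * b + (c * (1 - T ^ 2)) * d := by intros; ring
  have e2 : ∀ a b : ℂ, (1 - T ^ 2) * (ν * (ν + 1) * a * b) =
      ν * (ν + 1) * (a * (1 - T ^ 2)) * b := by intros; ring
  rw [e1, e2, hs, hc']
  linear_combination (2 * T * (1 - T ^ 2) * gE ν w) * ode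

theorem gG_zero (ν : ℂ) : gG ν 0 = 1 := by
  simp [gG, gE, gq, lc, PS_zero, hc]

theorem gG1_zero (ν : ℂ) : gG1 ν 0 = 0 := by
  simp [gG1]

theorem legendreP_cosh (ν : ℂ) (w : ℝ) : legendreP ν (Real.cosh w) = gG ν w := by
  unfold legendreP gG gq gE
  rw [hyp_eq]
  have hC := Real.cosh_pos (w / 2)
  have e1 : Real.cosh w = Real.cosh (w / 2) ^ 2 + Real.sinh (w / 2) ^ 2 := by
    rw [← Real.cosh_two_mul]; ring_nf
  have e2 := Real.cosh_sq (w / 2)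
  have e3 : ((Real.cosh w : ℝ) + 1) / 2 = Real.cosh (w / 2) ^ 2 := by linarith
  have e4 : ((Real.cosh w : ℝ) - 1) / (Real.cosh w + 1) = Real.tanh (w / 2) ^ 2 := by
    rw [Real.tanh_eq_sinh_div_cosh, div_pow, div_eq_div_iff]
    · have h5 : Real.cosh w - 1 = 2 * Real.sinh (w / 2) ^ 2 := by linarith
      have h6 : Real.cosh w + 1 = 2 * Real.cosh (w / 2) ^ 2 := by linarith
      rw [h5, h6]; ring
    · have := Real.cosh_pos w; positivity
    · positivity
  congr 1
  · have : ((Real.cosh w : ℂ) + 1) / 2 = ((Real.cosh (w / 2) ^ 2 : ℝ) : ℂ) := by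
      rw [← e3]; push_cast; rfl
    rw [this, Complex.cpow_def_of_ne_zero (by exact_mod_cast (by positivity)),
      ← Complex.ofReal_log (by positivity), Real.log_pow]
    unfold lc; congr 1; push_cast; ring
  · congr 1
    rw [← Complex.ofReal_pow, ← e4]; push_cast; rfl

end FSI

namespace FSI
open Filter Topology

theorem lc_le {r : ℝ} (hr : 0 ≤ r) : lc r ≤ r := by
  unfold lc
  rw [Real.log_le_iff_le_exp (Real.cosh_pos r), Real.cosh_eq]
  have : Real.exp (-r) ≤ Real.exp r := Real.exp_le_exp.2 (by linarith)
  linarith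

theorem le_lc (r : ℝ) : r - Real.log 2 ≤ lc r := by
  unfold lc
  rw [Real.le_log_iff_exp_le (Real.cosh_pos r), Real.exp_sub, Real.exp_log (by norm_num), Real.cosh_eq]
  have := Real.exp_pos (-r)
  linarith

theorem mc_rec (β : ℝ) (n : ℕ) :
    ((n : ℝ) + 1) * Ring.multichoose β (n + 1) = (n + β) * Ring.multichoose β n := by
  have h1 := Ring.factorial_nsmul_multichoose_eq_ascPochhammer β (n + 1)
  have h0 := Ring.factorial_nsmul_multichoose_eq_ascPochhammer β n
  rw [Polynomial.ascPochhammer_smeval_eq_eval, nsmul_eq_mul] at h0 h1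
  rw [ascPochhammer_succ_eval, ← h0, Nat.factorial_succ] at h1
  have h2 : (n.factorial : ℝ) ≠ 0 := by exact_mod_cast n.factorial_ne_zero
  apply mul_left_cancel₀ h2
  push_cast at h1
  linear_combination h1

theorem mc_pos {β : ℝ} (hβ : 0 < β) (n : ℕ) : 0 < Ring.multichoose β n := by
  induction n with
  | zero => simp
  | succ n ih =>
    have h := mc_rec β n
    have : 0 < ((n : ℝ) + 1) * Ring.multichoose β (n + 1) := by rw [h]; positivity
    exact (pos_iff_pos_of_mul_pos this).1 (by positivity)

theorem mc_hasSum (β : ℝ) {y : ℝ} (h0 : 0 ≤ y) (h1 : y < 1) :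
    HasSum (fun n => Ring.multichoose β n * y ^ n) (1 / (1 - y) ^ β) := by
  have h := (Real.one_div_one_sub_rpow_hasFPowerSeriesOnBall_zero β).hasSum (y := y) (by
    simp [enorm_eq_nnnorm]
    rw [← NNReal.coe_lt_coe]
    simp [abs_of_nonneg h0, h1])
  simp only [zero_add, FormalMultilinearSeries.ofScalars_apply_eq, smul_eq_mul] at h
  refine h.congr_fun (fun n => ?_) |> fun h => h
  rw [Ring.multichoose_eq]

theorem coef_bound (ν : ℂ) {β : ℝ} (hβ : 0 < β) (hβ2 : -2 * ν.re - 1 < β) :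
    ∃ C, 0 ≤ C ∧ ∀ n, ‖hc (-ν) (-ν) 1 n‖ ≤ C * Ring.multichoose β n := by
  set p := hc (-ν) (-ν) 1
  set q : ℕ → ℝ := fun n => ‖p n‖ / Ring.multichoose β n with hq
  obtain ⟨N, hN⟩ := exists_nat_gt (‖ν‖ ^ 2 / (β + 1 + 2 * ν.re))
  have hpos : 0 < β + 1 + 2 * ν.re := by linarith
  have hstep : ∀ n, N ≤ n → q (n + 1) ≤ q n := by
    intro n hn
    have hn' : (N : ℝ) ≤ n := by exact_mod_cast hn
    have hb := mc_rec β n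
    have hr := congrArg norm (hc_rec (-ν) (-ν) 1 n)
    have e1 : ‖((n : ℂ) + 1)‖ = n + 1 := by
      have := Complex.norm_natCast (n + 1); push_cast at this; exact this
    simp only [norm_mul, e1] at hr
    have e2 : ‖(n : ℂ) + -ν‖ * ‖(n : ℂ) + -ν‖ ≤ (n + β) * (n + 1) := by
      have : ‖(n : ℂ) + -ν‖ * ‖(n : ℂ) + -ν‖ = n ^ 2 - 2 * n * ν.re + ‖ν‖ ^ 2 := by
        rw [← sq, Complex.sq_norm, Complex.sq_norm, Complex.normSq_apply, Complex.normSq_apply]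
        simp; ring
      rw [this]
      have h3 : ‖ν‖ ^ 2 ≤ (β + 1 + 2 * ν.re) * n := by
        have := (div_lt_iff₀ hpos).1 (hN.trans_le hn'); linarith
      nlinarith
    have b0 := mc_pos hβ n
    have b1 := mc_pos hβ (n + 1)
    have p0 : 0 ≤ ‖p n‖ := norm_nonneg _
    rw [hq]
    simp only
    rw [div_le_div_iff₀ b1 b0]
    have n1 : (0 : ℝ) < n + 1 := by positivity
    have : ((n : ℝ) + 1) * (n + 1) * (‖p (n + 1)‖ * Ring.multichoose β n) ≤
        ((n : ℝ) + 1) * (n + 1) * (‖p n‖ * Ring.multichoose β (n + 1)) := by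
      calc _ = (‖(n : ℂ) + -ν‖ * ‖(n : ℂ) + -ν‖) * (‖p n‖ * Ring.multichoose β n) := by
            linear_combination (Ring.multichoose β n) * hr
        _ ≤ ((n + β) * (n + 1)) * (‖p n‖ * Ring.multichoose β n) := by gcongr
        _ = _ := by linear_combination (-(n + 1) * ‖p n‖) * hb
    exact le_of_mul_le_mul_left this (by positivity)
  have q0 : ∀ n, 0 ≤ q n := fun n => div_nonneg (norm_nonneg _) (mc_pos hβ n).le
  have hle : ∀ n, N ≤ n → q n ≤ q N := by
    intro n hn
    induction n, hn using Nat.le_induction with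
    | base => exact le_rfl
    | succ n hn ih => exact (hstep n hn).trans ih
  refine ⟨∑ i ∈ Finset.range (N + 1), q i, Finset.sum_nonneg fun i _ => q0 i, fun n => ?_⟩
  have h : q n ≤ ∑ i ∈ Finset.range (N + 1), q i := by
    rcases le_total N n with h | h
    · exact (hle n h).trans (Finset.single_le_sum (fun i _ => q0 i) (by simp))
    · exact Finset.single_le_sum (f := q) (fun i _ => q0 i) (by simp; omega)
  exact (div_le_iff₀ (mc_pos hβ n)).1 h

theorem gG_bound (ν : ℂ) {κ : ℝ} (h1 : ν.re < κ) (h2 : -ν.re - 1 < κ) :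
    ∃ C, 0 ≤ C ∧ ∀ w : ℝ, 0 ≤ w → ‖gG ν w‖ ≤ C * Real.exp (κ * w) := by
  obtain ⟨C, hC, hb⟩ := coef_bound ν (β := κ - ν.re) (by linarith) (by linarith)
  refine ⟨C * Real.exp (|κ| * (2 * Real.log 2)), by positivity, fun w hw => ?_⟩
  set L := 2 * lc (w / 2) with hL
  have hT1 : Real.tanh (w / 2) ^ 2 < 1 := by
    have := T_norm w
    rwa [← Complex.ofReal_pow, Complex.norm_real, Real.norm_of_nonneg (by positivity)] at this
  have hcosh : 1 - Real.tanh (w / 2) ^ 2 = Real.exp (-L) := by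
    rw [hL, show -(2 * lc (w / 2)) = -(lc (w / 2)) + -(lc (w / 2)) by ring, Real.exp_add, Real.exp_neg]
    unfold lc
    rw [Real.exp_log (Real.cosh_pos _), Real.tanh_eq_sinh_div_cosh]
    have := (Real.cosh_pos (w / 2)).ne'
    field_simp
    rw [Real.cosh_sq]; ring
  have hsum := (mc_hasSum (κ - ν.re) (by positivity) hT1).mul_left C
  have hq : ‖gq (hc (-ν) (-ν) 1) w‖ ≤ C * (1 / (1 - Real.tanh (w / 2) ^ 2) ^ (κ - ν.re)) := by
    unfold gq PS
    refine tsum_of_norm_bounded hsum (fun n => ?_)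
    rw [norm_mul, norm_pow, ← Complex.ofReal_pow, Complex.norm_real, Real.norm_of_nonneg (by positivity),
      ← mul_assoc]
    have := hb n
    gcongr
  have hE : ‖gE ν w‖ = Real.exp (ν.re * L) := by
    unfold gE; rw [Complex.norm_exp]; congr 1
    rw [Complex.re_mul_ofReal]
  unfold gG
  rw [norm_mul, hE]
  have e1 : 1 / (1 - Real.tanh (w / 2) ^ 2) ^ (κ - ν.re) = Real.exp ((κ - ν.re) * L) := by
    rw [hcosh, ← Real.exp_mul, one_div, ← Real.exp_neg]; congr 1; ring
  rw [e1] at hq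
  have u1 := lc_le (r := w / 2) (by linarith)
  have u2 := le_lc (w / 2)
  have h3 : κ * L ≤ κ * w + |κ| * (2 * Real.log 2) := by
    have h4 : |L - w| ≤ 2 * Real.log 2 := by
      rw [abs_le]; constructor <;> linarith [Real.log_pos one_lt_two]
    have h5 : κ * (L - w) ≤ |κ| * |L - w| := by rw [← abs_mul]; exact le_abs_self _
    have h6 : |κ| * |L - w| ≤ |κ| * (2 * Real.log 2) := by gcongr
    linarith
  calc Real.exp (ν.re * L) * ‖gq (hc (-ν) (-ν) 1) w‖
      ≤ Real.exp (ν.re * L) * (C * Real.exp ((κ - ν.re) * L)) := by gcongr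
    _ = C * Real.exp (κ * L) := by
      rw [mul_left_comm, ← Real.exp_add]; congr 2; ring
    _ ≤ C * Real.exp (κ * w + |κ| * (2 * Real.log 2)) := by gcongr
    _ = _ := by rw [Real.exp_add]; ring

theorem bound_extend {F : ℝ → ℂ} (hF : Continuous F) {κ a b C : ℝ} 
    (h : ∀ w, b ≤ w → ‖F w‖ ≤ C * Real.exp (κ * w)) :
    ∃ C', 0 ≤ C' ∧ ∀ w : ℝ, a ≤ w → ‖F w‖ ≤ C' * Real.exp (κ * w) := by
  have hc : Continuous (fun w => ‖F w‖ * Real.exp (-(κ * w))) := by fun_prop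
  obtain ⟨M, hM⟩ := (isCompact_Icc (a := a) (b := b)).bddAbove_image hc.continuousOn
  refine ⟨max 0 (max M C), le_max_left _ _, fun w hw => ?_⟩
  rcases le_total w b with h1 | h1
  · have := hM ⟨w, ⟨hw, h1⟩, rfl⟩
    simp only [Real.exp_neg] at this
    rw [← div_eq_mul_inv, div_le_iff₀ (Real.exp_pos _)] at this
    exact this.trans (by gcongr; exact (le_max_left _ _).trans (le_max_right _ _))
  · exact (h w h1).trans (by gcongr; exact (le_max_right _ _).trans (le_max_right _ _))

theorem sinh_ge {w : ℝ} (hw : 1 ≤ w) : Real.exp w / 4 ≤ Real.sinh w := by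
  rw [Real.sinh_eq]
  have h1 : Real.exp (-w) ≤ 1 := Real.exp_le_one_iff.2 (by linarith)
  have h2 := Real.add_one_le_exp w
  linarith

theorem gG1_bound (ν : ℂ) {κ : ℝ} (h1 : ν.re < κ) (h2 : -ν.re - 1 < κ) :
    ∃ C, 0 ≤ C ∧ ∀ w : ℝ, 0 ≤ w → ‖gG1 ν w‖ ≤ C * Real.exp (κ * w) := by
  obtain ⟨C, hC, hb⟩ := gG_bound ν h1 h2
  have hk : 0 < κ + 1 := by linarith
  set K := ‖ν * (ν + 1)‖ * C with hK
  have hK0 : 0 ≤ K := by positivity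
  have hder : ∀ w : ℝ, HasDerivAt (fun w : ℝ => (Real.sinh w : ℂ) * gG1 ν w)
      (ν * (ν + 1) * (Real.sinh w : ℂ) * gG ν w) w := by
    intro w
    have := ((Real.hasDerivAt_sinh w).ofReal_comp).mul (hasDerivAt_gG1 ν w)
    refine HasDerivAt.congr_deriv this ?_
    rw [← gG_ode]; ring
  have main : ∀ w : ℝ, 0 ≤ w → ‖(Real.sinh w : ℂ) * gG1 ν w‖ ≤ K / (κ + 1) * Real.exp ((κ + 1) * w) := by
    intro w hw
    refine image_norm_le_of_norm_deriv_right_le_deriv_boundary (a := 0) (b := w)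
      (f := fun w : ℝ => (Real.sinh w : ℂ) * gG1 ν w)
      (f' := fun w : ℝ => ν * (ν + 1) * (Real.sinh w : ℂ) * gG ν w)
      (B := fun w => K / (κ + 1) * Real.exp ((κ + 1) * w))
      (B' := fun w => K * Real.exp ((κ + 1) * w))
      (fun x _ => (hder x).continuousAt.continuousWithinAt)
      (fun x _ => (hder x).hasDerivWithinAt) (by simp; positivity) ?_ ?_ ⟨hw, le_rfl⟩
    · intro x
      have := ((((hasDerivAt_id x).const_mul (κ + 1)).exp).const_mul (K / (κ + 1)))
      refine HasDerivAt.congr_deriv this ?_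
      field_simp; simp
    · intro x hx
      rw [norm_mul, norm_mul, Complex.norm_real, Real.norm_of_nonneg (Real.sinh_nonneg_iff.2 hx.1)]
      have hs : Real.sinh x ≤ Real.exp x := by
        rw [Real.sinh_eq]; have := Real.exp_pos (-x); have := Real.exp_pos x; linarith
      have hg := hb x hx.1
      calc ‖ν * (ν + 1)‖ * Real.sinh x * ‖gG ν x‖
          ≤ ‖ν * (ν + 1)‖ * Real.exp x * (C * Real.exp (κ * x)) := by gcongr
        _ = _ := by rw [hK, add_mul, Real.exp_add]; ring_nf
  refine bound_extend (continuous_gG1 ν) (b := 1) (C := 4 * (K / (κ + 1))) (fun w hw => ?_)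
  have hm := main w (by linarith)
  have hs := sinh_ge hw
  rw [norm_mul, Complex.norm_real, Real.norm_of_nonneg (Real.sinh_nonneg_iff.2 (by linarith))] at hm
  have h3 : Real.exp w / 4 * ‖gG1 ν w‖ ≤ K / (κ + 1) * Real.exp ((κ + 1) * w) := le_trans (by gcongr) hm
  rw [add_mul, Real.exp_add, one_mul] at h3
  have := Real.exp_pos w
  refine le_of_mul_le_mul_left ?_ this
  linarith

theorem gG2_bound (ν : ℂ) {κ : ℝ} (h1 : ν.re < κ) (h2 : -ν.re - 1 < κ) :
    ∃ C, 0 ≤ C ∧ ∀ w : ℝ, 0 ≤ w → ‖gG2 ν w‖ ≤ C * Real.exp (κ * w) := by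
  obtain ⟨C, hC, hb⟩ := gG_bound ν h1 h2
  obtain ⟨C1, hC1, hb1⟩ := gG1_bound ν h1 h2
  refine bound_extend (continuous_gG2 ν) (b := 1) (C := ‖ν * (ν + 1)‖ * C + 4 * C1) (fun w hw => ?_)
  have hs := sinh_ge hw
  have hspos : 0 < Real.sinh w := lt_of_lt_of_le (by positivity) hs
  have hch : Real.cosh w ≤ 4 * Real.sinh w := by
    have : Real.cosh w ≤ Real.exp w := by
      rw [Real.cosh_eq]
      have : Real.exp (-w) ≤ Real.exp w := Real.exp_le_exp.2 (by linarith)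
      linarith
    linarith
  have ode := gG_ode ν w
  have e : (Real.sinh w : ℂ) * gG2 ν w = ν * (ν + 1) * (Real.sinh w : ℂ) * gG ν w -
    (Real.cosh w : ℂ) * gG1 ν w := by linear_combination ode
  have e2 := congrArg norm e
  rw [norm_mul, Complex.norm_real, Real.norm_of_nonneg hspos.le] at e2
  have g0 := hb w (by linarith)
  have g1 := hb1 w (by linarith)
  refine le_of_mul_le_mul_left ?_ hspos
  rw [e2]
  refine (norm_sub_le _ _).trans ?_
  rw [norm_mul, norm_mul, norm_mul (Real.cosh w : ℂ), Complex.norm_real, Complex.norm_real,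
    Real.norm_of_nonneg hspos.le, Real.norm_of_nonneg (Real.cosh_pos w).le]
  calc _ ≤ ‖ν * (ν + 1)‖ * Real.sinh w * (C * Real.exp (κ * w)) +
        4 * Real.sinh w * (C1 * Real.exp (κ * w)) := by gcongr
    _ = _ := by ring

end FSI

namespace FSI
open Filter Topology

theorem norm_cexp_mul (m : ℂ) (w : ℝ) : ‖Complex.exp (-m * w)‖ = Real.exp (-m.re * w) := by
  rw [Complex.norm_exp]; simp

theorem exp_bd {F : ℝ → ℂ} {C κ : ℝ} {m : ℂ} {w : ℝ} (hb : ‖F w‖ ≤ C * Real.exp (κ * w)) :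
    ‖Complex.exp (-m * w) * F w‖ ≤ C * Real.exp (-(m.re - κ) * w) := by
  rw [norm_mul, norm_cexp_mul]
  calc _ ≤ Real.exp (-m.re * w) * (C * Real.exp (κ * w)) := by gcongr
    _ = _ := by
      rw [show -(m.re - κ) * w = -m.re * w + κ * w by ring, Real.exp_add]; ring

theorem lap_int {F : ℝ → ℂ} (hF : Continuous F) {C κ : ℝ} {m : ℂ}
    (hb : ∀ w, 0 ≤ w → ‖F w‖ ≤ C * Real.exp (κ * w)) (hm : κ < m.re) :
    IntegrableOn (fun w : ℝ => Complex.exp (-m * w) * F w) (Ioi 0) := by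
  have h1 : IntegrableOn (fun w : ℝ => C * Real.exp (-(m.re - κ) * w)) (Ioi 0) :=
    (exp_neg_integrableOn_Ioi 0 (by linarith)).const_mul C
  refine Integrable.mono' h1 ?_ ?_
  · exact (Continuous.mul (by fun_prop) hF).aestronglyMeasurable
  · refine (ae_restrict_iff' measurableSet_Ioi).2 (Eventually.of_forall fun w hw => ?_)
    exact exp_bd (hb w (le_of_lt hw))

theorem lap_norm {F : ℝ → ℂ} (hF : Continuous F) {C κ : ℝ} {m : ℂ}
    (hb : ∀ w, 0 ≤ w → ‖F w‖ ≤ C * Real.exp (κ * w)) (hm : κ < m.re) :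
    ‖∫ w in Ioi (0 : ℝ), Complex.exp (-m * w) * F w‖ ≤ C / (m.re - κ) := by
  have h1 : IntegrableOn (fun w : ℝ => C * Real.exp (-(m.re - κ) * w)) (Ioi 0) :=
    (exp_neg_integrableOn_Ioi 0 (by linarith)).const_mul C
  have := norm_integral_le_of_norm_le h1 ((ae_restrict_iff' measurableSet_Ioi).2
    (Eventually.of_forall fun w hw => exp_bd (m := m) (hb w (le_of_lt hw))))
  refine this.trans (le_of_eq ?_)
  rw [integral_const_mul, integral_exp_mul_Ioi (by linarith)]
  have : m.re - κ ≠ 0 := by linarith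
  simp only [mul_zero, Real.exp_zero]
  field_simp

theorem lap_tendsto {F : ℝ → ℂ} {C κ : ℝ} {m : ℂ}
    (hb : ∀ w, 0 ≤ w → ‖F w‖ ≤ C * Real.exp (κ * w)) (hm : κ < m.re) :
    Tendsto (fun w : ℝ => Complex.exp (-m * w) * F w) atTop (𝓝 0) := by
  have h1 : Tendsto (fun w : ℝ => C * Real.exp (-(m.re - κ) * w)) atTop (𝓝 0) := by
    have : Tendsto (fun w : ℝ => -(m.re - κ) * w) atTop atBot :=
      tendsto_id.const_mul_atTop_of_neg (by linarith)
    simpa using (Real.tendsto_exp_atBot.comp this).const_mul C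
  refine squeeze_zero_norm' ?_ h1
  filter_upwards [eventually_ge_atTop 0] with w hw
  exact exp_bd (hb w hw)

/-- Laplace transform of gG -/
noncomputable def LG (ν m : ℂ) : ℂ := ∫ w in Ioi (0 : ℝ), Complex.exp (-m * w) * gG ν w

theorem exists_kappa {ν m : ℂ} (h1 : ν.re < m.re) (h2 : -ν.re - 1 < m.re) :
    ∃ κ, ν.re < κ ∧ -ν.re - 1 < κ ∧ κ < m.re := by
  obtain ⟨κ, hκ, hκ'⟩ := exists_between (max_lt h1 h2)
  exact ⟨κ, (le_max_left _ _).trans_lt hκ, (le_max_right _ _).trans_lt hκ, hκ'⟩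

theorem LG_rec {ν m : ℂ} (h1 : ν.re < m.re) (h2 : -ν.re - 1 < m.re) :
    LG ν m * ((m - ν) * (m + ν + 1)) = LG ν (m + 2) * ((m + 1 - ν) * (m + 2 + ν)) := by
  obtain ⟨κ, k1, k2, k3⟩ := exists_kappa h1 h2
  obtain ⟨C0, hC0, b0⟩ := gG_bound ν k1 k2
  obtain ⟨C1, hC1, b1⟩ := gG1_bound ν k1 k2
  have i0 := lap_int (continuous_gG ν) b0 k3
  have i2 := lap_int (m := m + 2) (continuous_gG ν) b0 (by simp; linarith)
  set U : ℝ → ℂ := fun w => Complex.exp (-(m + 1) * w) * ((Real.sinh w : ℂ) * (gG1 ν w + (m + 1) * gG ν w))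
  have e1 : ∀ w : ℝ, Complex.exp (-m * w) = Complex.exp (-(m + 1) * w) * Real.exp w := by
    intro w; rw [Complex.ofReal_exp, ← Complex.exp_add]; ring_nf
  have e2 : ∀ w : ℝ, Complex.exp (-(m + 2) * w) = Complex.exp (-(m + 1) * w) * Real.exp (-w) := by
    intro w; rw [Complex.ofReal_exp, ← Complex.exp_add]; push_cast; ring_nf
  have hU : ∀ w ∈ Ici (0 : ℝ), HasDerivAt U (-((m - ν) * (m + ν + 1)) / 2 * (Complex.exp (-m * w) * gG ν w) +
      ((m + 1 - ν) * (m + 2 + ν)) / 2 * (Complex.exp (-(m + 2) * w) * gG ν w)) w := by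
    intro w _
    have := (hasDerivAt_expc (-(m + 1)) w).mul ((Real.hasDerivAt_sinh w).ofReal_comp.mul
      ((hasDerivAt_gG1 ν w).add ((hasDerivAt_gG ν w).const_mul (m + 1))))
    refine HasDerivAt.congr_deriv this ?_
    have ode := gG_ode ν w
    rw [e1, e2]
    have s1 : (Real.sinh w : ℂ) = (Real.exp w - Real.exp (-w)) / 2 := by rw [Real.sinh_eq]; push_cast; ring
    have s2 : (Real.cosh w : ℂ) = (Real.exp w + Real.exp (-w)) / 2 := by rw [Real.cosh_eq]; push_cast; ring
    simp only [Pi.add_apply, Pi.mul_apply]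
    rw [s1, s2] at ode ⊢
    linear_combination Complex.exp (-(m + 1) * w) * ode
  have hF : ∀ w : ℝ, 0 ≤ w → ‖(Real.sinh w : ℂ) * (gG1 ν w + (m + 1) * gG ν w)‖ ≤
      (C1 + ‖m + 1‖ * C0) * Real.exp ((κ + 1) * w) := by
    intro w hw
    have hs : ‖(Real.sinh w : ℂ)‖ ≤ Real.exp w := by
      rw [Complex.norm_real, Real.norm_of_nonneg (Real.sinh_nonneg_iff.2 hw), Real.sinh_eq]
      have := Real.exp_pos w; have := Real.exp_pos (-w); linarith
    calc _ ≤ Real.exp w * (C1 * Real.exp (κ * w) + ‖m + 1‖ * (C0 * Real.exp (κ * w))) := by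
          rw [norm_mul]
          gcongr
          refine (norm_add_le _ _).trans ?_
          rw [norm_mul]
          gcongr
          · exact b1 w hw
          · exact b0 w hw
      _ = _ := by rw [show (κ + 1) * w = w + κ * w by ring, Real.exp_add]; ring
  have hlim : Tendsto U atTop (𝓝 0) := lap_tendsto hF (by simp; linarith)
  have := integral_Ioi_of_hasDerivAt_of_tendsto' hU
    (Integrable.add (i0.const_mul _) (i2.const_mul _)) hlim
  rw [integral_add (i0.const_mul _) (i2.const_mul _), integral_const_mul, integral_const_mul] at this
  have u0 : U 0 = 0 := by simp [U]
  rw [u0] at this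
  unfold LG
  linear_combination -2 * this

theorem LG_lim {ν m : ℂ} (h1 : ν.re < m.re) (h2 : -ν.re - 1 < m.re) :
    Tendsto (fun n : ℕ => (m + 2 * n) * LG ν (m + 2 * n)) atTop (𝓝 1) := by
  obtain ⟨κ, k1, k2, k3⟩ := exists_kappa h1 h2
  obtain ⟨C0, hC0, b0⟩ := gG_bound ν k1 k2
  obtain ⟨C1, hC1, b1⟩ := gG1_bound ν k1 k2
  have key : ∀ n : ℕ, ‖(m + 2 * n) * LG ν (m + 2 * n) - 1‖ ≤ C1 / (2 * n + (m.re - κ)) := by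
    intro n
    have hn : (0 : ℝ) ≤ n := n.cast_nonneg
    set M := m + 2 * n with hM
    have hMre : M.re = m.re + 2 * n := by simp [hM]
    have k3' : κ < M.re := by rw [hMre]; linarith
    have i0 := lap_int (continuous_gG ν) b0 k3'
    have i1 := lap_int (continuous_gG1 ν) b1 k3'
    have hd : ∀ w ∈ Ici (0 : ℝ), HasDerivAt (fun w : ℝ => Complex.exp (-M * w) * gG ν w)
      (-M * (Complex.exp (-M * w) * gG ν w) + Complex.exp (-M * w) * gG1 ν w) w := by
      intro w _
      refine HasDerivAt.congr_deriv ((hasDerivAt_expc (-M) w).mul (hasDerivAt_gG ν w)) ?_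
      ring
    have := integral_Ioi_of_hasDerivAt_of_tendsto' hd ((i0.const_mul _).add i1) (lap_tendsto b0 k3')
    rw [integral_add (i0.const_mul _) i1, integral_const_mul] at this
    have h0 : M * LG ν M - 1 = ∫ w in Ioi (0 : ℝ), Complex.exp (-M * w) * gG1 ν w := by
      simp [gG_zero] at this
      unfold LG
      simp only [neg_mul] at this ⊢
      linear_combination -this
    rw [h0]
    refine (lap_norm (continuous_gG1 ν) b1 k3').trans (le_of_eq ?_)
    rw [hMre]; ring
  rw [tendsto_iff_norm_sub_tendsto_zero]
  refine squeeze_zero (fun _ => norm_nonneg _) key ?_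
  refine Tendsto.div_atTop tendsto_const_nhds ?_
  refine tendsto_atTop_add_const_right _ _ ?_
  exact tendsto_natCast_atTop_atTop.const_mul_atTop (by norm_num)

/-- closed form -/
noncomputable def RL (ν m : ℂ) : ℂ :=
  Complex.Gamma ((m - ν) / 2) * Complex.Gamma ((m + ν + 1) / 2) /
    (2 * Complex.Gamma ((m - ν + 1) / 2) * Complex.Gamma ((m + ν + 2) / 2))

theorem RL_ne {ν m : ℂ} (h1 : ν.re < m.re) (h2 : -ν.re - 1 < m.re) : RL ν m ≠ 0 := by
  unfold RL
  have a1 : Complex.Gamma ((m - ν) / 2) ≠ 0 := Complex.Gamma_ne_zero_of_re_pos (by simp; linarith)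
  have a2 : Complex.Gamma ((m + ν + 1) / 2) ≠ 0 := Complex.Gamma_ne_zero_of_re_pos (by simp; linarith)
  have a3 : Complex.Gamma ((m - ν + 1) / 2) ≠ 0 := Complex.Gamma_ne_zero_of_re_pos (by simp; linarith)
  have a4 : Complex.Gamma ((m + ν + 2) / 2) ≠ 0 := Complex.Gamma_ne_zero_of_re_pos (by simp; linarith)
  exact div_ne_zero (mul_ne_zero a1 a2) (mul_ne_zero (mul_ne_zero two_ne_zero a3) a4)

theorem ne_of_re_pos {z : ℂ} (h : 0 < z.re) : z ≠ 0 := by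
  rintro rfl; simp at h

theorem RL_rec {ν m : ℂ} (h1 : ν.re < m.re) (h2 : -ν.re - 1 < m.re) :
    RL ν m * ((m - ν) * (m + ν + 1)) = RL ν (m + 2) * ((m + 1 - ν) * (m + 2 + ν)) := by
  unfold RL
  have a1 : (m - ν) ≠ 0 := ne_of_re_pos (by simp; linarith)
  have a2 : (m + ν + 1) ≠ 0 := ne_of_re_pos (by simp; linarith)
  have a3 : (m - ν + 1) ≠ 0 := ne_of_re_pos (by simp; linarith)
  have a4 : (m + ν + 2) ≠ 0 := ne_of_re_pos (by simp; linarith)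
  have b3 : Complex.Gamma ((m - ν + 1) / 2) ≠ 0 := Complex.Gamma_ne_zero_of_re_pos (by simp; linarith)
  have b4 : Complex.Gamma ((m + ν + 2) / 2) ≠ 0 := Complex.Gamma_ne_zero_of_re_pos (by simp; linarith)
  rw [show (m + 2 - ν) / 2 = (m - ν) / 2 + 1 by ring, show (m + 2 + ν + 1) / 2 = (m + ν + 1) / 2 + 1 by ring,
    show (m + 2 - ν + 1) / 2 = (m - ν + 1) / 2 + 1 by ring,
    show (m + 2 + ν + 2) / 2 = (m + ν + 2) / 2 + 1 by ring,
    Complex.Gamma_add_one _ (by simpa using a1), Complex.Gamma_add_one _ (by simpa using a2),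
    Complex.Gamma_add_one _ (by simpa using a3), Complex.Gamma_add_one _ (by simpa using a4)]
  field_simp
  ring

theorem Gamma_add_nat {s : ℂ} (hs : 0 < s.re) (n : ℕ) :
    Complex.Gamma (s + n + 1) = (∏ j ∈ Finset.range (n + 1), (s + j)) * Complex.Gamma s := by
  induction n with
  | zero =>
    simp [Complex.Gamma_add_one s (ne_of_re_pos hs)]
  | succ n ih =>
    rw [Complex.Gamma_add_one, Finset.prod_range_succ]
    · push_cast
      rw [← add_assoc, ih]; ring
    · exact ne_of_re_pos (by simp; positivity)

theorem Gamma_asymp {s : ℂ} (hs : 0 < s.re) :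
    Tendsto (fun n : ℕ => Complex.Gamma (s + n + 1) / ((n : ℂ) ^ s * n.factorial)) atTop (𝓝 1) := by
  have hG := Complex.Gamma_ne_zero_of_re_pos hs
  have h := Tendsto.div (tendsto_const_nhds (x := Complex.Gamma s)) (Complex.GammaSeq_tendsto_Gamma s) hG
  rw [div_self hG] at h
  refine h.congr (fun n => ?_)
  simp only [Pi.div_apply]
  rw [Gamma_add_nat hs, Complex.GammaSeq]
  field_simp

theorem RL_lim {ν m : ℂ} (h1 : ν.re < m.re) (h2 : -ν.re - 1 < m.re) :
    Tendsto (fun n : ℕ => (m + 2 * (n + 1 : ℕ)) * RL ν (m + 2 * (n + 1 : ℕ))) atTop (𝓝 1) := by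
  have a1 := Gamma_asymp (s := (m - ν) / 2) (by simp; linarith)
  have a2 := Gamma_asymp (s := (m + ν + 1) / 2) (by simp; linarith)
  have a3 := Gamma_asymp (s := (m - ν + 1) / 2) (by simp; linarith)
  have a4 := Gamma_asymp (s := (m + ν + 2) / 2) (by simp; linarith)
  have a5 := tendsto_ratio (m / 2 + 1) 0
  have := ((a1.mul a2).div (a3.mul a4) (by simp)).mul a5
  simp only [mul_one, div_one] at this
  refine this.congr' ?_
  filter_upwards [eventually_ge_atTop 1] with n hn
  have hn0 : (n : ℂ) ≠ 0 := by exact_mod_cast (by omega : n ≠ 0)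
  unfold RL
  simp only [Pi.div_apply]
  push_cast
  rw [show (m + 2 * (n + 1) - ν) / 2 = (m - ν) / 2 + n + 1 by ring,
    show (m + 2 * (n + 1) + ν + 1) / 2 = (m + ν + 1) / 2 + n + 1 by ring,
    show (m + 2 * (n + 1) - ν + 1) / 2 = (m - ν + 1) / 2 + n + 1 by ring,
    show (m + 2 * (n + 1) + ν + 2) / 2 = (m + ν + 2) / 2 + n + 1 by ring]
  have hn' : (0 : ℝ) ≤ n := n.cast_nonneg
  have b3 : Complex.Gamma ((m - ν + 1) / 2 + n + 1) ≠ 0 := Complex.Gamma_ne_zero_of_re_pos (by simp; linarith)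
  have b4 : Complex.Gamma ((m + ν + 2) / 2 + n + 1) ≠ 0 := Complex.Gamma_ne_zero_of_re_pos (by simp; linarith)
  have hp : (n : ℂ) ^ ((m - ν) / 2) * (n : ℂ) ^ ((m + ν + 1) / 2) * n =
      (n : ℂ) ^ ((m - ν + 1) / 2) * (n : ℂ) ^ ((m + ν + 2) / 2) := by
    rw [← Complex.cpow_add _ _ hn0, ← Complex.cpow_add _ _ hn0]
    nth_rw 2 [← Complex.cpow_one (n : ℂ)]
    rw [← Complex.cpow_add _ _ hn0]
    congr 1; ring
  have c1 : (n : ℂ) ^ ((m - ν) / 2) ≠ 0 := by simp [Complex.cpow_eq_zero_iff, hn0]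
  have c2 : (n : ℂ) ^ ((m + ν + 1) / 2) ≠ 0 := by simp [Complex.cpow_eq_zero_iff, hn0]
  have hf : (n.factorial : ℂ) ≠ 0 := by exact_mod_cast n.factorial_ne_zero
  generalize (n : ℂ) ^ ((m - ν) / 2) = X1 at *
  generalize (n : ℂ) ^ ((m + ν + 1) / 2) = X2 at *
  have hX : (n : ℂ) ^ ((m - ν + 1) / 2) * (n : ℂ) ^ ((m + ν + 2) / 2) ≠ 0 := by rw [← hp]; positivity
  generalize (n : ℂ) ^ ((m - ν + 1) / 2) = X3 at *
  generalize (n : ℂ) ^ ((m + ν + 2) / 2) = X4 at *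
  have c3 := left_ne_zero_of_mul hX
  have c4 := right_ne_zero_of_mul hX
  rw [add_zero]
  generalize Complex.Gamma ((m - ν) / 2 + n + 1) = Y1 at *
  generalize Complex.Gamma ((m + ν + 1) / 2 + n + 1) = Y2 at *
  generalize Complex.Gamma ((m - ν + 1) / 2 + n + 1) = Y3 at *
  generalize Complex.Gamma ((m + ν + 2) / 2 + n + 1) = Y4 at *
  have : (Y1 / (X1 * n.factorial) * (Y2 / (X2 * n.factorial)) / (Y3 / (X3 * n.factorial) * (Y4 / (X4 * n.factorial))))
     = Y1 * Y2 * n / (Y3 * Y4) := by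
    field_simp
    linear_combination -Y1 * Y2 * hp
  rw [this]
  field_simp
  ring

theorem LG_eq {ν m : ℂ} (h1 : ν.re < m.re) (h2 : -ν.re - 1 < m.re) : LG ν m = RL ν m := by
  have hre : ∀ n : ℕ, (m + 2 * n).re = m.re + 2 * n := by intro n; simp
  have hn : ∀ n : ℕ, (0 : ℝ) ≤ n := fun n => n.cast_nonneg
  have step : ∀ n : ℕ, LG ν (m + 2 * n) / RL ν (m + 2 * n) = LG ν m / RL ν m := by
    intro n
    induction n with
    | zero => simp
    | succ n ih =>
      rw [← ih]
      have g1 : ν.re < (m + 2 * n).re := by rw [hre]; linarith [hn n]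
      have g2 : -ν.re - 1 < (m + 2 * n).re := by rw [hre]; linarith [hn n]
      have A := LG_rec g1 g2
      have B := RL_rec g1 g2
      have C := RL_ne g1 g2
      have C' : RL ν (m + 2 * n + 2) ≠ 0 := RL_ne (by simp at g1 ⊢; linarith) (by simp at g2 ⊢; linarith)
      have a3 : (m + 2 * n + 1 - ν) ≠ 0 := ne_of_re_pos (by simp; linarith [hn n])
      have a4 : (m + 2 * n + 2 + ν) ≠ 0 := ne_of_re_pos (by simp; linarith [hn n])
      rw [show m + 2 * ((n + 1 : ℕ) : ℂ) = m + 2 * n + 2 by push_cast; ring]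
      rw [div_eq_div_iff C' C]
      apply mul_right_cancel₀ (mul_ne_zero a3 a4)
      linear_combination (-RL ν (m + 2 * n)) * A + LG ν (m + 2 * n) * B
  have L1 := (LG_lim h1 h2).comp (tendsto_add_atTop_nat 1)
  have L2 := L1.div (RL_lim h1 h2) one_ne_zero
  have L3 : Tendsto (fun _ : ℕ => LG ν m / RL ν m) atTop (𝓝 (1 / 1)) := by
    refine L2.congr' ?_
    obtain ⟨N, hN⟩ := exists_nat_gt (-m.re)
    filter_upwards [eventually_ge_atTop N] with n hnN
    have : (N : ℝ) ≤ n := by exact_mod_cast hnN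
    rw [← step (n + 1)]
    have hne : m + 2 * ((n + 1 : ℕ) : ℂ) ≠ 0 := ne_of_re_pos (by rw [hre]; push_cast; linarith [hn n])
    simp only [Pi.div_apply, Function.comp_apply]
    rw [mul_div_mul_left _ _ hne]
  have := tendsto_nhds_unique L3 tendsto_const_nhds
  rw [one_div_one, eq_comm, div_eq_one_iff_eq (RL_ne h1 h2)] at this
  exact this

end FSI

namespace FSI
open Filter Topology

/-- exponential rate bound, locally uniform in the parameter -/
structure Dec (κ : ℝ) (H : ℝ → ℝ → ℂ) : Prop where
  cont : ∀ s, Continuous (H s)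
  bd : ∀ A : ℝ, ∃ C, 0 ≤ C ∧ ∀ s v, |s| ≤ A → 0 ≤ v → ‖H s v‖ ≤ C * Real.exp (κ * v)

theorem Dec.mul {κ κ' : ℝ} {H K : ℝ → ℝ → ℂ} (h : Dec κ H) (k : Dec κ' K) :
    Dec (κ + κ') (fun s v => H s v * K s v) := by
  refine ⟨fun s => (h.cont s).mul (k.cont s), fun A => ?_⟩
  obtain ⟨C, hC, hb⟩ := h.bd A
  obtain ⟨C', hC', kb⟩ := k.bd A
  refine ⟨C * C', by positivity, fun s v hs hv => ?_⟩
  rw [norm_mul]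
  calc _ ≤ (C * Real.exp (κ * v)) * (C' * Real.exp (κ' * v)) := by
        gcongr
        · exact hb s v hs hv
        · exact kb s v hs hv
    _ = _ := by rw [add_mul, Real.exp_add]; ring

theorem Dec.add {κ : ℝ} {H K : ℝ → ℝ → ℂ} (h : Dec κ H) (k : Dec κ K) :
    Dec κ (fun s v => H s v + K s v) := by
  refine ⟨fun s => (h.cont s).add (k.cont s), fun A => ?_⟩
  obtain ⟨C, hC, hb⟩ := h.bd A
  obtain ⟨C', hC', kb⟩ := k.bd A
  refine ⟨C + C', by positivity, fun s v hs hv => ?_⟩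
  rw [add_mul]
  exact (norm_add_le _ _).trans (add_le_add (hb s v hs hv) (kb s v hs hv))

theorem Dec.congr {κ κ' : ℝ} {H K : ℝ → ℝ → ℂ} (h : Dec κ H) (e : κ = κ') (e2 : ∀ s v, H s v = K s v) :
    Dec κ' K := by
  have : H = K := by funext s v; exact e2 s v
  subst this; subst e; exact h

theorem Dec.of_bdd {H : ℝ → ℝ → ℂ} (hc : ∀ s, Continuous (H s)) (C : ℝ) (hC : 0 ≤ C)
    (hb : ∀ s v, ‖H s v‖ ≤ C) : Dec 0 H :=
  ⟨hc, fun _ => ⟨C, hC, fun s v _ _ => by simpa using hb s v⟩⟩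

theorem Dec.integrable {κ : ℝ} {H : ℝ → ℝ → ℂ} (h : Dec κ H) (hκ : κ < 0) (s : ℝ) :
    IntegrableOn (H s) (Ioi 0) := by
  obtain ⟨C, hC, hb⟩ := h.bd |s|
  have h1 : IntegrableOn (fun w : ℝ => C * Real.exp (κ * w)) (Ioi 0) := by
    have := (exp_neg_integrableOn_Ioi 0 (b := -κ) (by linarith)).const_mul C
    simpa [IntegrableOn] using this
  refine Integrable.mono' h1 (h.cont s).aestronglyMeasurable ?_
  refine (ae_restrict_iff' measurableSet_Ioi).2 (Eventually.of_forall fun w hw => ?_)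
  exact hb s w le_rfl (le_of_lt hw)

theorem Dec.tendsto {κ : ℝ} {H : ℝ → ℝ → ℂ} (h : Dec κ H) (hκ : κ < 0) (s : ℝ) :
    Tendsto (H s) atTop (𝓝 0) := by
  obtain ⟨C, hC, hb⟩ := h.bd |s|
  have h1 : Tendsto (fun w : ℝ => C * Real.exp (κ * w)) atTop (𝓝 0) := by
    have : Tendsto (fun w : ℝ => κ * w) atTop atBot := tendsto_id.const_mul_atTop_of_neg hκ
    simpa using (Real.tendsto_exp_atBot.comp this).const_mul C
  refine squeeze_zero_norm' ?_ h1
  filter_upwards [eventually_ge_atTop 0] with w hw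
  exact hb s w le_rfl hw

theorem Dec.hasDerivAt {κ : ℝ} {H H' : ℝ → ℝ → ℂ} (h : Dec κ H) (h' : Dec κ H') (hκ : κ < 0)
    (hd : ∀ s v, HasDerivAt (fun s => H s v) (H' s v) s) (s : ℝ) :
    HasDerivAt (fun s => ∫ v in Ioi (0 : ℝ), H s v) (∫ v in Ioi (0 : ℝ), H' s v) s := by
  obtain ⟨C, hC, hb⟩ := h'.bd (|s| + 1)
  have h1 : IntegrableOn (fun w : ℝ => C * Real.exp (κ * w)) (Ioi 0) := by
    have := (exp_neg_integrableOn_Ioi 0 (b := -κ) (by linarith)).const_mul C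
    simpa [IntegrableOn] using this
  refine (hasDerivAt_integral_of_dominated_loc_of_deriv_le (s := Metric.ball s 1)
    (bound := fun w => C * Real.exp (κ * w)) (Metric.ball_mem_nhds s one_pos)
    (Eventually.of_forall fun s => (h.cont s).aestronglyMeasurable) (h.integrable hκ s)
    (h'.cont s).aestronglyMeasurable ?_ h1 (Eventually.of_forall fun v t _ => hd t v)).2
  refine (ae_restrict_iff' measurableSet_Ioi).2 (Eventually.of_forall fun w hw t ht => ?_)
  refine hb t w ?_ (le_of_lt hw)
  rw [Metric.mem_ball, Real.dist_eq] at ht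
  have := abs_add_le s (t - s)
  rw [add_sub_cancel] at this
  linarith

theorem lc_bd {A r : ℝ} (hA : 0 ≤ A) (hr : -A ≤ r) : |lc r - r| ≤ 2 * A + Real.log 2 := by
  have h2 := Real.log_pos (by norm_num : (1 : ℝ) < 2)
  have h1 : lc r ≤ |r| := by
    have : lc r = lc |r| := by unfold lc; rw [Real.cosh_abs]
    rw [this]; exact lc_le (abs_nonneg r)
  have h3 : |r| ≤ r + 2 * A := abs_le.2 ⟨by linarith, by linarith⟩
  rw [abs_le]
  constructor <;> linarith [le_lc r]

noncomputable def WW (s v : ℝ) : ℝ := lc (s + v) - lc s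

theorem WW_bd {A s v : ℝ} (hs : |s| ≤ A) (hv : 0 ≤ v) : |WW s v - v| ≤ 4 * A + 2 * Real.log 2 := by
  have hA : 0 ≤ A := (abs_nonneg _).trans hs
  have h0 := abs_le.1 hs
  have h1 := abs_le.1 (lc_bd hA h0.1)
  have h2 := abs_le.1 (lc_bd (r := s + v) hA (by linarith))
  unfold WW
  rw [abs_le]
  constructor <;> linarith

theorem continuous_lc : Continuous lc :=
  continuous_iff_continuousAt.2 fun w => (hasDerivAt_lc w).continuousAt

theorem continuous_tanh : Continuous Real.tanh :=
  continuous_iff_continuousAt.2 fun w => (hasDerivAt_tanh w).continuousAt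

theorem Dec.of_g {F : ℝ → ℂ} (hF : Continuous F) {C κ : ℝ}
    (hb : ∀ w, 0 ≤ w → ‖F w‖ ≤ C * Real.exp (κ * w)) : Dec κ (fun s v => F (WW s v)) := by
  refine ⟨fun s => hF.comp ?_, fun A => ?_⟩
  · unfold WW
    have := continuous_lc
    fun_prop
  · obtain ⟨C', hC', hb'⟩ := bound_extend hF (a := -(4 * A + 2 * Real.log 2)) hb
    refine ⟨C' * Real.exp (|κ| * (4 * A + 2 * Real.log 2)), by positivity, fun s v hs hv => ?_⟩
    have hW := WW_bd hs hv
    have hW2 := abs_le.1 hW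
    refine (hb' _ (by linarith)).trans ?_
    rw [mul_assoc, ← Real.exp_add]
    gcongr
    have h1 : κ * WW s v = κ * (WW s v - v) + κ * v := by ring
    rw [h1]
    have : κ * (WW s v - v) ≤ |κ| * |WW s v - v| := by rw [← abs_mul]; exact le_abs_self _
    have : |κ| * |WW s v - v| ≤ |κ| * (4 * A + 2 * Real.log 2) := by gcongr
    linarith

theorem Dec.of_f {F : ℝ → ℂ} (hF : Continuous F) {C κ : ℝ}
    (hb : ∀ w, 0 ≤ w → ‖F w‖ ≤ C * Real.exp (κ * w)) : Dec κ (fun s v => F (s + v)) := by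
  refine ⟨fun s => by fun_prop, fun A => ?_⟩
  obtain ⟨C', hC', hb'⟩ := bound_extend hF (a := -A) hb
  refine ⟨C' * Real.exp (|κ| * A), by positivity, fun s v hs hv => ?_⟩
  have h0 := abs_le.1 hs
  refine (hb' _ (by linarith)).trans ?_
  rw [mul_assoc, ← Real.exp_add]
  gcongr
  rw [mul_add]
  have : κ * s ≤ |κ| * |s| := by rw [← abs_mul]; exact le_abs_self _
  have : |κ| * |s| ≤ |κ| * A := by gcongr
  linarith

theorem abs_tanh_le (r : ℝ) : |Real.tanh r| ≤ 1 := abs_le.2 ⟨(lt_tanh r).le, (tanh_lt r).le⟩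

theorem tanh_sq (r : ℝ) : Real.tanh r ^ 2 = 1 - 1 / Real.cosh r ^ 2 := by
  have h := (Real.cosh_pos r).ne'
  rw [Real.tanh_eq_sinh_div_cosh, div_pow, Real.sinh_sq]; field_simp

theorem exp_WW (s v : ℝ) : Real.exp (WW s v) = Real.cosh (s + v) / Real.cosh s := by
  unfold WW lc
  rw [Real.exp_sub, Real.exp_log (Real.cosh_pos _), Real.exp_log (Real.cosh_pos _)]

theorem key_ode (ν : ℂ) (s v : ℝ) :
    gG2 ν (WW s v) * ((Real.tanh (s + v) : ℂ) ^ 2 - (Real.tanh s : ℂ) ^ 2) +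
      gG1 ν (WW s v) * (2 - (Real.tanh (s + v) : ℂ) ^ 2 - (Real.tanh s : ℂ) ^ 2) =
    ν * (ν + 1) * ((Real.tanh (s + v) : ℂ) ^ 2 - (Real.tanh s : ℂ) ^ 2) * gG ν (WW s v) := by
  have ode := gG_ode ν (WW s v)
  have c1 := (Real.cosh_pos s).ne'
  have c2 := (Real.cosh_pos (s + v)).ne'
  have e1 : Real.tanh (s + v) ^ 2 - Real.tanh s ^ 2 =
      2 / (Real.cosh s * Real.cosh (s + v)) * Real.sinh (WW s v) := by
    rw [Real.sinh_eq, Real.exp_neg, exp_WW, tanh_sq, tanh_sq]; field_simp; ring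
  have e2 : 2 - Real.tanh (s + v) ^ 2 - Real.tanh s ^ 2 =
      2 / (Real.cosh s * Real.cosh (s + v)) * Real.cosh (WW s v) := by
    rw [Real.cosh_eq (WW s v), Real.exp_neg, exp_WW, tanh_sq, tanh_sq]; field_simp; ring
  have e1' : (Real.tanh (s + v) : ℂ) ^ 2 - (Real.tanh s : ℂ) ^ 2 =
      ((2 / (Real.cosh s * Real.cosh (s + v)) : ℝ) : ℂ) * (Real.sinh (WW s v) : ℂ) := by
    exact_mod_cast e1
  have e2' : 2 - (Real.tanh (s + v) : ℂ) ^ 2 - (Real.tanh s : ℂ) ^ 2 =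
      ((2 / (Real.cosh s * Real.cosh (s + v)) : ℝ) : ℂ) * (Real.cosh (WW s v) : ℂ) := by
    exact_mod_cast e2
  rw [e1', e2']
  linear_combination ((2 / (Real.cosh s * Real.cosh (s + v)) : ℝ) : ℂ) * ode

noncomputable def qq (ν m : ℂ) (r : ℝ) : ℂ := m ^ 2 - ν * (ν + 1) * (1 - (Real.tanh r : ℂ) ^ 2)

noncomputable def qQ (ν m : ℂ) : ℝ := ‖m ^ 2‖ + ‖ν * (ν + 1)‖

theorem sech_norm (r : ℝ) : ‖(1 - (Real.tanh r : ℂ) ^ 2)‖ ≤ 1 := by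
  have h : (1 - (Real.tanh r : ℂ) ^ 2) = ((1 - Real.tanh r ^ 2 : ℝ) : ℂ) := by push_cast; ring
  have h1 := abs_le.1 (abs_tanh_le r)
  rw [h, Complex.norm_real, Real.norm_eq_abs, abs_le]
  constructor <;> nlinarith

theorem qq_bd (ν m : ℂ) (r : ℝ) : ‖qq ν m r‖ ≤ qQ ν m := by
  unfold qq qQ
  refine (norm_sub_le _ _).trans ?_
  rw [norm_mul (ν * (ν + 1))]
  have := mul_le_mul_of_nonneg_left (sech_norm r) (norm_nonneg (ν * (ν + 1)))
  linarith

theorem continuous_qq (ν m : ℂ) : Continuous (qq ν m) := by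
  unfold qq
  have := continuous_tanh
  fun_prop

/-- solutions of the ODE with prescribed decay -/
structure Sol (ν m k : ℂ) (f f1 : ℝ → ℂ) : Prop where
  d : ∀ r, HasDerivAt f (f1 r) r
  d1 : ∀ r, HasDerivAt f1 (qq ν m r * f r) r
  as : ∃ C, 0 ≤ C ∧ ∀ r, 0 ≤ r → ‖f r - k * Complex.exp (-m * r)‖ ≤ C * Real.exp (-(m.re + 2) * r)
  k0 : k ≠ 0
  m1 : ν.re < m.re
  m2 : -ν.re - 1 < m.re

theorem deriv_bd {ν m : ℂ} {f f1 : ℝ → ℂ} (d : ∀ r, HasDerivAt f (f1 r) r)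
    (d1 : ∀ r, HasDerivAt f1 (qq ν m r * f r) r) {C κ : ℝ}
    (hb : ∀ r, 0 ≤ r → ‖f r‖ ≤ C * Real.exp (κ * r)) :
    ∃ C', 0 ≤ C' ∧ ∀ r, 0 ≤ r → ‖f1 r‖ ≤ C' * Real.exp (κ * r) := by
  have hC : 0 ≤ C := by have := (norm_nonneg _).trans (hb 0 le_rfl); simpa using this
  have hQ : 0 ≤ qQ ν m := by unfold qQ; positivity
  set E := C * Real.exp |κ| with hE
  have hE0 : 0 ≤ E := by positivity
  have b2 : ∀ r t, 0 ≤ r → t ∈ Icc r (r + 1) → ‖f t‖ ≤ E * Real.exp (κ * r) := by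
    intro r t hr ht
    refine (hb t (hr.trans ht.1)).trans ?_
    rw [hE, mul_assoc, ← Real.exp_add]
    gcongr
    have h1 : κ * t = κ * (t - r) + κ * r := by ring
    have h2 : κ * (t - r) ≤ |κ| * |t - r| := by rw [← abs_mul]; exact le_abs_self _
    have h3 : |t - r| ≤ 1 := abs_le.2 ⟨by linarith [ht.1], by linarith [ht.2]⟩
    have h4 : |κ| * |t - r| ≤ |κ| * 1 := by gcongr
    linarith
  refine ⟨2 * E + qQ ν m * E, by positivity, fun r hr => ?_⟩
  have s1 : ∀ t ∈ Icc r (r + 1), ‖f1 t - f1 r‖ ≤ qQ ν m * (E * Real.exp (κ * r)) := by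
    intro t ht
    have := (convex_Icc r (r + 1)).norm_image_sub_le_of_norm_hasDerivWithin_le
      (fun u _ => (d1 u).hasDerivWithinAt) (C := qQ ν m * (E * Real.exp (κ * r)))
      (fun u hu => by
        rw [norm_mul]
        exact mul_le_mul (qq_bd ν m u) (b2 r u hr hu) (norm_nonneg _) hQ)
      (left_mem_Icc.2 (by linarith)) ht
    refine this.trans ?_
    have h3 : ‖t - r‖ ≤ 1 := abs_le.2 ⟨by linarith [ht.1], by linarith [ht.2]⟩
    exact mul_le_of_le_one_right (by positivity) h3
  have s2 : ‖(f (r + 1) - (r + 1 : ℝ) * f1 r) - (f r - r * f1 r)‖ ≤ qQ ν m * (E * Real.exp (κ * r)) := by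
    have := (convex_Icc r (r + 1)).norm_image_sub_le_of_norm_hasDerivWithin_le
      (f := fun t : ℝ => f t - t * f1 r) (f' := fun t => f1 t - f1 r)
      (fun u _ => by
        have h0 : HasDerivAt (fun r : ℝ => (r : ℂ)) 1 u := Complex.ofRealCLM.hasDerivAt
        have := (d u).sub (h0.mul_const (f1 r))
        rw [one_mul] at this
        exact this.hasDerivWithinAt) s1
      (left_mem_Icc.2 (by linarith)) (right_mem_Icc.2 (by linarith))
    simpa using this
  have s3 : f1 r = f (r + 1) - f r - ((f (r + 1) - (r + 1 : ℝ) * f1 r) - (f r - r * f1 r)) := by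
    push_cast; ring
  rw [s3]
  refine (norm_sub_le _ _).trans ?_
  have := norm_sub_le (f (r + 1)) (f r)
  have := b2 r r hr (left_mem_Icc.2 (by linarith))
  have := b2 r (r + 1) hr (right_mem_Icc.2 (by linarith))
  linarith

theorem Sol.b {ν m k : ℂ} {f f1 : ℝ → ℂ} (h : Sol ν m k f f1) :
    ∃ C, 0 ≤ C ∧ ∀ r, 0 ≤ r → ‖f r‖ ≤ C * Real.exp (-m.re * r) := by
  obtain ⟨C, hC, hb⟩ := h.as
  refine ⟨C + ‖k‖, by positivity, fun r hr => ?_⟩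
  have e : f r = (f r - k * Complex.exp (-m * r)) + k * Complex.exp (-m * r) := by ring
  rw [e, add_mul]
  refine (norm_add_le _ _).trans ?_
  gcongr
  · refine (hb r hr).trans ?_
    gcongr
    nlinarith
  · rw [norm_mul, norm_cexp_mul]

theorem Sol.m_gt {ν m k : ℂ} {f f1 : ℝ → ℂ} (h : Sol ν m k f f1) : -(1/2) < m.re := by
  linarith [h.m1, h.m2]

end FSI

namespace FSI
open Filter Topology

noncomputable def TT (r : ℝ) : ℂ := (Real.tanh r : ℂ)

theorem hasDerivAt_TT (r : ℝ) : HasDerivAt TT (1 - TT r ^ 2) r := by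
  refine HasDerivAt.congr_deriv (hasDerivAt_tanh r).ofReal_comp ?_
  unfold TT; push_cast; ring

theorem TT_norm (r : ℝ) : ‖TT r‖ ≤ 1 := by
  unfold TT; rw [Complex.norm_real]; exact abs_tanh_le r

theorem continuous_TT : Continuous TT :=
  continuous_iff_continuousAt.2 fun w => (hasDerivAt_TT w).continuousAt

noncomputable def dl (s v : ℝ) : ℂ := TT (s + v) - TT s

noncomputable def H0 (ν : ℂ) (f : ℝ → ℂ) (s v : ℝ) : ℂ := f (s + v) * gG ν (WW s v)
noncomputable def H1 (ν : ℂ) (f f1 : ℝ → ℂ) (s v : ℝ) : ℂ :=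
  f1 (s + v) * gG ν (WW s v) + f (s + v) * gG1 ν (WW s v) * dl s v
noncomputable def H2 (ν m : ℂ) (f f1 : ℝ → ℂ) (s v : ℝ) : ℂ :=
  qq ν m (s + v) * f (s + v) * gG ν (WW s v) + 2 * (f1 (s + v) * gG1 ν (WW s v) * dl s v)
    + f (s + v) * gG2 ν (WW s v) * (dl s v ^ 2)
    + f (s + v) * gG1 ν (WW s v) * (TT s ^ 2 - TT (s + v) ^ 2)
noncomputable def HB (ν : ℂ) (f : ℝ → ℂ) (s v : ℝ) : ℂ :=
  2 * (f (s + v) * gG1 ν (WW s v) * dl s v)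

theorem hasDerivAt_shift_s {f : ℝ → ℂ} {f' : ℂ} {s v : ℝ} (h : HasDerivAt f f' (s + v)) :
    HasDerivAt (fun s => f (s + v)) f' s := h.comp_add_const s v
theorem hasDerivAt_shift_v {f : ℝ → ℂ} {f' : ℂ} {s v : ℝ} (h : HasDerivAt f f' (s + v)) :
    HasDerivAt (fun v => f (s + v)) f' v := h.comp_const_add s v

theorem hasDerivAt_WW_s {g : ℝ → ℂ} {g' : ℂ} {s v : ℝ} (h : HasDerivAt g g' (WW s v)) :
    HasDerivAt (fun s => g (WW s v)) (g' * dl s v) s := by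
  have h1 : HasDerivAt (fun s => WW s v) (Real.tanh (s + v) - Real.tanh s) s :=
    ((hasDerivAt_lc (s + v)).comp_add_const s v).sub (hasDerivAt_lc s)
  have := h.scomp s h1
  refine HasDerivAt.congr_deriv this ?_
  unfold dl TT
  rw [Complex.real_smul]; push_cast; ring

theorem hasDerivAt_WW_v {g : ℝ → ℂ} {g' : ℂ} {s v : ℝ} (h : HasDerivAt g g' (WW s v)) :
    HasDerivAt (fun v => g (WW s v)) (g' * TT (s + v)) v := by
  have h1 : HasDerivAt (fun v => WW s v) (Real.tanh (s + v)) v :=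
    ((hasDerivAt_lc (s + v)).comp_const_add s v).sub_const _
  have := h.scomp v h1
  refine HasDerivAt.congr_deriv this ?_
  unfold TT
  rw [Complex.real_smul]; push_cast; ring

theorem hasDerivAt_dl_s (s v : ℝ) :
    HasDerivAt (fun s => dl s v) (TT s ^ 2 - TT (s + v) ^ 2) s := by
  refine HasDerivAt.congr_deriv
    ((hasDerivAt_shift_s (hasDerivAt_TT (s + v))).sub (hasDerivAt_TT s)) ?_
  ring
theorem hasDerivAt_dl_v (s v : ℝ) :
    HasDerivAt (fun v => dl s v) (1 - TT (s + v) ^ 2) v :=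
  (hasDerivAt_shift_v (hasDerivAt_TT (s + v))).sub_const _

section
variable {ν m k : ℂ} {f f1 : ℝ → ℂ}

theorem Sol.cont (h : Sol ν m k f f1) : Continuous f :=
  continuous_iff_continuousAt.2 fun w => (h.d w).continuousAt
theorem Sol.cont1 (h : Sol ν m k f f1) : Continuous f1 :=
  continuous_iff_continuousAt.2 fun w => (h.d1 w).continuousAt

theorem Sol.H0_d (h : Sol ν m k f f1) (s v : ℝ) :
    HasDerivAt (fun s => H0 ν f s v) (H1 ν f f1 s v) s := by
  have := (hasDerivAt_shift_s (h.d (s + v))).mul (hasDerivAt_WW_s (hasDerivAt_gG ν (WW s v)))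
  refine HasDerivAt.congr_deriv this ?_
  unfold H1; ring

theorem Sol.H1_d (h : Sol ν m k f f1) (s v : ℝ) :
    HasDerivAt (fun s => H1 ν f f1 s v) (H2 ν m f f1 s v) s := by
  have := ((hasDerivAt_shift_s (h.d1 (s + v))).mul (hasDerivAt_WW_s (hasDerivAt_gG ν (WW s v)))).add
    (((hasDerivAt_shift_s (h.d (s + v))).mul (hasDerivAt_WW_s (hasDerivAt_gG1 ν (WW s v)))).mul
      (hasDerivAt_dl_s s v))
  refine HasDerivAt.congr_deriv this ?_
  unfold H2; simp only [Pi.mul_apply]; ring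

theorem Sol.HB_d (h : Sol ν m k f f1) (s v : ℝ) :
    HasDerivAt (fun v => HB ν f s v) (H2 ν m f f1 s v - qq ν m s * H0 ν f s v) v := by
  have := ((((hasDerivAt_shift_v (h.d (s + v))).mul (hasDerivAt_WW_v (hasDerivAt_gG1 ν (WW s v)))).mul
      (hasDerivAt_dl_v s v)).const_mul 2)
  refine HasDerivAt.congr_deriv this ?_
  have ode := key_ode ν s v
  unfold H2 H0 dl qq TT; simp only [Pi.mul_apply]
  linear_combination f (s + v) * ode

theorem Dec.dl : Dec 0 dl := by
  refine Dec.of_bdd (fun s => ?_) 2 (by norm_num) (fun s v => ?_)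
  · have := continuous_TT
    unfold FSI.dl; fun_prop
  · refine (norm_sub_le _ _).trans ?_
    linarith [TT_norm s, TT_norm (s + v)]

theorem Dec.T2 : Dec 0 (fun s v => TT s ^ 2 - TT (s + v) ^ 2) := by
  refine Dec.of_bdd (fun s => ?_) 2 (by norm_num) (fun s v => ?_)
  · have := continuous_TT
    fun_prop
  · refine (norm_sub_le _ _).trans ?_
    rw [norm_pow, norm_pow]
    have := pow_le_one₀ (n := 2) (norm_nonneg _) (TT_norm s)
    have := pow_le_one₀ (n := 2) (norm_nonneg _) (TT_norm (s + v))
    linarith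

theorem Dec.const (c : ℂ) : Dec 0 (fun _ _ => c) :=
  Dec.of_bdd (fun _ => continuous_const) ‖c‖ (norm_nonneg _) (fun _ _ => le_rfl)

theorem Dec.qq (ν m : ℂ) : Dec 0 (fun s v => qq ν m (s + v)) :=
  Dec.of_bdd (fun s => by have := continuous_qq ν m; fun_prop) (qQ ν m) (by unfold qQ; positivity)
    (fun _ _ => qq_bd _ _ _)

theorem Sol.decs (h : Sol ν m k f f1) : ∃ κ, κ < 0 ∧ Dec κ (H0 ν f) ∧ Dec κ (H1 ν f f1) ∧
    Dec κ (H2 ν m f f1) ∧ Dec κ (HB ν f) := by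
  obtain ⟨κ, k1, k2, k3⟩ := exists_kappa h.m1 h.m2
  obtain ⟨C0, hC0, b0⟩ := gG_bound ν k1 k2
  obtain ⟨C1, hC1, b1⟩ := gG1_bound ν k1 k2
  obtain ⟨C2, hC2, b2⟩ := gG2_bound ν k1 k2
  obtain ⟨K0, hK0, c0⟩ := h.b
  obtain ⟨K1, hK1, c1⟩ := deriv_bd h.d h.d1 c0
  have g0 := Dec.of_g (continuous_gG ν) b0
  have g1 := Dec.of_g (continuous_gG1 ν) b1
  have g2 := Dec.of_g (continuous_gG2 ν) b2
  have f0 := Dec.of_f h.cont c0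
  have f1' := Dec.of_f h.cont1 c1
  have B := (f0.mul g1).mul Dec.dl
  refine ⟨-m.re + κ, by linarith, f0.mul g0, ?_, ?_, ?_⟩
  · exact (f1'.mul g0).add (B.congr (by ring) fun _ _ => rfl)
  · have t1 := ((Dec.qq ν m).mul f0).mul g0
    have t2 := (Dec.const 2).mul ((f1'.mul g1).mul Dec.dl)
    have t3 := (f0.mul g2).mul (Dec.dl.mul Dec.dl)
    have t4 := (f0.mul g1).mul Dec.T2
    have e : -m.re + κ = -m.re + κ := rfl
    exact (((t1.congr (κ' := -m.re + κ) (by ring) fun _ _ => rfl).add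
      (t2.congr (κ' := -m.re + κ) (by ring) fun _ _ => rfl)).add
      (t3.congr (κ' := -m.re + κ) (by ring) fun _ _ => rfl)).add
      (t4.congr (κ' := -m.re + κ) (by ring) fun _ _ => rfl) |>.congr rfl (fun s v => by unfold H2; ring)
  · exact ((Dec.const 2).mul B).congr (by ring) fun _ _ => rfl

noncomputable def Fi (ν : ℂ) (f : ℝ → ℂ) (s : ℝ) : ℂ := ∫ v in Ioi (0 : ℝ), H0 ν f s v
noncomputable def Fi1 (ν : ℂ) (f f1 : ℝ → ℂ) (s : ℝ) : ℂ := ∫ v in Ioi (0 : ℝ), H1 ν f f1 s v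

theorem Sol.Fi_d (h : Sol ν m k f f1) (s : ℝ) : HasDerivAt (Fi ν f) (Fi1 ν f f1 s) s := by
  obtain ⟨κ, hκ, d0, d1, d2, dB⟩ := h.decs
  exact d0.hasDerivAt d1 hκ h.H0_d s

theorem Sol.Fi1_d (h : Sol ν m k f f1) (s : ℝ) :
    HasDerivAt (Fi1 ν f f1) (qq ν m s * Fi ν f s) s := by
  obtain ⟨κ, hκ, d0, d1, d2, dB⟩ := h.decs
  refine HasDerivAt.congr_deriv (d1.hasDerivAt d2 hκ h.H1_d s) ?_
  have i0 := (d0.integrable hκ s).const_mul (FSI.qq ν m s)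
  have i2 := d2.integrable hκ s
  have := integral_Ioi_of_hasDerivAt_of_tendsto' (a := 0) (fun v _ => h.HB_d s v) (i2.sub i0)
    (dB.tendsto hκ s)
  rw [integral_sub i2 i0, integral_const_mul] at this
  have z : HB ν f s 0 = 0 := by simp [HB, dl]
  rw [z, sub_zero, sub_eq_zero] at this
  exact this

theorem lc_eq (r : ℝ) : lc r = r - Real.log 2 + Real.log (1 + Real.exp (-2 * r)) := by
  have h0 : (0 : ℝ) < 1 + Real.exp (-2 * r) := by positivity
  have e : Real.cosh r = Real.exp r / 2 * (1 + Real.exp (-2 * r)) := by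
    rw [Real.cosh_eq, show -2 * r = -r + -r by ring, Real.exp_add, Real.exp_neg]; field_simp
  unfold lc
  rw [e, Real.log_mul (by positivity) h0.ne', Real.log_div (by positivity) (by norm_num), Real.log_exp]

theorem WW_asymp {s v : ℝ} (hv : 0 ≤ v) :
    WW s v ≤ v ∧ v - Real.exp (-2 * s) ≤ WW s v := by
  unfold WW
  rw [lc_eq, lc_eq]
  have h1 : Real.log (1 + Real.exp (-2 * (s + v))) ≤ Real.log (1 + Real.exp (-2 * s)) := by
    apply Real.log_le_log (by positivity)
    have := Real.exp_le_exp.2 (by linarith : -2 * (s + v) ≤ -2 * s)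
    linarith
  have h2 : 0 ≤ Real.log (1 + Real.exp (-2 * (s + v))) := Real.log_nonneg (by
    have := Real.exp_pos (-2 * (s + v)); linarith)
  have h3 : Real.log (1 + Real.exp (-2 * s)) ≤ Real.exp (-2 * s) := by
    have := Real.log_le_sub_one_of_pos (x := 1 + Real.exp (-2 * s)) (by positivity)
    linarith
  constructor <;> linarith

theorem g_diff (ν : ℂ) {κ : ℝ} (k1 : ν.re < κ) (k2 : -ν.re - 1 < κ) :
    ∃ C, 0 ≤ C ∧ ∀ s v, 0 ≤ s → 0 ≤ v →
      ‖gG ν (WW s v) - gG ν v‖ ≤ C * Real.exp (κ * v) * Real.exp (-2 * s) := by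
  obtain ⟨C1, hC1, b1⟩ := gG1_bound ν k1 k2
  obtain ⟨C, hC, b⟩ := bound_extend (continuous_gG1 ν) (a := -1) b1
  refine ⟨C * Real.exp |κ|, by positivity, fun s v hs hv => ?_⟩
  obtain ⟨w1, w2⟩ := WW_asymp (s := s) hv
  have he : Real.exp (-2 * s) ≤ 1 := Real.exp_le_one_iff.2 (by linarith)
  have := (convex_Icc (WW s v) v).norm_image_sub_le_of_norm_hasDerivWithin_le
      (fun u _ => (hasDerivAt_gG ν u).hasDerivWithinAt) (C := C * Real.exp |κ| * Real.exp (κ * v))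
      (fun u hu => by
        refine (b u (by linarith [hu.1])).trans ?_
        rw [mul_assoc, ← Real.exp_add]
        gcongr
        have h1 : κ * u = κ * (u - v) + κ * v := by ring
        have h2 : κ * (u - v) ≤ |κ| * |u - v| := by rw [← abs_mul]; exact le_abs_self _
        have h3 : |u - v| ≤ 1 := abs_le.2 ⟨by linarith [hu.1], by linarith [hu.2]⟩
        have h4 : |κ| * |u - v| ≤ |κ| * 1 := by gcongr
        linarith)
      (right_mem_Icc.2 w1) (left_mem_Icc.2 w1)
  refine this.trans ?_
  gcongr
  rw [Real.norm_eq_abs, abs_le]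
  constructor <;> linarith [Real.exp_pos (-2 * s)]

theorem Sol.Fi_asymp (h : Sol ν m k f f1) : ∃ C, 0 ≤ C ∧ ∀ s, 0 ≤ s →
    ‖Fi ν f s - k * Complex.exp (-m * s) * LG ν m‖ ≤ C * Real.exp (-(m.re + 2) * s) := by
  obtain ⟨κ, k1, k2, k3⟩ := exists_kappa h.m1 h.m2
  obtain ⟨C0, hC0, b0⟩ := gG_bound ν k1 k2
  obtain ⟨C1, hC1, b1⟩ := g_diff ν k1 k2
  obtain ⟨C2, hC2, b2⟩ := h.as
  obtain ⟨κ', hκ', d0, _⟩ := h.decs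
  set B := C2 * (C0 + C1) + ‖k‖ * C1
  refine ⟨B / (m.re - κ), by have : 0 < m.re - κ := by linarith
                             positivity, fun s hs => ?_⟩
  have i0 := d0.integrable hκ' s
  have i1 := (lap_int (continuous_gG ν) b0 k3).const_mul (k * Complex.exp (-m * s))
  have e : Fi ν f s - k * Complex.exp (-m * s) * LG ν m = ∫ v in Ioi (0 : ℝ),
      (H0 ν f s v - k * Complex.exp (-m * s) * (Complex.exp (-m * v) * gG ν v)) := by
    rw [integral_sub i0 i1, integral_const_mul]; rfl
  rw [e]
  have h1 : IntegrableOn (fun w : ℝ => B * Real.exp (-(m.re + 2) * s) * Real.exp (-(m.re - κ) * w)) (Ioi 0) :=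
    (exp_neg_integrableOn_Ioi 0 (by linarith)).const_mul _
  have := norm_integral_le_of_norm_le (μ := volume.restrict (Ioi 0))
    (f := fun v => (H0 ν f s v - k * Complex.exp (-m * s) * (Complex.exp (-m * v) * gG ν v)))
    h1 ((ae_restrict_iff' measurableSet_Ioi).2
    (Eventually.of_forall fun v hv => ?_))
  · refine this.trans (le_of_eq ?_)
    rw [integral_const_mul, integral_exp_mul_Ioi (by linarith)]
    have : m.re - κ ≠ 0 := by linarith
    simp only [mul_zero, Real.exp_zero]
    field_simp
  · have hv : (0 : ℝ) ≤ v := le_of_lt hv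
    have he : Real.exp (-2 * s) ≤ 1 := Real.exp_le_one_iff.2 (by linarith)
    have a1 : ‖gG ν (WW s v)‖ ≤ (C0 + C1) * Real.exp (κ * v) := by
      have := norm_add_le (gG ν v) (gG ν (WW s v) - gG ν v)
      rw [add_sub_cancel] at this
      have t1 := b0 v hv
      have t2 := (b1 s v hs hv).trans (mul_le_of_le_one_right (by positivity) he)
      linarith
    have a2 := b2 (s + v) (by linarith)
    have a3 := b1 s v hs hv
    have ee : H0 ν f s v - k * Complex.exp (-m * s) * (Complex.exp (-m * v) * gG ν v) =
        (f (s + v) - k * Complex.exp (-m * (s + v : ℝ))) * gG ν (WW s v) +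
        k * Complex.exp (-m * (s + v : ℝ)) * (gG ν (WW s v) - gG ν v) := by
      unfold H0
      rw [show -m * ((s + v : ℝ) : ℂ) = -m * s + -m * v by push_cast; ring, Complex.exp_add]; ring
    rw [ee]
    refine (norm_add_le _ _).trans ?_
    rw [norm_mul, norm_mul, norm_mul, norm_cexp_mul]
    have x1 : Real.exp (-(m.re + 2) * (s + v)) * Real.exp (κ * v) ≤
        Real.exp (-(m.re + 2) * s) * Real.exp (-(m.re - κ) * v) := by
      rw [← Real.exp_add, ← Real.exp_add]
      apply Real.exp_le_exp.2
      nlinarith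
    have x2 : Real.exp (-m.re * (s + v)) * (Real.exp (κ * v) * Real.exp (-2 * s)) =
        Real.exp (-(m.re + 2) * s) * Real.exp (-(m.re - κ) * v) := by
      rw [← Real.exp_add, ← Real.exp_add, ← Real.exp_add]
      congr 1
      ring
    calc _ ≤ (C2 * Real.exp (-(m.re + 2) * (s + v))) * ((C0 + C1) * Real.exp (κ * v)) +
          ‖k‖ * Real.exp (-m.re * (s + v)) * (C1 * Real.exp (κ * v) * Real.exp (-2 * s)) := by gcongr
      _ = C2 * (C0 + C1) * (Real.exp (-(m.re + 2) * (s + v)) * Real.exp (κ * v)) +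
          ‖k‖ * C1 * (Real.exp (-m.re * (s + v)) * (Real.exp (κ * v) * Real.exp (-2 * s))) := by ring
      _ ≤ C2 * (C0 + C1) * (Real.exp (-(m.re + 2) * s) * Real.exp (-(m.re - κ) * v)) +
          ‖k‖ * C1 * (Real.exp (-(m.re + 2) * s) * Real.exp (-(m.re - κ) * v)) := by
            rw [x2]; gcongr
      _ = _ := by ring

/-- f does not decay faster than its leading term -/
theorem Sol.not_small (h : Sol ν m k f f1) {C : ℝ}
    (hb : ∀ s, 0 ≤ s → ‖f s‖ ≤ C * Real.exp (-(m.re + 2) * s)) : False := by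
  obtain ⟨C2, hC2, b2⟩ := h.as
  have hk : 0 < ‖k‖ := norm_pos_iff.2 h.k0
  have key : ∀ s, 0 ≤ s → ‖k‖ * Real.exp (2 * s) ≤ C + C2 := by
    intro s hs
    have t1 := hb s hs
    have t2 := b2 s hs
    have t3 := norm_sub_le (f s) (f s - k * Complex.exp (-m * s))
    rw [sub_sub_cancel, norm_mul, norm_cexp_mul] at t3
    have t4 : ‖k‖ * Real.exp (2 * s) * Real.exp (-(m.re + 2) * s) ≤ (C + C2) * Real.exp (-(m.re + 2) * s) := by
      rw [mul_assoc, ← Real.exp_add]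
      rw [show 2 * s + -(m.re + 2) * s = -m.re * s by ring]
      linarith
    exact le_of_mul_le_mul_right t4 (Real.exp_pos _)
  have t := key ((C + C2) / ‖k‖ / 2) (by
    have := key 0 le_rfl
    simp at this
    have : 0 ≤ C + C2 := by linarith
    positivity)
  have t2 := Real.add_one_le_exp (2 * ((C + C2) / ‖k‖ / 2))
  have t3 : ‖k‖ * (2 * ((C + C2) / ‖k‖ / 2) + 1) ≤ C + C2 := le_trans (by gcongr) t
  rw [show ‖k‖ * (2 * ((C + C2) / ‖k‖ / 2) + 1) = (C + C2) + ‖k‖ by field_simp] at t3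
  linarith

theorem ode_zero {D D1 : ℝ → ℂ} (d : ∀ r, HasDerivAt D (D1 r) r)
    (d1 : ∀ r, HasDerivAt D1 (qq ν m r * D r) r) {S : ℝ} (z : D S = 0) (z1 : D1 S = 0) (r : ℝ) : D r = 0 := by
  have hQ : 0 ≤ qQ ν m := by unfold qQ; positivity
  have hv : ∀ t : ℝ, LipschitzOnWith (Real.toNNReal (1 + qQ ν m))
      (fun p : ℂ × ℂ => (p.2, FSI.qq ν m t * p.1)) univ := by
    intro t
    refine LipschitzOnWith.of_dist_le_mul fun p _ p' _ => ?_
    rw [Real.coe_toNNReal _ (by positivity), Prod.dist_eq, dist_eq_norm, dist_eq_norm]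
    simp only
    rw [← mul_sub, norm_mul]
    have q1 : ‖p.1 - p'.1‖ ≤ dist p p' := by rw [← dist_eq_norm, Prod.dist_eq]; exact le_max_left _ _
    have q2 : ‖p.2 - p'.2‖ ≤ dist p p' := by rw [← dist_eq_norm, Prod.dist_eq]; exact le_max_right _ _
    have q3 : (0 : ℝ) ≤ dist p p' := dist_nonneg
    apply max_le
    · nlinarith
    · have := mul_le_mul (qq_bd ν m t) q1 (norm_nonneg _) hQ
      linarith
  have := ODE_solution_unique_univ (v := fun t p => (p.2, FSI.qq ν m t * p.1)) (s := fun _ => univ)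
    (f := fun t => (D t, D1 t)) (g := fun _ => (0, 0)) (t₀ := S) hv
    (fun t => ⟨(d t).prodMk (d1 t), mem_univ _⟩)
    (fun t => ⟨HasDerivAt.congr_deriv (hasDerivAt_const t ((0 : ℂ), (0 : ℂ))) (by ext <;> simp), mem_univ _⟩) (by simp [z, z1])
  exact congrArg Prod.fst (congrFun this r)

theorem Sol.unique (h : Sol ν m k f f1) {D D1 : ℝ → ℂ} (d : ∀ r, HasDerivAt D (D1 r) r)
    (d1 : ∀ r, HasDerivAt D1 (qq ν m r * D r) r) {C : ℝ}
    (hb : ∀ s, 0 ≤ s → ‖D s‖ ≤ C * Real.exp (-(m.re + 2) * s)) (r : ℝ) : D r = 0 := by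
  have hC : 0 ≤ C := by have := (norm_nonneg _).trans (hb 0 le_rfl); simpa using this
  obtain ⟨C', hC', hb'⟩ := deriv_bd d d1 hb
  obtain ⟨K0, hK0, c0⟩ := h.b
  obtain ⟨K1, hK1, c1⟩ := deriv_bd h.d h.d1 c0
  -- Wronskian
  have hW : ∀ s, D s * f1 s - D1 s * f s = 0 := by
    have hd : ∀ s, HasDerivAt (fun s => D s * f1 s - D1 s * f s) 0 s := by
      intro s
      refine HasDerivAt.congr_deriv (((d s).mul (h.d1 s)).sub ((d1 s).mul (h.d s))) ?_
      ring
    have hconst := is_const_of_deriv_eq_zero (fun s => (hd s).differentiableAt) (fun s => (hd s).deriv)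
    have hlim : Tendsto (fun s => D s * f1 s - D1 s * f s) atTop (𝓝 0) := by
      have h1 : Tendsto (fun w : ℝ => (C * K1 + C' * K0) * Real.exp (-(2 * m.re + 2) * w)) atTop (𝓝 0) := by
        have : Tendsto (fun w : ℝ => -(2 * m.re + 2) * w) atTop atBot :=
          tendsto_id.const_mul_atTop_of_neg (by linarith [h.m_gt])
        simpa using (Real.tendsto_exp_atBot.comp this).const_mul (C * K1 + C' * K0)
      refine squeeze_zero_norm' ?_ h1
      filter_upwards [eventually_ge_atTop 0] with s hs
      refine (norm_sub_le _ _).trans ?_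
      rw [norm_mul, norm_mul]
      calc _ ≤ (C * Real.exp (-(m.re + 2) * s)) * (K1 * Real.exp (-m.re * s)) +
            (C' * Real.exp (-(m.re + 2) * s)) * (K0 * Real.exp (-m.re * s)) := by
              gcongr
              · exact hb s hs
              · exact c1 s hs
              · exact hb' s hs
              · exact c0 s hs
        _ = _ := by
          rw [show -(2 * m.re + 2) * s = -(m.re + 2) * s + -m.re * s by ring, Real.exp_add]; ring
    intro s
    refine tendsto_nhds_unique ?_ hlim
    exact tendsto_const_nhds.congr (fun t => hconst s t)
  obtain ⟨S, hS⟩ : ∃ S, f S ≠ 0 := by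
    by_contra hne
    push Not at hne
    exact h.not_small (C := 0) (fun s _ => by simp [hne s])
  set l := D S / f S with hl
  have hD : ∀ r, D r - l * f r = 0 := by
    refine ode_zero (D1 := fun r => D1 r - l * f1 r) (ν := ν) (m := m) (S := S) ?_ ?_ ?_ ?_
    · intro r; exact (d r).sub ((h.d r).const_mul l)
    · intro r
      refine HasDerivAt.congr_deriv ((d1 r).sub ((h.d1 r).const_mul l)) ?_
      ring
    · rw [hl]; field_simp; ring
    · have := hW S
      rw [hl]; field_simp; linear_combination -this
  by_cases hl0 : l = 0
  · have := hD r; rw [hl0] at this; simpa using this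
  · exfalso
    refine h.not_small (C := C / ‖l‖) (fun s hs => ?_)
    have e : D s = l * f s := by linear_combination hD s
    have := hb s hs
    rw [e, norm_mul] at this
    have hlp : 0 < ‖l‖ := norm_pos_iff.2 hl0
    rw [div_mul_eq_mul_div, le_div_iff₀ hlp]
    linarith

theorem Sol.main (h : Sol ν m k f f1) (s : ℝ) : Fi ν f s = LG ν m * f s := by
  obtain ⟨C, hC, hb⟩ := h.Fi_asymp
  obtain ⟨C2, hC2, b2⟩ := h.as
  have := h.unique (D := fun s => Fi ν f s - LG ν m * f s)
    (D1 := fun s => Fi1 ν f f1 s - LG ν m * f1 s) (C := C + ‖LG ν m‖ * C2)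
    (fun r => (h.Fi_d r).sub ((h.d r).const_mul _))
    (fun r => HasDerivAt.congr_deriv ((h.Fi1_d r).sub ((h.d1 r).const_mul _)) (by ring))
    (fun s hs => by
      have e : Fi ν f s - LG ν m * f s = (Fi ν f s - k * Complex.exp (-m * s) * LG ν m) -
        LG ν m * (f s - k * Complex.exp (-m * s)) := by ring
      rw [e]
      refine (norm_sub_le _ _).trans ?_
      rw [norm_mul (LG ν m)]
      have t1 := hb s hs
      have t2 := mul_le_mul_of_nonneg_left (b2 s hs) (norm_nonneg (LG ν m))
      linarith) s
  linear_combination this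

end

end FSI

namespace FSI
open Filter Topology

theorem Good.bdd {p : ℕ → ℂ} (hp : Good p) : ∃ C, 0 ≤ C ∧ ∀ z : ℂ, ‖z‖ ≤ 1 / 2 → ‖PS p z‖ ≤ C := by
  have hc : ContinuousOn (PS p) (Metric.closedBall 0 (1 / 2)) := fun z hz =>
    (hp.hasDerivAt (by
      have : ‖z‖ ≤ 1 / 2 := by simpa using hz
      linarith)).continuousAt.continuousWithinAt
  obtain ⟨C, hC⟩ := (isCompact_closedBall (0 : ℂ) (1 / 2)).exists_bound_of_continuousOn hc
  refine ⟨C, (norm_nonneg _).trans (hC 0 (by simp)), fun z hz => hC z (by simpa using hz)⟩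

theorem Good.first {p : ℕ → ℂ} (hp : Good p) :
    ∃ C, 0 ≤ C ∧ ∀ z : ℂ, ‖z‖ ≤ 1 / 2 → ‖PS p z - p 0‖ ≤ C * ‖z‖ := by
  obtain ⟨C, hC, hb⟩ := hp.dp.bdd
  refine ⟨C, hC, fun z hz => ?_⟩
  have := (convex_closedBall (0 : ℂ) (1 / 2)).norm_image_sub_le_of_norm_hasDerivWithin_le
    (f := PS p) (f' := PS (FSI.dp p)) (C := C) (x := 0) (y := z)
    (fun u hu => (hp.hasDerivAt (by
      have : ‖u‖ ≤ 1 / 2 := by simpa using hu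
      linarith)).hasDerivWithinAt)
    (fun u hu => hb u (by simpa using hu)) (by simp) (by simpa using hz)
  simpa [PS_zero] using this

theorem Good.second {p : ℕ → ℂ} (hp : Good p) :
    ∃ C, 0 ≤ C ∧ ∀ z : ℂ, ‖z‖ ≤ 1 / 2 → ‖PS p z - p 0 - p 1 * z‖ ≤ C * ‖z‖ ^ 2 := by
  obtain ⟨C, hC, hb⟩ := hp.dp.first
  refine ⟨C, hC, fun z hz => ?_⟩
  have h0 : FSI.dp p 0 = p 1 := by simp [FSI.dp]
  rw [h0] at hb
  have := (convex_closedBall (0 : ℂ) ‖z‖).norm_image_sub_le_of_norm_hasDerivWithin_le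
    (f := fun u => PS p u - p 1 * u) (f' := fun u => PS (FSI.dp p) u - p 1) (C := C * ‖z‖) (x := 0) (y := z)
    (fun u hu => by
      have h1 : ‖u‖ ≤ ‖z‖ := by simpa using hu
      have := (hp.hasDerivAt (z := u) (by linarith)).sub ((hasDerivAt_id u).const_mul (p 1))
      rw [mul_one] at this
      exact this.hasDerivWithinAt)
    (fun u hu => by
      have h1 : ‖u‖ ≤ ‖z‖ := by simpa using hu
      refine (hb u (by linarith)).trans ?_
      gcongr) (by simp) (by simp)
  simp only [PS_zero, mul_zero, sub_zero] at this
  rw [pow_two, ← mul_assoc, show PS p z - p 0 - p 1 * z = PS p z - p 1 * z - p 0 by ring]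
  exact this

noncomputable def yy (r : ℝ) : ℝ := (1 - Real.tanh r) / 2

theorem yy_eq (r : ℝ) : yy r = Real.exp (-2 * r) * (1 - yy r) := by
  have h := exp_two_mul_tanh r
  have h2 : 1 + Real.tanh r ≠ 0 := by linarith [lt_tanh r]
  rw [div_eq_iff h2] at h
  unfold yy; linarith

theorem yy_pos (r : ℝ) : 0 < yy r := by unfold yy; linarith [tanh_lt r]
theorem yy_lt_one (r : ℝ) : yy r < 1 := by unfold yy; linarith [lt_tanh r]
theorem yy_le (r : ℝ) : yy r ≤ Real.exp (-2 * r) := by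
  rw [yy_eq]; exact mul_le_of_le_one_right (Real.exp_pos _).le (by linarith [yy_pos r])
theorem yy_half {r : ℝ} (hr : 0 ≤ r) : yy r ≤ 1 / 2 := by
  have h := yy_eq r
  have h1 : Real.exp (-2 * r) ≤ 1 := Real.exp_le_one_iff.2 (by linarith)
  nlinarith [yy_lt_one r]

theorem yy_norm (r : ℝ) : ‖((yy r : ℝ) : ℂ)‖ = yy r := by
  rw [Complex.norm_real, Real.norm_of_nonneg (yy_pos r).le]

theorem fF_as (ν μ : ℂ) : ∃ C, 0 ≤ C ∧ ∀ r, 0 ≤ r →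
    ‖fF ν μ r - hc (-ν) (ν + 1) (1 + μ) 0 * Complex.exp (-μ * r)‖ ≤ C * Real.exp (-(μ.re + 2) * r) := by
  obtain ⟨C, hC, hb⟩ := (hc_good (-ν) (ν + 1) (1 + μ)).first
  refine ⟨C, hC, fun r hr => ?_⟩
  have e : fF ν μ r - hc (-ν) (ν + 1) (1 + μ) 0 * Complex.exp (-μ * r) =
      Complex.exp (-μ * r) * (PS (hc (-ν) (ν + 1) (1 + μ)) (yy r) - hc (-ν) (ν + 1) (1 + μ) 0) := by
    unfold fF yy; ring
  rw [e, norm_mul, norm_cexp_mul]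
  have h1 := hb (yy r) (by rw [yy_norm]; exact yy_half hr)
  rw [yy_norm] at h1
  have h2 := mul_le_mul_of_nonneg_left (yy_le r) hC
  rw [show -(μ.re + 2) * r = -μ.re * r + -2 * r by ring, Real.exp_add]
  calc _ ≤ Real.exp (-μ.re * r) * (C * Real.exp (-2 * r)) := by gcongr; linarith
    _ = _ := by ring

theorem hc_zero (ν μ : ℂ) : hc (-ν) (ν + 1) (1 + μ) 0 = 1 / Complex.Gamma (1 + μ) := by simp [hc]

theorem solA {ν μ : ℂ} (h1 : ν.re < μ.re) (h2 : -ν.re - 1 < μ.re) :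
    Sol ν μ (hc (-ν) (ν + 1) (1 + μ) 0) (fF ν μ) (fF1 ν μ) where
  d := hasDerivAt_fF ν μ
  d1 := hasDerivAt_fF1 ν μ
  as := fF_as ν μ
  k0 := by
    rw [hc_zero]
    exact one_div_ne_zero (Complex.Gamma_ne_zero_of_re_pos (by simp; linarith))
  m1 := h1
  m2 := h2

theorem solB {ν : ℂ} (h1 : ν.re < -1) (h2 : -2 < ν.re) :
    Sol ν 1 (hc (-ν) (ν + 1) (1 + (-1)) 1) (fF ν (-1)) (fF1 ν (-1)) where
  d := hasDerivAt_fF ν (-1)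
  d1 := by
    intro r
    refine HasDerivAt.congr_deriv (hasDerivAt_fF1 ν (-1) r) ?_
    unfold qq; ring
  as := by
    set p := hc (-ν) (ν + 1) (1 + (-1)) with hp
    obtain ⟨C, hC, hb⟩ := (hc_good (-ν) (ν + 1) (1 + (-1))).second
    refine ⟨C + ‖p 1‖, by positivity, fun r hr => ?_⟩
    have p0 : p 0 = 0 := by rw [hp, hc_zero]; simp
    rw [← hp] at hb
    have e : fF ν (-1) r - p 1 * Complex.exp (-1 * r) =
        Complex.exp (-(-1) * r) * ((PS p (yy r) - p 0 - p 1 * yy r) + p 1 * ((yy r - Real.exp (-2 * r) : ℝ) : ℂ)) := by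
      have : Complex.exp (-1 * r) = Complex.exp (-(-1) * r) * (Real.exp (-2 * r) : ℝ) := by
        rw [Complex.ofReal_exp, ← Complex.exp_add]; congr 1; push_cast; ring
      rw [this, p0]
      unfold fF yy
      push_cast; ring
    rw [e, norm_mul, norm_cexp_mul]
    have hy := yy_norm r
    have t1 := hb (yy r) (by rw [hy]; exact yy_half hr)
    rw [hy] at t1
    have hyl := yy_le r
    have hyp := yy_pos r
    have hE := Real.exp_pos (-2 * r)
    have t2 : ‖((yy r - Real.exp (-2 * r) : ℝ) : ℂ)‖ ≤ Real.exp (-2 * r) ^ 2 := by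
      rw [Complex.norm_real, Real.norm_eq_abs]
      have : yy r - Real.exp (-2 * r) = - (Real.exp (-2 * r) * yy r) := by linarith [yy_eq r]
      rw [this, abs_neg, abs_of_nonneg (by positivity), pow_two]
      gcongr
    have x : Real.exp (-(-1 : ℂ).re * r) * Real.exp (-2 * r) ^ 2 = Real.exp (-((1 : ℂ).re + 2) * r) := by
      rw [pow_two, ← Real.exp_add, ← Real.exp_add]; congr 1; simp; ring
    calc _ ≤ Real.exp (-(-1 : ℂ).re * r) * (C * Real.exp (-2 * r) ^ 2 + ‖p 1‖ * Real.exp (-2 * r) ^ 2) := by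
          gcongr
          refine (norm_add_le _ _).trans ?_
          rw [norm_mul]
          gcongr
          refine t1.trans ?_
          gcongr
      _ = (C + ‖p 1‖) * (Real.exp (-(-1 : ℂ).re * r) * Real.exp (-2 * r) ^ 2) := by ring
      _ = _ := by rw [x]
  k0 := by
    have a : ν ≠ 0 := by rintro rfl; simp at h1; linarith
    have b : ν + 1 ≠ 0 := by
      intro h
      have := congrArg Complex.re h
      simp at this; linarith
    have e : hc (-ν) (ν + 1) (1 + (-1)) 1 = -ν * (ν + 1) := by simp [hc]
    rw [e]
    exact mul_ne_zero (neg_ne_zero.2 a) b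
  m1 := by simp; linarith
  m2 := by simp; linarith

theorem RL_tendsto {ν : ℂ} {m : ℝ → ℂ} {l : Filter ℝ} {m0 : ℂ} (h1 : ν.re < m0.re) (h2 : -ν.re - 1 < m0.re)
    (hm : Tendsto m l (𝓝 m0)) : Tendsto (fun e => RL ν (m e)) l (𝓝 (RL ν m0)) := by
  have hG : ∀ z : ℂ, 0 < z.re → ContinuousAt Complex.Gamma z := by
    intro z hz
    refine (Complex.differentiableAt_Gamma z (fun n h => ?_)).continuousAt
    rw [h] at hz
    simp at hz
    have : (0 : ℝ) ≤ n := n.cast_nonneg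
    linarith
  have : ContinuousAt (RL ν) m0 := by
    have a1 : 0 < ((m0 - ν) / 2).re := by simp; linarith
    have a2 : 0 < ((m0 + ν + 1) / 2).re := by simp; linarith
    have a3 : 0 < ((m0 - ν + 1) / 2).re := by simp; linarith
    have a4 : 0 < ((m0 + ν + 2) / 2).re := by simp; linarith
    have b1 : ContinuousAt (fun m => Complex.Gamma ((m - ν) / 2)) m0 :=
      ContinuousAt.comp (f := fun m => (m - ν) / 2) (hG _ a1) (by fun_prop)
    have b2 : ContinuousAt (fun m => Complex.Gamma ((m + ν + 1) / 2)) m0 :=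
      ContinuousAt.comp (f := fun m => (m + ν + 1) / 2) (hG _ a2) (by fun_prop)
    have b3 : ContinuousAt (fun m => Complex.Gamma ((m - ν + 1) / 2)) m0 :=
      ContinuousAt.comp (f := fun m => (m - ν + 1) / 2) (hG _ a3) (by fun_prop)
    have b4 : ContinuousAt (fun m => Complex.Gamma ((m + ν + 2) / 2)) m0 :=
      ContinuousAt.comp (f := fun m => (m + ν + 2) / 2) (hG _ a4) (by fun_prop)
    unfold RL
    refine (b1.mul b2).div ((continuousAt_const.mul b3).mul b4) ?_
    exact mul_ne_zero (mul_ne_zero two_ne_zero (Complex.Gamma_ne_zero_of_re_pos a3))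
      (Complex.Gamma_ne_zero_of_re_pos a4)
  exact this.tendsto.comp hm

theorem no_int {ν : ℂ} {a : ℝ} (h1 : ν.re < a) (h2 : a ≤ -1 - ν.re)
    (hi : IntegrableOn (fun w : ℝ => Real.exp (-a * w) * ‖gG ν w‖) (Ioi 0)) : False := by
  set M := ∫ w in Ioi (0 : ℝ), Real.exp (-a * w) * ‖gG ν w‖
  have key : ∀ e : ℝ, 0 < e → ‖LG ν (-ν - 1 + e)‖ ≤ M := by
    intro e he
    refine norm_integral_le_of_norm_le hi ((ae_restrict_iff' measurableSet_Ioi).2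
      (Eventually.of_forall fun w hw => ?_))
    have hw : (0 : ℝ) < w := hw
    rw [norm_mul, norm_cexp_mul]
    refine mul_le_mul_of_nonneg_right (Real.exp_le_exp.2 ?_) (norm_nonneg _)
    simp
    nlinarith
  have hrec : ∀ e : ℝ, 0 < e → (e : ℂ) * LG ν (-ν - 1 + e) * (-2 * ν - 1 + e) =
      RL ν (-ν + 1 + e) * ((-2 * ν + e) * (1 + e)) := by
    intro e he
    have r := LG_rec (ν := ν) (m := -ν - 1 + e) (by simp; linarith) (by simp; linarith)
    rw [LG_eq (m := -ν - 1 + e + 2) (by simp; linarith) (by simp; linarith)] at r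
    rw [show -ν + 1 + (e : ℂ) = -ν - 1 + e + 2 by ring]
    linear_combination r
  have he : Tendsto (fun e : ℝ => (e : ℂ)) (𝓝[>] 0) (𝓝 0) := by
    have : Tendsto (fun e : ℝ => (e : ℂ)) (𝓝 0) (𝓝 ((0 : ℝ) : ℂ)) := Complex.continuous_ofReal.tendsto 0
    exact (by simpa using this : Tendsto (fun e : ℝ => (e : ℂ)) (𝓝 0) (𝓝 0)).mono_left nhdsWithin_le_nhds
  have lhs : Tendsto (fun e : ℝ => (e : ℂ) * LG ν (-ν - 1 + e) * (-2 * ν - 1 + e)) (𝓝[>] 0) (𝓝 0) := by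
    have t1 : Tendsto (fun e : ℝ => (e : ℂ) * LG ν (-ν - 1 + e)) (𝓝[>] 0) (𝓝 0) := by
      refine squeeze_zero_norm' (a := fun e : ℝ => ‖(e : ℂ)‖ * M) ?_ (by simpa using he.norm.mul_const M)
      filter_upwards [self_mem_nhdsWithin] with e hee
      rw [norm_mul]
      gcongr
      exact key e hee
    simpa using t1.mul (tendsto_const_nhds.add he)
  have rhs : Tendsto (fun e : ℝ => RL ν (-ν + 1 + e) * ((-2 * ν + e) * (1 + e))) (𝓝[>] 0)
      (𝓝 (RL ν (-ν + 1 + 0) * ((-2 * ν + 0) * (1 + 0)))) :=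
    (RL_tendsto (by simp; linarith) (by simp; linarith) (tendsto_const_nhds.add he)).mul
      ((tendsto_const_nhds.add he).mul (tendsto_const_nhds.add he))
  have lhs' := lhs.congr' (f₂ := fun e : ℝ => RL ν (-ν + 1 + e) * ((-2 * ν + e) * (1 + e))) (by
    filter_upwards [self_mem_nhdsWithin] with e hee
    exact hrec e hee)
  have := tendsto_nhds_unique rhs lhs'
  have hν : ν ≠ 0 := by rintro rfl; simp at h1 h2; linarith
  have hR : RL ν (-ν + 1) ≠ 0 := RL_ne (by simp; linarith) (by simp; linarith)
  simp [hν, hR] at this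

theorem tanh_nonneg' {r : ℝ} (hr : 0 < r) : 0 < Real.tanh r := by
  rw [Real.tanh_eq_sinh_div_cosh]
  exact div_pos (Real.sinh_pos_iff.2 hr) (Real.cosh_pos r)

theorem diverge {ν μ : ℂ} (h1 : ν.re < μ.re) (h2 : μ.re ≤ -1 - ν.re)
    (hk : hc (-ν) (ν + 1) (1 + μ) 0 ≠ 0) (s : ℝ)
    (hi : IntegrableOn (H0 ν (fF ν μ) s) (Ioi 0)) : False := by
  set k := hc (-ν) (ν + 1) (1 + μ) 0
  have hkp : 0 < ‖k‖ := norm_pos_iff.2 hk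
  obtain ⟨C, hC, hb⟩ := fF_as ν μ
  -- lower bound for f
  obtain ⟨r0, hr0⟩ : ∃ r0, ∀ r, r0 ≤ r → ‖k‖ / 2 * Real.exp (-μ.re * r) ≤ ‖fF ν μ r‖ := by
    have : Tendsto (fun w : ℝ => C * Real.exp (-2 * w)) atTop (𝓝 0) := by
      have : Tendsto (fun w : ℝ => -2 * w) atTop atBot := tendsto_id.const_mul_atTop_of_neg (by norm_num)
      simpa using (Real.tendsto_exp_atBot.comp this).const_mul C
    have := (this.eventually_le_const (half_pos hkp)).and (eventually_ge_atTop 0)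
    obtain ⟨r0, h⟩ := eventually_atTop.1 this
    refine ⟨r0, fun r hr => ?_⟩
    obtain ⟨u1, u2⟩ := h r hr
    have t2 := hb r u2
    have t3 := norm_sub_le (fF ν μ r) (fF ν μ r - k * Complex.exp (-μ * r))
    rw [sub_sub_cancel, norm_mul, norm_cexp_mul] at t3
    rw [show -(μ.re + 2) * r = -2 * r + -μ.re * r by ring, Real.exp_add, ← mul_assoc] at t2
    have := mul_le_mul_of_nonneg_right u1 (Real.exp_pos (-μ.re * r)).le
    linarith
  set B := 4 * |s| + 2 * Real.log 2
  set V := max 0 (max (r0 - s) (1 - s))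
  have hV0 : 0 ≤ V := le_max_left _ _
  have hV1 : r0 - s ≤ V := (le_max_left _ _).trans (le_max_right _ _)
  have hV2 : 1 - s ≤ V := (le_max_right _ _).trans (le_max_right _ _)
  set G : ℝ → ℝ := fun w => Real.exp (-μ.re * w) * ‖gG ν w‖ with hG
  have hGc : Continuous G := by
    have := continuous_gG ν
    fun_prop
  have hder : ∀ v, HasDerivAt (fun v => WW s v) (Real.tanh (s + v)) v := fun v =>
    ((hasDerivAt_lc (s + v)).comp_const_add s v).sub_const _
  have hWc : Continuous (fun v => WW s v) := continuous_iff_continuousAt.2 fun v => (hder v).continuousAt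
  have hmono : StrictMonoOn (fun v => WW s v) (Ici V) := by
    refine strictMonoOn_of_deriv_pos (convex_Ici V) hWc.continuousOn (fun v hv => ?_)
    rw [interior_Ici] at hv
    rw [(hder v).deriv]
    have hv : V < v := hv
    exact tanh_nonneg' (by linarith)
  have hint : IntegrableOn (fun v => |Real.tanh (s + v)| • G (WW s v)) (Ioi V) := by
    have hi' := (hi.mono_set (Ioi_subset_Ioi hV0)).norm.const_mul
      (Real.exp (|μ.re| * B) * Real.exp (μ.re * s) * (2 / ‖k‖))
    refine Integrable.mono' hi' ?_ ?_
    · have := continuous_tanh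
      exact Continuous.aestronglyMeasurable (by fun_prop)
    · refine (ae_restrict_iff' measurableSet_Ioi).2 (Eventually.of_forall fun v hv => ?_)
      have hv : V < v := hv
      have w := WW_bd (s := s) (A := |s|) le_rfl (hV0.trans hv.le)
      have f1 := hr0 (s + v) (by linarith)
      have x1 : Real.exp (-μ.re * WW s v) ≤ Real.exp (|μ.re| * B) * Real.exp (μ.re * s) * Real.exp (-μ.re * (s + v)) := by
        rw [← Real.exp_add, ← Real.exp_add]
        apply Real.exp_le_exp.2
        have h2 : -μ.re * (WW s v - v) ≤ |μ.re| * |WW s v - v| := by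
          rw [← abs_neg μ.re, ← abs_mul]; exact le_abs_self _
        have h4 : |μ.re| * |WW s v - v| ≤ |μ.re| * B := by gcongr
        linarith
      have x2 : Real.exp (-μ.re * (s + v)) ≤ 2 / ‖k‖ * ‖fF ν μ (s + v)‖ := by
        rw [div_mul_eq_mul_div, le_div_iff₀ hkp]; linarith
      rw [smul_eq_mul, norm_mul, Real.norm_eq_abs, abs_abs]
      have hGn : ‖G (WW s v)‖ = G (WW s v) := Real.norm_of_nonneg (by rw [hG]; positivity)
      rw [hGn]
      unfold H0
      rw [norm_mul]
      calc _ ≤ 1 * G (WW s v) := mul_le_mul_of_nonneg_right (abs_tanh_le _) (by rw [hG]; positivity)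
        _ = Real.exp (-μ.re * WW s v) * ‖gG ν (WW s v)‖ := by rw [one_mul]
        _ ≤ (Real.exp (|μ.re| * B) * Real.exp (μ.re * s) * (2 / ‖k‖ * ‖fF ν μ (s + v)‖)) * ‖gG ν (WW s v)‖ := by
          gcongr
          exact x1.trans (by gcongr)
        _ = _ := by ring
  have himg := (integrableOn_image_iff_integrableOn_abs_deriv_smul measurableSet_Ioi
    (fun v _ => (hder v).hasDerivWithinAt) (hmono.injOn.mono Ioi_subset_Ici_self) G).2 hint
  have hsub : Ioi (WW s V) ⊆ (fun v => WW s v) '' Ioi V := by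
    intro w hw
    have hw : WW s V < w := hw
    have : ∃ v', V ≤ v' ∧ w ≤ WW s v' := by
      refine ⟨max V (w + B), le_max_left _ _, ?_⟩
      have := abs_le.1 (WW_bd (s := s) (A := |s|) le_rfl (hV0.trans (le_max_left V (w + B))))
      linarith [le_max_right V (w + B)]
    obtain ⟨v', hv', hw'⟩ := this
    obtain ⟨v, hv, e⟩ := intermediate_value_Icc hv' hWc.continuousOn ⟨hw.le, hw'⟩
    refine ⟨v, lt_of_le_of_ne hv.1 ?_, e⟩
    rintro rfl
    exact absurd e hw.ne
  have hfin : IntegrableOn G (Ioi 0) := by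
    have a1 : IntegrableOn G (Icc 0 (WW s V)) := hGc.continuousOn.integrableOn_Icc
    refine (a1.union (himg.mono_set hsub)).mono_set ?_
    intro w hw
    have hw : (0 : ℝ) < w := hw
    by_cases h : w ≤ WW s V
    · exact Or.inl ⟨hw.le, h⟩
    · exact Or.inr (not_le.1 h)
  exact no_int h1 h2 hfin

theorem tanh_strictMono : StrictMono Real.tanh :=
  strictMono_of_deriv_pos fun r => by
    rw [(hasDerivAt_tanh r).deriv, tanh_sq]
    have := Real.cosh_pos r
    simp; positivity

theorem cosh_WW (s v : ℝ) : (2 - Real.tanh s ^ 2 - Real.tanh (s + v) ^ 2) /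
    (2 * Real.sqrt ((1 - Real.tanh s ^ 2) * (1 - Real.tanh (s + v) ^ 2))) = Real.cosh (WW s v) := by
  have c1 := Real.cosh_pos s
  have c2 := Real.cosh_pos (s + v)
  have e : (1 - Real.tanh s ^ 2) * (1 - Real.tanh (s + v) ^ 2) = (1 / (Real.cosh s * Real.cosh (s + v))) ^ 2 := by
    rw [tanh_sq, tanh_sq]; field_simp; ring
  rw [e, Real.sqrt_sq (by positivity), Real.cosh_eq (WW s v), Real.exp_neg, exp_WW, tanh_sq, tanh_sq]
  field_simp
  ring

theorem image_tanh {s : ℝ} : (fun v => Real.tanh (s + v)) '' Ioi 0 = Ioo (Real.tanh s) 1 := by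
  ext t
  constructor
  · rintro ⟨v, hv, rfl⟩
    have hv : (0 : ℝ) < v := hv
    exact ⟨tanh_strictMono (by linarith), tanh_lt _⟩
  · rintro ⟨h1, h2⟩
    have ht : t ∈ Ioo (-1 : ℝ) 1 := ⟨(lt_tanh s).trans h1, h2⟩
    refine ⟨Real.artanh t - s, ?_, ?_⟩
    · have : s < Real.artanh t := by
        rw [← tanh_strictMono.lt_iff_lt, Real.tanh_artanh ht]; exact h1
      simpa using this
    · simp [Real.tanh_artanh ht]

theorem cov {ν μ : ℂ} {F : ℝ → ℂ} (s : ℝ)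
    (hF : ∀ t, F t = ferrersP ν μ t * ((1 - t ^ 2 : ℝ) : ℂ)⁻¹ *
        legendreP ν ((2 - Real.tanh s ^ 2 - t ^ 2) / (2 * Real.sqrt ((1 - Real.tanh s ^ 2) * (1 - t ^ 2))))) :
    (IntegrableOn F (Ioo (Real.tanh s) 1) ↔ IntegrableOn (H0 ν (fF ν μ) s) (Ioi 0)) ∧
      ∫ t in Ioo (Real.tanh s) 1, F t = Fi ν (fF ν μ) s := by
  have hder : ∀ v ∈ Ioi (0 : ℝ), HasDerivWithinAt (fun v => Real.tanh (s + v)) (1 - Real.tanh (s + v) ^ 2) (Ioi 0) v :=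
    fun v _ => ((hasDerivAt_tanh (s + v)).comp_const_add s v).hasDerivWithinAt
  have hinj : InjOn (fun v => Real.tanh (s + v)) (Ioi 0) := by
    intro a _ b _ h
    have := Real.tanh_injective h
    linarith
  have e : (fun v => |1 - Real.tanh (s + v) ^ 2| • F (Real.tanh (s + v))) = H0 ν (fF ν μ) s := by
    funext v
    have hp : 0 < 1 - Real.tanh (s + v) ^ 2 := by
      rw [tanh_sq]
      have := Real.cosh_pos (s + v)
      simp; positivity
    rw [abs_of_pos hp, hF, cosh_WW, legendreP_cosh, ferrersP_tanh, Complex.real_smul]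
    have hp' : ((1 - Real.tanh (s + v) ^ 2 : ℝ) : ℂ) ≠ 0 := by exact_mod_cast hp.ne'
    unfold H0
    rw [show ∀ a b c : ℂ, a * (b * a⁻¹ * c) = (a * a⁻¹) * (b * c) by intros; ring, mul_inv_cancel₀ hp', one_mul]
  constructor
  · rw [← image_tanh, integrableOn_image_iff_integrableOn_abs_deriv_smul measurableSet_Ioi hder hinj, e]
  · rw [← image_tanh, integral_image_eq_integral_abs_deriv_smul measurableSet_Ioi hder hinj]
    unfold Fi
    rw [← e]

theorem constA {ν μ : ℂ} (h1 : ν.re < μ.re) (h2 : -ν.re - 1 < μ.re) :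
    2 * (ν - μ) * Complex.Gamma ((μ - ν + 3) / 2) * Complex.Gamma ((ν + μ + 2) / 2) /
        ((ν - μ - 1) * Complex.Gamma ((μ - ν + 2) / 2) * Complex.Gamma ((ν + μ + 1) / 2)) * RL ν μ = 1 := by
  unfold RL
  have a1 : (μ - ν) ≠ 0 := ne_of_re_pos (by simp; linarith)
  have a3 : (μ - ν + 1) ≠ 0 := ne_of_re_pos (by simp; linarith)
  have a3' : (ν - μ - 1) ≠ 0 := by
    intro h; apply a3; linear_combination -h
  have b1 : Complex.Gamma ((μ - ν) / 2) ≠ 0 := Complex.Gamma_ne_zero_of_re_pos (by simp; linarith)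
  have b2 : Complex.Gamma ((μ + ν + 1) / 2) ≠ 0 := Complex.Gamma_ne_zero_of_re_pos (by simp; linarith)
  have b3 : Complex.Gamma ((μ - ν + 1) / 2) ≠ 0 := Complex.Gamma_ne_zero_of_re_pos (by simp; linarith)
  have b4 : Complex.Gamma ((μ + ν + 2) / 2) ≠ 0 := Complex.Gamma_ne_zero_of_re_pos (by simp; linarith)
  rw [show (μ - ν + 3) / 2 = (μ - ν + 1) / 2 + 1 by ring, show (μ - ν + 2) / 2 = (μ - ν) / 2 + 1 by ring,
    Complex.Gamma_add_one _ (by simpa using a3), Complex.Gamma_add_one _ (by simpa using a1),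
    add_comm ν μ]
  generalize Complex.Gamma ((μ - ν) / 2) = X1 at *
  generalize Complex.Gamma ((μ + ν + 1) / 2) = X2 at *
  generalize Complex.Gamma ((μ - ν + 1) / 2) = X3 at *
  generalize Complex.Gamma ((μ + ν + 2) / 2) = X4 at *
  field_simp
  ring

theorem constB {ν : ℂ} (h1 : ν.re < -1) (h2 : -2 < ν.re) :
    2 * (ν - -1) * Complex.Gamma ((-1 - ν + 3) / 2) * Complex.Gamma ((ν + -1 + 2) / 2) /
        ((ν - -1 - 1) * Complex.Gamma ((-1 - ν + 2) / 2) * Complex.Gamma ((ν + -1 + 1) / 2)) * RL ν 1 = 1 := by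
  unfold RL
  have a1 : ν ≠ 0 := by rintro rfl; simp at h1; linarith
  have a2 : ν + 1 ≠ 0 := by
    intro h
    have := congrArg Complex.re h
    simp at this; linarith
  have g : ∀ z : ℂ, -1 < z.re → z.re < 0 → Complex.Gamma z ≠ 0 := by
    intro z hz1 hz2
    refine Complex.Gamma_ne_zero fun n h => ?_
    rw [h] at hz1 hz2
    simp only [Complex.neg_re, Complex.natCast_re] at hz1 hz2
    have u1 : (n : ℝ) < 1 := by linarith
    have u2 : (0 : ℝ) < n := by linarith
    norm_cast at u1 u2
    omega
  have b1 : Complex.Gamma (ν / 2) ≠ 0 := g _ (by simp; linarith) (by simp; linarith)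
  have b2 : Complex.Gamma ((ν + 1) / 2) ≠ 0 := g _ (by simp; linarith) (by simp; linarith)
  have b3 : Complex.Gamma ((1 - ν) / 2) ≠ 0 := Complex.Gamma_ne_zero_of_re_pos (by simp; linarith)
  have b4 : Complex.Gamma ((2 - ν) / 2) ≠ 0 := Complex.Gamma_ne_zero_of_re_pos (by simp; linarith)
  rw [show (-1 - ν + 3) / 2 = (2 - ν) / 2 by ring, show (ν + -1 + 2) / 2 = (ν + 1) / 2 by ring,
    show (-1 - ν + 2) / 2 = (1 - ν) / 2 by ring, show (ν + -1 + 1) / 2 = ν / 2 by ring,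
    show (1 + ν + 1) / 2 = ν / 2 + 1 by ring, show (1 - ν + 1) / 2 = (2 - ν) / 2 by ring,
    show (1 + ν + 2) / 2 = (ν + 1) / 2 + 1 by ring, show ν - -1 - 1 = ν by ring,
    show ν - -1 = ν + 1 by ring,
    Complex.Gamma_add_one _ (by simpa using a1), Complex.Gamma_add_one _ (by simpa using a2)]
  generalize Complex.Gamma (ν / 2) = X1 at *
  generalize Complex.Gamma ((ν + 1) / 2) = X2 at *
  generalize Complex.Gamma ((1 - ν) / 2) = X3 at *
  generalize Complex.Gamma ((2 - ν) / 2) = X4 at *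
  field_simp

end FSI

/-- Integral representation for a single Ferrers function of the
first kind. -/
theorem ferrersP_single_integral
    (ν μ : ℂ) (h1 : -3 < (μ + ν).re) (h2 : 0 < (μ - ν).re)
    (h3 : ν - μ - 1 ≠ 0)
    (h4 : ∀ n : ℕ, (μ - ν + 2) / 2 ≠ -(n : ℂ)) (h5 : ∀ n : ℕ, (ν + μ + 1) / 2 ≠ -(n : ℂ))
    (x : ℝ) (hx : -1 < x) (hx' : x < 1)
    (F : ℝ → ℂ)
    (hF : ∀ t, F t = ferrersP ν μ t * ((1 - t ^ 2 : ℝ) : ℂ)⁻¹ *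
        legendreP ν ((2 - x ^ 2 - t ^ 2) / (2 * Real.sqrt ((1 - x ^ 2) * (1 - t ^ 2)))))
    (hint : IntegrableOn F (Ioo x 1)) :
    ferrersP ν μ x =
      2 * (ν - μ) * Complex.Gamma ((μ - ν + 3) / 2) * Complex.Gamma ((ν + μ + 2) / 2) /
        ((ν - μ - 1) * Complex.Gamma ((μ - ν + 2) / 2) * Complex.Gamma ((ν + μ + 1) / 2)) *
        ∫ t in Ioo x 1, F t := by
  obtain ⟨s, rfl⟩ : ∃ s, Real.tanh s = x := ⟨Real.artanh x, Real.tanh_artanh ⟨hx, hx'⟩⟩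
  obtain ⟨ci, ce⟩ := FSI.cov s hF
  rw [FSI.ferrersP_tanh, ce]
  simp only [Complex.add_re, Complex.sub_re] at h1 h2
  have h2' : ν.re < μ.re := by linarith
  by_cases hA : -ν.re - 1 < μ.re
  · rw [(FSI.solA h2' hA).main s, FSI.LG_eq h2' hA, ← mul_assoc, FSI.constA h2' hA, one_mul]
  by_cases hm : μ = -1
  · subst hm
    simp only [Complex.neg_re, Complex.one_re] at h1 h2 h2'
    have hb : -2 < ν.re := by linarith
    rw [(FSI.solB h2' hb).main s, FSI.LG_eq (by simp; linarith) (by simp; linarith), ← mul_assoc,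
      FSI.constB h2' hb, one_mul]
  exfalso
  refine FSI.diverge h2' (by linarith) ?_ s (ci.1 hint)
  rw [FSI.hc_zero]
  refine one_div_ne_zero (Complex.Gamma_ne_zero fun n hn => ?_)
  rcases Nat.eq_zero_or_pos n with rfl | hp
  · apply hm
    simp at hn
    linear_combination hn
  · have hr := congrArg Complex.re hn
    simp at hr
    have : (1 : ℝ) ≤ n := by exact_mod_cast hp
    linarith
end

section
/- Evaluation of an Euler-type integral (Lemma on the kernel integral). Let α, β ∈ ℂ with Re β > −1/2 and Re(α−β) > 0, and let z be a real number with z > 1. Then ∫_1^z (w²−1)^{β−1/2} (z−w)^{α−β−1} dw = Γ(β+1/2) Γ(α−β) (z−1)^{α−1/2} (z+1)^{β−1/2} ₂F̃₁(1/2−β, α−β; α+1/2; (z−1)/(z+1)), and moreover this quantity also equals [e^{−iπβ} 2^β Γ(β+1/2) Γ(α−β) / (√π Γ(α+β))] · (z²−1)^{(α−1)/2} · Q_{α−1}^β(z/√(z²−1)) (note z/√(z²−1) > 1), provided in addition that α+β is not a nonpositive integer. -/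
open MeasureTheory Set

theorem ek_binom (a x : ℂ) (hx : ‖x‖ < 1) :
    HasSum (fun n : ℕ => (ascPochhammer ℂ n).eval a / (n.factorial : ℂ) * x ^ n)
      ((1 - x) ^ (-a)) := by
  have h := (Complex.one_div_one_sub_cpow_hasFPowerSeriesOnBall_zero a).hasSum (y := x)
    (by simpa [Metric.mem_eball, edist_eq_enorm_sub, ← ofReal_norm] using hx)
  simp only [zero_add, one_div, ← Complex.cpow_neg, FormalMultilinearSeries.ofScalars_apply_eq,
    smul_eq_mul] at h
  refine Eq.mp (congrArg (fun f => HasSum f _) (funext fun n => Eq.symm ?_)) h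
  rw [← Ring.multichoose_eq]
  have h1 := Ring.factorial_nsmul_multichoose_eq_ascPochhammer a n
  rw [Polynomial.ascPochhammer_smeval_eq_eval, nsmul_eq_mul] at h1
  rw [← h1, mul_div_cancel_left₀ _ (Nat.cast_ne_zero.mpr n.factorial_ne_zero)]

theorem ek_hyp_eq (a b c : ℂ) : hyp2F1reg a b c = Complex.regularizedGaussHGFun a b c := by
  funext z
  unfold hyp2F1reg Complex.regularizedGaussHGFun FormalMultilinearSeries.sum
  congr 1
  ext n
  rw [FormalMultilinearSeries.apply_eq_pow_smul_coeff, Complex.coeff_regularizedGaussHGFunSeries,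
    smul_eq_mul, mul_comm (Complex.Gamma _), mul_comm]

theorem ek_hyp_fps (a b c : ℂ) : HasFPowerSeriesOnBall (hyp2F1reg a b c)
    (Complex.regularizedGaussHGFunSeries a b c) 0 1 := by
  rw [ek_hyp_eq]
  exact ((Complex.regularizedGaussHGFunSeries a b c).hasFPowerSeriesOnBall
    (lt_of_lt_of_le one_pos (Complex.radius_regularizedGaussHGFunSeries_ge_one a b c))).mono
    one_pos (Complex.radius_regularizedGaussHGFunSeries_ge_one a b c)

theorem ek_hyp_hasSum (a b c x : ℂ) (hx : ‖x‖ < 1) :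
    HasSum (fun n : ℕ => (ascPochhammer ℂ n).eval a * (ascPochhammer ℂ n).eval b /
      (Complex.Gamma (c + n) * (n.factorial : ℂ)) * x ^ n) (hyp2F1reg a b c x) := by
  have h := (ek_hyp_fps a b c).hasSum (y := x)
    (by simpa [Metric.mem_eball, edist_eq_enorm_sub, ← ofReal_norm] using hx)
  rw [zero_add] at h
  refine Eq.mp (congrArg (fun f => HasSum f _) (funext fun n => Eq.symm ?_)) h
  rw [FormalMultilinearSeries.apply_eq_pow_smul_coeff, Complex.coeff_regularizedGaussHGFunSeries,
    smul_eq_mul, mul_comm (Complex.Gamma _), mul_comm]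

theorem ek_hyp_analytic (a b c x : ℂ) (hx : ‖x‖ < 1) : AnalyticAt ℂ (hyp2F1reg a b c) x :=
  (ek_hyp_fps a b c).analyticAt_of_mem
    (by simpa [Metric.mem_eball, edist_eq_enorm_sub, ← ofReal_norm] using hx)

theorem ek_poch_add (a : ℂ) (m n : ℕ) : (ascPochhammer ℂ (m + n)).eval a =
    (ascPochhammer ℂ m).eval a * (ascPochhammer ℂ n).eval (a + m) := by
  rw [← ascPochhammer_mul]
  simp

theorem ek_vand (m : ℕ) : ∀ A c : ℂ, ∑ n ∈ Finset.range (m + 1), (m.choose n : ℂ) * (-1) ^ n *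
    (ascPochhammer ℂ n).eval A * (ascPochhammer ℂ (m - n)).eval (c + n) =
    (ascPochhammer ℂ m).eval (c - A) := by
  induction m with
  | zero => simp
  | succ m ih =>
    intro A c
    have e1 : ∑ n ∈ Finset.range (m + 1), (m.choose n : ℂ) * (-1) ^ n *
      (ascPochhammer ℂ n).eval A * (ascPochhammer ℂ (m + 1 - n)).eval (c + n) =
      (c + m) * (ascPochhammer ℂ m).eval (c - A) := by
      rw [← ih A c, Finset.mul_sum]
      refine Finset.sum_congr rfl fun n hn => ?_
      have hn : n ≤ m := by simpa [Nat.lt_succ_iff] using hn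
      rw [Nat.succ_sub hn, Nat.succ_eq_add_one, ascPochhammer_succ_eval, Nat.cast_sub hn]
      ring
    have e2 : ∑ n ∈ Finset.range (m + 1), (m.choose n : ℂ) * (-1) ^ (n + 1) *
      (ascPochhammer ℂ (n + 1)).eval A * (ascPochhammer ℂ (m - n)).eval (c + (n + 1 : ℕ)) =
      -A * (ascPochhammer ℂ m).eval (c - A) := by
      rw [show c - A = (c + 1) - (A + 1) by ring, ← ih (A + 1) (c + 1), Finset.mul_sum]
      refine Finset.sum_congr rfl fun n hn => ?_
      rw [add_comm n 1, ek_poch_add A 1 n]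
      simp only [ascPochhammer_one, Polynomial.eval_X]
      push_cast
      rw [← add_assoc]
      ring
    rw [Finset.sum_range_succ', ascPochhammer_succ_right]
    have e3 : ∀ n ∈ Finset.range (m + 1), ((m + 1).choose (n + 1) : ℂ) * (-1) ^ (n + 1) *
      (ascPochhammer ℂ (n + 1)).eval A *
        (ascPochhammer ℂ (m + 1 - (n + 1))).eval (c + (n + 1 : ℕ)) =
      (m.choose n : ℂ) * (-1) ^ (n + 1) *
      (ascPochhammer ℂ (n + 1)).eval A * (ascPochhammer ℂ (m - n)).eval (c + (n + 1 : ℕ)) +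
      (m.choose (n + 1) : ℂ) * (-1) ^ (n + 1) *
      (ascPochhammer ℂ (n + 1)).eval A *
        (ascPochhammer ℂ (m + 1 - (n + 1))).eval (c + (n + 1 : ℕ)) := by
      intro n hn
      rw [Nat.choose_succ_succ, Nat.add_sub_add_right]
      push_cast
      ring
    rw [Finset.sum_congr rfl e3, Finset.sum_add_distrib, e2, add_assoc]
    have e4 := Finset.sum_range_succ' (fun n => (m.choose n : ℂ) * (-1) ^ n *
      (ascPochhammer ℂ n).eval A * (ascPochhammer ℂ (m + 1 - n)).eval (c + n)) (m + 1)
    rw [Finset.sum_range_succ, e1] at e4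
    simp only [Nat.choose_succ_self, Nat.cast_zero, zero_mul, add_zero, Nat.choose_zero_right]
      at e4 ⊢
    rw [← e4]
    simp only [Polynomial.eval_mul, Polynomial.eval_add, Polynomial.eval_X,
        Polynomial.eval_natCast]
    ring

theorem ek_refl (b : ℂ) (m : ℕ) : (ascPochhammer ℂ m).eval (1 - b - m) * (-1) ^ m =
    (ascPochhammer ℂ m).eval b := by
  have h := ascPochhammer_eval_neg_eq_descPochhammer ℂ (-b) m
  rw [neg_neg, descPochhammer_eval_eq_ascPochhammer] at h
  rw [h, mul_comm]
  congr 3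
  ring

theorem ek_beta_integrable (b d : ℂ) (hb : 0 < b.re) (hd : 0 < d.re) :
    IntegrableOn (fun s : ℝ => (s : ℂ) ^ (b - 1) * (1 - (s : ℂ)) ^ (d - 1)) (Ioo 0 1) := by
  have h := Complex.betaIntegral_convergent hb hd
  rw [intervalIntegrable_iff_integrableOn_Ioo_of_le zero_le_one] at h
  exact h

theorem ek_beta (b d : ℂ) (hb : 0 < b.re) (hd : 0 < d.re) :
    ∫ s in Ioo (0 : ℝ) 1, (s : ℂ) ^ (b - 1) * (1 - (s : ℂ)) ^ (d - 1) =
      Complex.Gamma b * Complex.Gamma d / Complex.Gamma (b + d) := by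
  rw [Complex.Gamma_mul_Gamma_eq_betaIntegral hb hd, mul_div_cancel_left₀,
    Complex.betaIntegral, intervalIntegral.integral_of_le zero_le_one, integral_Ioc_eq_integral_Ioo]
  exact Complex.Gamma_ne_zero_of_re_pos (by simp; linarith)

theorem ek_gamma_add (b : ℂ) (hb : 0 < b.re) (n : ℕ) :
    Complex.Gamma (b + n) = (ascPochhammer ℂ n).eval b * Complex.Gamma b := by
  have h0 := Complex.Gamma_ne_zero_of_re_pos hb
  rw [← Complex.Gamma_add_nat_div_Gamma_eq b, div_mul_cancel₀ _ h0]
  intro k hk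
  rw [hk] at hb
  simp at hb
  linarith [(Nat.cast_nonneg k : (0 : ℝ) ≤ k)]

theorem ek_euler (a b d : ℂ) (hb : 0 < b.re) (hd : 0 < d.re) (x : ℝ) (hx0 : 0 ≤ x) (hx1 : x < 1) :
    ∫ s in Ioo (0 : ℝ) 1, (s : ℂ) ^ (b - 1) * (1 - (s : ℂ)) ^ (d - 1) *
        (1 - (x : ℂ) * s) ^ (-a) =
      Complex.Gamma b * Complex.Gamma d * hyp2F1reg a b (b + d) x := by
  have hxn : ‖(x : ℂ)‖ < 1 := by simpa [abs_of_nonneg hx0] using hx1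
  set co : ℕ → ℂ := fun n => (ascPochhammer ℂ n).eval a / (n.factorial : ℂ) * (x : ℂ) ^ n with hco
  set F : ℕ → ℝ → ℂ := fun n s =>
    co n * ((s : ℂ) ^ (b + n - 1) * (1 - (s : ℂ)) ^ (d - 1)) with hF
  have hbn : ∀ n : ℕ, 0 < (b + n).re := fun n => by
    simp; linarith [(Nat.cast_nonneg n : (0 : ℝ) ≤ n)]
  have hFi : ∀ n, Integrable (F n) (volume.restrict (Ioo 0 1)) := fun n =>
    (ek_beta_integrable (b + n) d (hbn n) hd).const_mul _
  have hsum : Summable fun n => ∫ s in Ioo (0 : ℝ) 1, ‖F n s‖ := by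
    refine Summable.of_nonneg_of_le (fun n => integral_nonneg fun s => norm_nonneg _) (fun n => ?_)
      ((ek_binom a x hxn).summable.norm.mul_right
        (∫ s in Ioo (0 : ℝ) 1, ‖(s : ℂ) ^ (b - 1) * (1 - (s : ℂ)) ^ (d - 1)‖))
    rw [← integral_const_mul]
    refine setIntegral_mono_on (hFi n).norm ((ek_beta_integrable b d hb hd).norm.const_mul _)
      measurableSet_Ioo fun s hs => ?_
    have hs0 : (s : ℂ) ≠ 0 := by exact_mod_cast hs.1.ne'
    have e : (s : ℂ) ^ (b + n - 1) = (s : ℂ) ^ (b - 1) * (s : ℂ) ^ n := by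
      rw [← Complex.cpow_natCast, ← Complex.cpow_add _ _ hs0]; congr 1; ring
    simp only [hF]
    rw [norm_mul]
    refine mul_le_mul_of_nonneg_left ?_ (norm_nonneg (co n))
    have : ‖(s : ℂ) ^ n‖ ≤ 1 := by
      rw [norm_pow, Complex.norm_real, Real.norm_of_nonneg hs.1.le]
      exact pow_le_one₀ hs.1.le hs.2.le
    rw [e, mul_right_comm, norm_mul]
    exact mul_le_of_le_one_right (norm_nonneg _) this
  have key := hasSum_integral_of_summable_integral_norm hFi hsum
  have e1 : ∀ n, ∫ s in Ioo (0 : ℝ) 1, F n s = Complex.Gamma b * Complex.Gamma d *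
      ((ascPochhammer ℂ n).eval a * (ascPochhammer ℂ n).eval b /
      (Complex.Gamma (b + d + n) * (n.factorial : ℂ)) * (x : ℂ) ^ n) := by
    intro n
    simp only [hF, hco]
    rw [integral_const_mul, ek_beta _ _ (hbn n) hd, ek_gamma_add b hb, add_right_comm b n d]
    have := Complex.Gamma_ne_zero_of_re_pos (s := b + d + n) (by
      simp; linarith [(Nat.cast_nonneg n : (0 : ℝ) ≤ n)])
    have hf : (n.factorial : ℂ) ≠ 0 := Nat.cast_ne_zero.mpr n.factorial_ne_zero
    field_simp
  simp only [e1] at key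
  rw [((ek_hyp_hasSum a b (b + d) x hxn).mul_left _).unique key]
  refine setIntegral_congr_fun measurableSet_Ioo fun s hs => ?_
  have hs0 : (s : ℂ) ≠ 0 := by exact_mod_cast hs.1.ne'
  have hxs : ‖(x : ℂ) * s‖ < 1 := by
    rw [← Complex.ofReal_mul, Complex.norm_real, Real.norm_of_nonneg (by have := hs.1; positivity)]
    nlinarith [hs.1, hs.2]
  have h2 := ((ek_binom a _ hxs).mul_left ((s : ℂ) ^ (b - 1) * (1 - (s : ℂ)) ^ (d - 1))).tsum_eq
  rw [← h2]
  refine tsum_congr fun n => ?_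
  have e : (s : ℂ) ^ (b + n - 1) = (s : ℂ) ^ (b - 1) * (s : ℂ) ^ n := by
    rw [← Complex.cpow_natCast, ← Complex.cpow_add _ _ hs0]; congr 1; ring
  simp only [hF, hco, e]
  ring

theorem ek_cp (r : ℝ) (hr : 0 < r) (p : ℂ) :
    (r : ℂ) ^ p = Complex.exp ((Real.log r : ℂ) * p) := by
  rw [Complex.cpow_def_of_ne_zero (by exact_mod_cast hr.ne'), Complex.ofReal_log hr.le]

theorem ek_exp_log (r : ℝ) (hr : 0 < r) : (r : ℂ) = Complex.exp (Real.log r : ℂ) := by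
  rw [← Complex.ofReal_exp, Real.exp_log hr]

theorem ek_part1 (α β : ℂ) (hβ : -(1 / 2 : ℝ) < β.re) (hαβ : 0 < (α - β).re)
    (z : ℝ) (hz : 1 < z) :
    (∫ w in Ioo (1 : ℝ) z,
        ((w ^ 2 - 1 : ℝ) : ℂ) ^ (β - 1 / 2) * ((z - w : ℝ) : ℂ) ^ (α - β - 1)) =
      Complex.Gamma (β + 1 / 2) * Complex.Gamma (α - β) * ((z : ℂ) - 1) ^ (α - 1 / 2) *
        ((z : ℂ) + 1) ^ (β - 1 / 2) *
        hyp2F1reg (1 / 2 - β) (α - β) (α + 1 / 2) (((z : ℂ) - 1) / ((z : ℂ) + 1)) := by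
  have hz1 : 0 < z - 1 := by linarith
  have hz2 : 0 < z + 1 := by linarith
  have himg : (fun s : ℝ => z - (z - 1) * s) '' Ioo 0 1 = Ioo 1 z := by
    ext w
    simp only [mem_image, mem_Ioo]
    constructor
    · rintro ⟨s, ⟨h0, h1⟩, rfl⟩
      constructor <;> nlinarith
    · rintro ⟨h1, h2⟩
      refine ⟨(z - w) / (z - 1), ⟨div_pos (by linarith) hz1, ?_⟩, ?_⟩
      · rw [div_lt_one hz1]; linarith
      · field_simp; ring
  have hder : ∀ s ∈ Ioo (0 : ℝ) 1, HasDerivWithinAt (fun s : ℝ => z - (z - 1) * s)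
      (-(z - 1)) (Ioo 0 1) s := fun s _ => by
    simpa using ((((hasDerivAt_id s).const_mul (z - 1)).const_sub z)).hasDerivWithinAt
  have hinj : InjOn (fun s : ℝ => z - (z - 1) * s) (Ioo 0 1) := by
    intro s _ t _ h
    have h : (z - 1) * s = (z - 1) * t := by simpa using h
    exact mul_left_cancel₀ hz1.ne' h
  rw [← himg, integral_image_eq_integral_abs_deriv_smul measurableSet_Ioo hder hinj]
  set x : ℝ := (z - 1) / (z + 1) with hx
  have hx0 : 0 ≤ x := by positivity
  have hx1 : x < 1 := by rw [hx, div_lt_one hz2]; linarith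
  have E := ek_euler (1 / 2 - β) (α - β) (β + 1 / 2) hαβ (by simp; linarith) x hx0 hx1
  rw [show α - β + (β + 1 / 2) = α + 1 / 2 by ring] at E
  have hxc : ((z : ℂ) - 1) / ((z : ℂ) + 1) = (x : ℂ) := by rw [hx]; push_cast; rfl
  have : ∀ A B C D H : ℂ, A * B * C * D * H = C * D * (B * A * H) := by intros; ring
  rw [hxc, this, ← E, ← integral_const_mul]
  refine setIntegral_congr_fun measurableSet_Ioo fun s hs => ?_
  have hs1 : 0 < 1 - s := by linarith [hs.2]
  have hs0 := hs.1
  have hxs : 0 < 1 - x * s := by nlinarith [hs.2]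
  have e1 : (z - (z - 1) * s) ^ 2 - 1 = (z - 1) * (1 - s) * ((z + 1) * (1 - x * s)) := by
    rw [hx]; field_simp; ring
  have e2 : z - (z - (z - 1) * s) = (z - 1) * s := by ring
  have f1 : (z : ℂ) - 1 = ((z - 1 : ℝ) : ℂ) := by push_cast; rfl
  have f2 : (z : ℂ) + 1 = ((z + 1 : ℝ) : ℂ) := by push_cast; rfl
  have f3 : 1 - (s : ℂ) = ((1 - s : ℝ) : ℂ) := by push_cast; rfl
  have f4 : 1 - (x : ℂ) * s = ((1 - x * s : ℝ) : ℂ) := by push_cast; rfl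
  simp only [e1, e2]
  rw [f1, f2, f3, f4, abs_neg, abs_of_pos hz1, Complex.real_smul,
    ek_cp _ (by positivity), ek_cp _ (by positivity), ek_cp _ hz1, ek_cp _ hz2, ek_cp _ hs0,
    ek_cp _ hs1, ek_cp _ hxs, Real.log_mul (by positivity) (by positivity),
    Real.log_mul (by positivity) (by positivity), Real.log_mul (by positivity) (by positivity),
    Real.log_mul (by positivity) (by positivity)]
  nth_rewrite 1 [ek_exp_log _ hz1]
  simp only [← Complex.exp_add]
  congr 1
  push_cast
  ring

theorem ek_euler_trans (a b d : ℂ) (hb : 0 < b.re) (hd : 0 < d.re) (x : ℝ) (hx0 : 0 ≤ x)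
    (hx1 : x < 1) : hyp2F1reg a b (b + d) x =
      ((1 - x : ℝ) : ℂ) ^ (d - a) * hyp2F1reg (b + d - a) d (b + d) x := by
  have hgb := Complex.Gamma_ne_zero_of_re_pos hb
  have hgd := Complex.Gamma_ne_zero_of_re_pos hd
  refine mul_left_cancel₀ (mul_ne_zero hgb hgd) ?_
  rw [← ek_euler a b d hb hd x hx0 hx1]
  have E := ek_euler (b + d - a) d b hd hb x hx0 hx1
  rw [show Complex.Gamma b * Complex.Gamma d * (((1 - x : ℝ) : ℂ) ^ (d - a) *
    hyp2F1reg (b + d - a) d (b + d) x) = ((1 - x : ℝ) : ℂ) ^ (d - a) * (Complex.Gamma d *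
    Complex.Gamma b * hyp2F1reg (b + d - a) d (d + b) x) by rw [add_comm d b]; ring, ← E,
    ← integral_const_mul]
  have hxp : 0 < 1 - x := by linarith
  have hpos : ∀ t ∈ Ioo (0 : ℝ) 1, 0 < 1 - x * t := fun t ht => by nlinarith [ht.1, ht.2]
  set f : ℝ → ℝ := fun t => (1 - t) / (1 - x * t) with hf
  have hmaps : ∀ t ∈ Ioo (0 : ℝ) 1, f t ∈ Ioo (0 : ℝ) 1 := fun t ht => by
    have h := hpos t ht
    refine ⟨div_pos (by linarith [ht.2]) h, ?_⟩
    simp only [hf]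
    rw [div_lt_one h]
    nlinarith [ht.1, ht.2]
  have hinv : ∀ t ∈ Ioo (0 : ℝ) 1, f (f t) = t := fun t ht => by
    have h := hpos t ht
    have h1 : 1 - x * f t = (1 - x) / (1 - x * t) := by
      simp only [hf]; rw [eq_div_iff h.ne', sub_mul]
      field_simp [h.ne', show 1 - t * x ≠ 0 by rw [mul_comm]; exact h.ne']
      try ring
    have h2 : 1 - f t = t * (1 - x) / (1 - x * t) := by
      simp only [hf]; rw [eq_div_iff h.ne', sub_mul]
      field_simp [h.ne', show 1 - t * x ≠ 0 by rw [mul_comm]; exact h.ne']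
      try ring
    change (1 - f t) / (1 - x * f t) = t
    rw [h1, h2, div_div_div_cancel_right₀ h.ne', mul_div_cancel_right₀ _ hxp.ne']
  have himg : f '' Ioo 0 1 = Ioo 0 1 := by
    ext w
    exact ⟨fun ⟨s, hs, h⟩ => h ▸ hmaps s hs, fun hw => ⟨f w, hmaps w hw, hinv w hw⟩⟩
  have hinj : InjOn f (Ioo 0 1) := fun s hs t ht h => by
    rw [← hinv s hs, ← hinv t ht, h]
  have hder : ∀ t ∈ Ioo (0 : ℝ) 1, HasDerivWithinAt f
      (-((1 - x) / (1 - x * t) ^ 2)) (Ioo 0 1) t := fun t ht => by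
    have h := hpos t ht
    have h1 := ((hasDerivAt_id t).const_sub 1).div
      (((hasDerivAt_id t).const_mul x).const_sub 1) h.ne'
    refine (h1.congr_deriv ?_).hasDerivWithinAt
    simp only [id]
    field_simp
    ring
  have S := integral_image_eq_integral_abs_deriv_smul measurableSet_Ioo hder hinj
    (fun s : ℝ => (s : ℂ) ^ (b - 1) * (1 - (s : ℂ)) ^ (d - 1) *
        (1 - (x : ℂ) * s) ^ (-a))
  rw [himg] at S
  rw [S]
  refine setIntegral_congr_fun measurableSet_Ioo fun t ht => ?_
  have h := hpos t ht
  have ht0 := ht.1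
  have ht1 : 0 < 1 - t := by linarith [ht.2]
  have g1 : 1 - ((f t : ℝ) : ℂ) = ((t * (1 - x) / (1 - x * t) : ℝ) : ℂ) := by
    rw [← Complex.ofReal_one, ← Complex.ofReal_sub]
    congr 1
    simp only [hf]; rw [eq_div_iff h.ne', sub_mul]
    field_simp [h.ne', show 1 - t * x ≠ 0 by rw [mul_comm]; exact h.ne']
    try ring
  have g2 : 1 - (x : ℂ) * ((f t : ℝ) : ℂ) = (((1 - x) / (1 - x * t) : ℝ) : ℂ) := by
    rw [← Complex.ofReal_one, ← Complex.ofReal_mul, ← Complex.ofReal_sub]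
    congr 1
    simp only [hf]; rw [eq_div_iff h.ne', sub_mul]
    field_simp [h.ne', show 1 - t * x ≠ 0 by rw [mul_comm]; exact h.ne']
    try ring
  have f3 : 1 - (t : ℂ) = ((1 - t : ℝ) : ℂ) := by push_cast; rfl
  have f4 : 1 - (x : ℂ) * t = ((1 - x * t : ℝ) : ℂ) := by push_cast; rfl
  rw [g1, g2, f3, f4, abs_neg, abs_of_pos (by positivity), Complex.real_smul,
    ek_exp_log ((1 - x) / (1 - x * t) ^ 2) (by positivity)]
  simp only [hf]
  rw [ek_cp _ (by positivity), ek_cp _ (by positivity), ek_cp _ (by positivity), ek_cp _ hxp,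
    ek_cp _ ht0, ek_cp _ ht1, ek_cp _ h, Real.log_div (by positivity) (by positivity),
    Real.log_div (by positivity) (by positivity), Real.log_div (by positivity) (by positivity),
    Real.log_div (by positivity) (by positivity), Real.log_mul (by positivity) (by positivity),
    Real.log_pow]
  simp only [← Complex.exp_add]
  congr 1
  push_cast
  ring

theorem ek_term_bound {f : ℕ → ℂ} {s : ℂ} (h : HasSum f s) : ∃ M : ℝ, 0 ≤ M ∧ ∀ n, ‖f n‖ ≤ M :=
  ⟨∑' n, ‖f n‖, tsum_nonneg fun _ => norm_nonneg _,
    fun n => h.summable.norm.le_tsum n (fun _ _ => norm_nonneg _)⟩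

theorem ek_poch_bound (a : ℂ) : ∃ M : ℝ, 0 ≤ M ∧
    ∀ n : ℕ, ‖(ascPochhammer ℂ n).eval a‖ ≤ M * 2 ^ n * n.factorial := by
  obtain ⟨M, hM, h⟩ := ek_term_bound (ek_binom a (1 / 2) (by norm_num))
  refine ⟨M, hM, fun n => ?_⟩
  have := h n
  rw [norm_mul, norm_div, norm_pow, norm_div, Complex.norm_natCast] at this
  norm_num at this
  have hf : (0 : ℝ) < n.factorial := by exact_mod_cast n.factorial_pos
  rw [div_mul_eq_mul_div, div_le_iff₀ hf, one_div, inv_pow, ← div_eq_mul_inv,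
    div_le_iff₀ (by positivity)] at this
  linarith

theorem ek_gamma_bound (c : ℂ) : ∃ M : ℝ, 0 ≤ M ∧
    ∀ n : ℕ, ‖(Complex.Gamma (c + n))⁻¹‖ ≤ M * 2 ^ n / n.factorial := by
  obtain ⟨M, hM, h⟩ := ek_term_bound (ek_hyp_hasSum 1 1 c (1 / 2) (by norm_num))
  refine ⟨M, hM, fun n => ?_⟩
  have := h n
  have hf : (0 : ℝ) < n.factorial := by exact_mod_cast n.factorial_pos
  have hfc : (n.factorial : ℂ) ≠ 0 := by exact_mod_cast n.factorial_ne_zero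
  rw [ascPochhammer_eval_one, mul_div_mul_right _ _ hfc, norm_mul, norm_pow, norm_div, norm_div,
    Complex.norm_natCast] at this
  norm_num at this
  rw [one_div, inv_pow, ← div_eq_mul_inv, div_le_iff₀ (by positivity)] at this
  rw [le_div_iff₀ hf, norm_inv, ← div_eq_inv_mul]
  exact this

theorem ek_fact_bound (n k : ℕ) : ((2 * n + k).factorial : ℝ) ≤
    2 ^ (4 * n + k) * (n.factorial * n.factorial * k.factorial) := by
  have h1 := Nat.add_choose_mul_factorial_mul_factorial (2 * n) k
  have h2 := Nat.add_choose_mul_factorial_mul_factorial n n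
  have h3 := Nat.choose_le_two_pow (2 * n + k) k
  have h4 := Nat.choose_le_two_pow (n + n) n
  have : (2 * n + k).factorial ≤
      2 ^ (4 * n + k) * (n.factorial * n.factorial * k.factorial) := by
    rw [← h1, show 2 * n = n + n by ring, ← h2]
    rw [show 2 * n = n + n by ring] at h3
    calc _ ≤ 2 ^ (n + n + k) * (2 ^ (n + n) * n.factorial * n.factorial) * k.factorial := by
          gcongr
      _ = _ := by
          rw [show 4 * n + k = (n + n + k) + (n + n) by ring, pow_add 2 (n + n + k)]; ring
  exact_mod_cast this

theorem ek_dup (a : ℂ) (n : ℕ) : (ascPochhammer ℂ (2 * n)).eval a =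
    4 ^ n * ((ascPochhammer ℂ n).eval (a / 2) * (ascPochhammer ℂ n).eval (a / 2 + 1 / 2)) := by
  induction n with
  | zero => simp
  | succ n ih =>
    rw [show 2 * (n + 1) = 2 * n + 1 + 1 by ring, ascPochhammer_succ_eval,
      ascPochhammer_succ_eval, ih, ascPochhammer_succ_eval, ascPochhammer_succ_eval]
    push_cast
    ring

theorem ek_antidiag (a c x : ℂ) (hc : 0 < c.re) (m : ℕ) :
    ∑ p ∈ Finset.HasAntidiagonal.antidiagonal m, (ascPochhammer ℂ (2 * p.1 + p.2)).eval a *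
      (Complex.Gamma (c + p.1))⁻¹ * (-1) ^ p.2 * x ^ (p.1 + p.2) /
      (p.1.factorial * p.2.factorial : ℂ) =
    (ascPochhammer ℂ m).eval a * (ascPochhammer ℂ m).eval (1 + a - c) /
      (Complex.Gamma (c + m) * (m.factorial : ℂ)) * x ^ m := by
  rw [Finset.Nat.sum_antidiagonal_eq_sum_range_succ (fun i j =>
    (ascPochhammer ℂ (2 * i + j)).eval a *
      (Complex.Gamma (c + i))⁻¹ * (-1) ^ j * x ^ (i + j) /
      (i.factorial * j.factorial : ℂ)), ← ek_refl (1 + a - c),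
    show 1 - (1 + a - c) - m = c - (a + m) by ring, ← ek_vand m (a + m) c]
  rw [Finset.sum_mul, Finset.mul_sum, Finset.sum_div, Finset.sum_mul]
  refine Finset.sum_congr rfl fun n hn => ?_
  have hn : n ≤ m := by simpa [Nat.lt_succ_iff] using hn
  obtain ⟨k, rfl⟩ := Nat.exists_eq_add_of_le hn
  rw [Nat.add_sub_cancel_left]
  have hcn : 0 < (c + n).re := by simp; linarith [(Nat.cast_nonneg n : (0 : ℝ) ≤ n)]
  have hcm : 0 < (c + (n + k : ℕ)).re := by
    simp; linarith [(Nat.cast_nonneg n : (0 : ℝ) ≤ n), (Nat.cast_nonneg k : (0 : ℝ) ≤ k)]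
  have g1 := Complex.Gamma_ne_zero_of_re_pos hcn
  have g2 := Complex.Gamma_ne_zero_of_re_pos hcm
  have g3 := ek_gamma_add (c + n) hcn k
  rw [add_assoc, ← Nat.cast_add] at g3
  have h1 := Nat.add_choose_mul_factorial_mul_factorial n k
  rw [← Nat.choose_symm_add] at h1
  have h1 : ((n + k).choose n : ℂ) * n.factorial * k.factorial = (n + k).factorial := by
    exact_mod_cast h1
  have f1 : (n.factorial : ℂ) ≠ 0 := by exact_mod_cast n.factorial_ne_zero
  have f2 : (k.factorial : ℂ) ≠ 0 := by exact_mod_cast k.factorial_ne_zero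
  have f3 : ((n + k).choose n : ℂ) ≠ 0 := by
    exact_mod_cast (Nat.choose_pos (Nat.le_add_right n k)).ne'
  have hp : (ascPochhammer ℂ k).eval (c + n) ≠ 0 := fun h => g2 (by rw [g3, h, zero_mul])
  rw [show 2 * n + k = (n + k) + n by ring, ek_poch_add a (n + k) n, g3, ← h1]
  have s1 : ((-1 : ℂ)) ^ n * (-1) ^ (n + k) = (-1) ^ k := by
    rw [pow_add, ← mul_assoc, ← mul_pow]; simp
  rw [← s1]
  field_simp

theorem ek_quad_near (a c x : ℂ) (hc : 0 < c.re) (hx : ‖x‖ ≤ 1 / 256) :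
    (1 + x) ^ (-a) * hyp2F1reg (a / 2) (a / 2 + 1 / 2) c (4 * x / (1 + x) ^ 2) =
      hyp2F1reg a (1 + a - c) c x := by
  set T : ℕ × ℕ → ℂ := fun p => (ascPochhammer ℂ (2 * p.1 + p.2)).eval a *
      (Complex.Gamma (c + p.1))⁻¹ * (-1) ^ p.2 * x ^ (p.1 + p.2) /
      (p.1.factorial * p.2.factorial : ℂ) with hT
  have hx1 : ‖x‖ < 1 := by linarith
  have h1x : (1 + x) ≠ 0 := by
    intro h
    have : x = -1 := by linear_combination h
    rw [this] at hx1; simp at hx1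
  have hsum : Summable T := by
    obtain ⟨M, hM, hp⟩ := ek_poch_bound a
    obtain ⟨M', hM', hg⟩ := ek_gamma_bound c
    have hgeo : Summable fun p : ℕ × ℕ => ((1 : ℝ) / 2) ^ p.1 * (1 / 2) ^ p.2 :=
      summable_geometric_two.mul_of_nonneg summable_geometric_two
        (fun n => by positivity) (fun n => by positivity)
    refine Summable.of_norm_bounded (hgeo.mul_left (M * M')) ?_
    rintro ⟨n, k⟩
    have hn : (0 : ℝ) < n.factorial := by exact_mod_cast n.factorial_pos
    have hk : (0 : ℝ) < k.factorial := by exact_mod_cast k.factorial_pos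
    simp only [hT]
    rw [norm_div, norm_mul, norm_mul, norm_mul, norm_pow, norm_pow, norm_neg, norm_one, one_pow,
      mul_one, norm_mul, Complex.norm_natCast, Complex.norm_natCast, div_le_iff₀ (by positivity)]
    calc _ ≤ (M * 2 ^ (2 * n + k) * (2 * n + k).factorial) * (M' * 2 ^ n / n.factorial) *
          (1 / 256) ^ (n + k) := by
          gcongr
          · exact hp _
          · exact hg _
      _ ≤ (M * 2 ^ (2 * n + k) * (2 ^ (4 * n + k) * (n.factorial * n.factorial * k.factorial))) *
          (M' * 2 ^ n / n.factorial) * (1 / 256) ^ (n + k) := by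
          gcongr
          exact ek_fact_bound n k
      _ = M * M' * ((1 / 2) ^ n * (1 / 64) ^ k) * (n.factorial * k.factorial) := by
          have e1 : (2 : ℝ) ^ (2 * n + k) * 2 ^ (4 * n + k) * 2 ^ n * (1 / 256) ^ (n + k) =
              (1 / 2) ^ n * (1 / 64) ^ k := by
            rw [show (1 / 2 : ℝ) = 2 ^ 7 * (1 / 256) by norm_num,
              show (1 / 64 : ℝ) = 2 ^ 2 * (1 / 256) by norm_num, mul_pow, mul_pow, ← pow_mul,
              ← pow_mul, pow_add (1 / 256 : ℝ)]
            ring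
          rw [← e1]
          field_simp
      _ ≤ _ := by
          gcongr
          norm_num
  have hA : ∀ n : ℕ, HasSum (fun k => T (n, k)) ((1 + x) ^ (-a) *
      ((ascPochhammer ℂ n).eval (a / 2) * (ascPochhammer ℂ n).eval (a / 2 + 1 / 2) /
      (Complex.Gamma (c + n) * (n.factorial : ℂ)) * (4 * x / (1 + x) ^ 2) ^ n)) := by
    intro n
    have h := (ek_binom (a + (2 * n : ℕ)) (-x) (by simpa using hx1)).mul_left
      ((ascPochhammer ℂ (2 * n)).eval a * (Complex.Gamma (c + n))⁻¹ * x ^ n / n.factorial)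
    rw [sub_neg_eq_add, neg_add, Complex.cpow_add _ _ h1x, Complex.cpow_neg _ ((2 * n : ℕ) : ℂ),
      Complex.cpow_natCast] at h
    refine Eq.mp (congrArg₂ (fun f s => HasSum f s) (funext fun k => ?_) ?_) h
    · simp only [hT]
      rw [ek_poch_add, neg_pow, pow_add]
      have f1 : (n.factorial : ℂ) ≠ 0 := by exact_mod_cast n.factorial_ne_zero
      have f2 : (k.factorial : ℂ) ≠ 0 := by exact_mod_cast k.factorial_ne_zero
      field_simp
    · rw [ek_dup, div_pow, mul_pow, pow_mul (1 + x)]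
      generalize (ascPochhammer ℂ n).eval (a / 2) = P1
      generalize (ascPochhammer ℂ n).eval (a / 2 + 1 / 2) = P2
      simp only [div_eq_mul_inv, mul_inv]
      ring
  have hB := (hsum.hasSum.prod_fiberwise hA)
  have hx4 : ‖4 * x / (1 + x) ^ 2‖ < 1 := by
    have : 255 / 256 ≤ ‖1 + x‖ := by
      have := norm_sub_norm_le (1 : ℂ) (-x)
      rw [sub_neg_eq_add, norm_neg, norm_one] at this
      linarith
    rw [norm_div, norm_pow, norm_mul, div_lt_one (by positivity)]
    norm_num
    nlinarith
  have hB' := (ek_hyp_hasSum (a / 2) (a / 2 + 1 / 2) c _ hx4).mul_left ((1 + x) ^ (-a))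
  have e1 := hB'.unique hB
  have hS := (Finset.HasAntidiagonal.sigmaAntidiagonalEquivProd.hasSum_iff (f := T)).mpr hsum.hasSum
  have hC := hS.sigma (fun m => hasSum_fintype _)
  rw [e1]
  refine hC.unique ?_
  refine Eq.mp (congrArg (fun f => HasSum f _) (funext fun m => ?_))
    (ek_hyp_hasSum a (1 + a - c) c x hx1)
  rw [← ek_antidiag a c x hc m, ← Finset.sum_coe_sort]
  rfl

theorem ek_hyp_comm (a b c x : ℂ) : hyp2F1reg a b c x = hyp2F1reg b a c x := by
  simp only [hyp2F1reg]
  exact tsum_congr fun n => by rw [mul_comm ((ascPochhammer ℂ n).eval a)]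

theorem ek_analytic_ofReal (G : ℂ → ℂ) (x : ℝ) (h : AnalyticAt ℂ G x) :
    AnalyticAt ℝ (fun t : ℝ => G t) x :=
  AnalyticAt.comp (g := G) (f := fun t : ℝ => (t : ℂ)) h.restrictScalars
    (Complex.ofRealCLM.analyticAt x)

theorem ek_quad (a c : ℂ) (x : ℝ) (hc : 0 < c.re) (hx0 : 0 ≤ x) (hx1 : x < 1) :
    (1 + (x : ℂ)) ^ (-a) *
      hyp2F1reg (a / 2) (a / 2 + 1 / 2) c (4 * (x : ℂ) / (1 + (x : ℂ)) ^ 2) =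
      hyp2F1reg a (1 + a - c) c x := by
  set G : ℂ → ℂ := fun x => (1 + x) ^ (-a) *
      hyp2F1reg (a / 2) (a / 2 + 1 / 2) c (4 * x / (1 + x) ^ 2) with hG
  have hGa : AnalyticOnNhd ℝ (fun t : ℝ => G t) (Ioo (-1 / 10) 1) := by
    rintro t ⟨h1, h2⟩
    refine ek_analytic_ofReal G t ?_
    have hpos : 0 < 1 + t := by linarith
    have h1a : AnalyticAt ℂ (fun x : ℂ => 1 + x) (t : ℂ) := analyticAt_const.add analyticAt_id
    have hcast : (1 : ℂ) + t = ((1 + t : ℝ) : ℂ) := by push_cast; rfl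
    have hne : (1 : ℂ) + t ≠ 0 := by rw [hcast]; exact_mod_cast hpos.ne'
    refine AnalyticAt.mul (h1a.cpow analyticAt_const ?_) ?_
    · rw [hcast]; exact Complex.ofReal_mem_slitPlane.mpr hpos
    · refine AnalyticAt.fun_comp (g := hyp2F1reg (a / 2) (a / 2 + 1 / 2) c) (ek_hyp_analytic _ _ _ _ ?_)
        ((analyticAt_const.mul analyticAt_id).div (h1a.pow 2) (pow_ne_zero 2 hne))
      have : 4 * (t : ℂ) / (1 + (t : ℂ)) ^ 2 = ((4 * t / (1 + t) ^ 2 : ℝ) : ℂ) := by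
        push_cast; rfl
      rw [this, Complex.norm_real, Real.norm_eq_abs, abs_div, abs_of_pos (pow_pos hpos 2),
        div_lt_one (by positivity), abs_lt]
      constructor <;> nlinarith
  have hHa : AnalyticOnNhd ℝ (fun t : ℝ => hyp2F1reg a (1 + a - c) c t) (Ioo (-1 / 10) 1) := by
    rintro t ⟨h1, h2⟩
    refine ek_analytic_ofReal _ t (ek_hyp_analytic _ _ _ _ ?_)
    rw [Complex.norm_real, Real.norm_eq_abs, abs_lt]
    constructor <;> linarith
  refine hGa.eqOn_of_preconnected_of_eventuallyEq hHa isPreconnected_Ioo (z₀ := 0)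
    (by constructor <;> norm_num) ?_ ⟨by linarith, hx1⟩
  filter_upwards [Metric.ball_mem_nhds (0 : ℝ) (show (0 : ℝ) < 1 / 256 by norm_num)] with t ht
  exact ek_quad_near a c t hc (by simpa using (mem_ball_zero_iff.mp ht).le)

theorem ek_part2 (α β : ℂ) (hβ : -(1 / 2 : ℝ) < β.re) (hαβ : 0 < (α - β).re)
    (z : ℝ) (hz : 1 < z) :
    hyp2F1reg (1 / 2 - β) (α - β) (α + 1 / 2) (((z - 1) / (z + 1) : ℝ) : ℂ) =
    ((2 * z / (z + 1) : ℝ) : ℂ) ^ (-(α - β)) * (((1 / z ^ 2 : ℝ) : ℂ) ^ β *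
      hyp2F1reg ((α + β) / 2) ((α + β + 1) / 2) (α + 1 / 2) (((z ^ 2 - 1) / z ^ 2 : ℝ) : ℂ)) := by
  have hz2 : 0 < z + 1 := by linarith
  have hz0 : 0 < z := by linarith
  have hre : 0 < α.re - β.re := by simpa using hαβ
  have q := ek_quad (α - β) (α + 1 / 2) ((z - 1) / (z + 1)) (by simp; linarith)
    (div_nonneg (by linarith) (by linarith)) (by rw [div_lt_one hz2]; linarith)
  have c1 : 1 + (((z - 1) / (z + 1) : ℝ) : ℂ) = ((2 * z / (z + 1) : ℝ) : ℂ) := by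
    rw [← Complex.ofReal_one, ← Complex.ofReal_add]; congr 1; field_simp; ring
  have c2 : 4 * (((z - 1) / (z + 1) : ℝ) : ℂ) / ((2 * z / (z + 1) : ℝ) : ℂ) ^ 2 =
      (((z ^ 2 - 1) / z ^ 2 : ℝ) : ℂ) := by
    rw [← Complex.ofReal_ofNat, ← Complex.ofReal_pow, ← Complex.ofReal_mul, ← Complex.ofReal_div]
    congr 1; field_simp; ring
  rw [c1, c2, show 1 + (α - β) - (α + 1 / 2) = 1 / 2 - β by ring] at q
  have t := ek_euler_trans ((α - β) / 2 + 1 / 2) ((α - β) / 2) ((α + β + 1) / 2)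
    (by simpa using hre) (by simp; linarith) ((z ^ 2 - 1) / z ^ 2)
    (div_nonneg (by nlinarith) (by positivity)) (by rw [div_lt_one (by positivity)]; linarith)
  rw [show (α - β) / 2 + (α + β + 1) / 2 = α + 1 / 2 by ring,
    show α + 1 / 2 - ((α - β) / 2 + 1 / 2) = (α + β) / 2 by ring,
    show (α + β + 1) / 2 - ((α - β) / 2 + 1 / 2) = β by ring,
    show 1 - (z ^ 2 - 1) / z ^ 2 = 1 / z ^ 2 by field_simp; ring] at t
  rw [ek_hyp_comm, ← q, ek_hyp_comm, t]
/-- Evaluation of an Euler-type integral (Lemma on the kernel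
integral). -/
theorem euler_kernel_integral
    (α β : ℂ) (hβ : -(1 / 2 : ℝ) < β.re) (hαβ : 0 < (α - β).re)
    (z : ℝ) (hz : 1 < z) :
    (∫ w in Ioo (1 : ℝ) z,
        ((w ^ 2 - 1 : ℝ) : ℂ) ^ (β - 1 / 2) * ((z - w : ℝ) : ℂ) ^ (α - β - 1)) =
      Complex.Gamma (β + 1 / 2) * Complex.Gamma (α - β) * ((z : ℂ) - 1) ^ (α - 1 / 2) *
        ((z : ℂ) + 1) ^ (β - 1 / 2) *
        hyp2F1reg (1 / 2 - β) (α - β) (α + 1 / 2) (((z : ℂ) - 1) / ((z : ℂ) + 1)) ∧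
    ((∀ n : ℕ, α + β ≠ -(n : ℂ)) →
      (∫ w in Ioo (1 : ℝ) z,
          ((w ^ 2 - 1 : ℝ) : ℂ) ^ (β - 1 / 2) * ((z - w : ℝ) : ℂ) ^ (α - β - 1)) =
        Complex.exp (-(Real.pi : ℂ) * Complex.I * β) * (2 : ℂ) ^ β *
            Complex.Gamma (β + 1 / 2) * Complex.Gamma (α - β) /
          ((Real.sqrt Real.pi : ℂ) * Complex.Gamma (α + β)) *
          ((z ^ 2 - 1 : ℝ) : ℂ) ^ ((α - 1) / 2) *
          legendreQ (α - 1) β (z / Real.sqrt (z ^ 2 - 1))) := by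
  have h1 := ek_part1 α β hβ hαβ z hz
  refine ⟨h1, fun hn => ?_⟩
  rw [h1]
  have hz1 : 0 < z - 1 := by linarith
  have hz2 : 0 < z + 1 := by linarith
  have hz0 : 0 < z := by linarith
  have hq : 0 < z ^ 2 - 1 := by nlinarith
  have hr : 0 < Real.sqrt (z ^ 2 - 1) := Real.sqrt_pos.mpr hq
  have hr2 : Real.sqrt (z ^ 2 - 1) ^ 2 = z ^ 2 - 1 := Real.sq_sqrt hq.le
  have hxc : ((z : ℂ) - 1) / ((z : ℂ) + 1) = (((z - 1) / (z + 1) : ℝ) : ℂ) := by push_cast; rfl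
  have f1 : (z : ℂ) - 1 = ((z - 1 : ℝ) : ℂ) := by push_cast; rfl
  have f2 : (z : ℂ) + 1 = ((z + 1 : ℝ) : ℂ) := by push_cast; rfl
  have f3 : (2 : ℂ) = ((2 : ℝ) : ℂ) := by push_cast; rfl
  have g1 : ((z / Real.sqrt (z ^ 2 - 1) : ℝ) : ℂ) ^ 2 - 1 = ((1 / (z ^ 2 - 1) : ℝ) : ℂ) := by
    rw [← Complex.ofReal_one, ← Complex.ofReal_pow, ← Complex.ofReal_sub]
    congr 1
    rw [div_pow, hr2]
    field_simp
    ring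
  have g2 : 1 / ((z / Real.sqrt (z ^ 2 - 1) : ℝ) : ℂ) ^ 2 = (((z ^ 2 - 1) / z ^ 2 : ℝ) : ℂ) := by
    rw [← Complex.ofReal_one, ← Complex.ofReal_pow, ← Complex.ofReal_div]
    congr 1
    rw [div_pow, hr2]
    field_simp
  have hG : Complex.Gamma (α + β) ≠ 0 := Complex.Gamma_ne_zero hn
  have hpi : (Real.sqrt Real.pi : ℂ) ≠ 0 := by
    exact_mod_cast (Real.sqrt_pos.mpr Real.pi_pos).ne'
  rw [hxc, ek_part2 α β hβ hαβ z hz, legendreQ, g1, g2,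
    show α - 1 + β + 1 = α + β by ring, show α - 1 + β + 2 = α + β + 1 by ring,
    show α - 1 + 3 / 2 = α + 1 / 2 by ring]
  generalize hyp2F1reg ((α + β) / 2) ((α + β + 1) / 2) (α + 1 / 2)
    (((z ^ 2 - 1) / z ^ 2 : ℝ) : ℂ) = H
  have hlq : Real.log (z ^ 2 - 1) = Real.log (z - 1) + Real.log (z + 1) := by
    rw [← Real.log_mul hz1.ne' hz2.ne']; congr 1; ring
  have P1 : ((z : ℂ) - 1) ^ (α - 1 / 2) * ((z : ℂ) + 1) ^ (β - 1 / 2) *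
      (((2 * z / (z + 1) : ℝ) : ℂ) ^ (-(α - β)) * ((1 / z ^ 2 : ℝ) : ℂ) ^ β) =
      (Complex.exp (-(Real.pi : ℂ) * Complex.I * β) * Complex.exp ((Real.pi : ℂ) * Complex.I * β)) *
      ((2 : ℂ) ^ β * ((z ^ 2 - 1 : ℝ) : ℂ) ^ ((α - 1) / 2) *
      (((1 / (z ^ 2 - 1) : ℝ) : ℂ) ^ (β / 2) * (2 : ℂ) ^ (-(α - 1) - 1) *
        ((z / Real.sqrt (z ^ 2 - 1) : ℝ) : ℂ) ^ (-(α - 1) - β - 1))) := by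
    rw [f1, f2, ek_cp _ hz1, ek_cp _ hz2, ek_cp _ hq, ek_cp _ (by positivity),
      ek_cp _ (by positivity), ek_cp _ (by positivity), ek_cp _ (by positivity),
      Real.log_div (by positivity) (by positivity), Real.log_div (by positivity) (by positivity),
      Real.log_div (by positivity) (by positivity), Real.log_div (by positivity) (by positivity),
      Real.log_mul (by positivity) (by positivity), Real.log_pow, Real.log_one,
      Real.log_sqrt hq.le, hlq, f3, ek_cp 2 (by norm_num), ek_cp 2 (by norm_num)]
    simp only [← Complex.exp_add]
    congr 1
    push_cast
    ring
  have e : ∀ A B C D E F K : ℂ, A * B * C * D * (E * (F * K)) =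
      (A * B * K) * (C * D * (E * F)) := by intros; ring
  rw [e, P1]
  field_simp
end
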